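/- Let F: K → M and G: L → M be colimit-preserving functors between locally presentable categories, and suppose cofibrant generation: cof(K) = cof(S_K) and cof(L) = cof(S_L) for sets S_K, S_L, with F and G preserving cofibrations. Then the class Ps(cof K, cof L) on the pseudopullback P of F and G, consisting of morphisms whose projections to K and L are cofibrations, is cofibrantly generated by a set of morphisms of P; in fact it equals cell(X) for the set X of morphisms f of P between κ-presentable objects with both projections cofibrations, for suitably large regular κ. -/

import Mathlib

open CategoryTheory Category Limits Opposite

universe w v u u' u''

namespace CellularPaper

variable {K : Type u} [Category.{v} K]

/-- The restriction of a chain `F : J ⥤ K` to the elements below `j`. -/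
def restrictionLT {J : Type w} [Preorder J] (F : J ⥤ K) (j : J) :
    {i : J // i < j} ⥤ K :=
  (Monotone.functor (f := fun i : {i : J // i < j} => (i : J)) fun _ _ h => h) ⋙ F

/-- The cocone on the restriction of `F` below `j` with apex `F.obj j`. -/
@[simps]
def coconeLT {J : Type w} [Preorder J] (F : J ⥤ K) (j : J) :
    Cocone (restrictionLT F j) where
  pt := F.obj j
  ι :=
    { app := fun i => F.map (homOfLE i.2.le)
      naturality := fun i i' h => by
        dsimp [restrictionLT, Monotone.functor]
        rw [← F.map_comp]
        simp }

/-- `f` is a transfinite composite of a smooth chain with links in `C`. -/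
def IsTransfiniteCompositionOf (C : MorphismProperty K) : MorphismProperty K :=
  fun A B f =>
    ∃ (J : Type w) (_ : LinearOrder J) (_ : SuccOrder J) (_ : OrderBot J)
      (_ : WellFoundedLT J) (F : J ⥤ K) (c : Cocone F) (_ : IsColimit c)
      (eA : A ≅ F.obj ⊥) (eB : c.pt ≅ B),
      (∀ j : J, ¬IsMax j → C (F.map (homOfLE (Order.le_succ j)))) ∧
      (∀ j : J, Order.IsSuccLimit j → Nonempty (IsColimit (coconeLT F j))) ∧
      eA.hom ≫ c.ι.app ⊥ ≫ eB.hom = f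

/-- A cellular structure: a class of morphisms containing all isomorphisms and closed
under pushout and transfinite composition. -/
structure IsCellular (C : MorphismProperty K) : Prop where
  isos : ∀ {A B : K} (f : A ⟶ B), IsIso f → C f
  pushout : ∀ {A B A' B' : K} {f : A ⟶ B} {u : A ⟶ A'} {v : B ⟶ B'} {g : A' ⟶ B'},
    IsPushout f u v g → C f → C g
  transfinite : ∀ {A B : K} (f : A ⟶ B), IsTransfiniteCompositionOf.{v} C f → C f

/-- `f` is a retract of `g` in the arrow category. -/
def IsRetractOf {A B X Y : K} (f : A ⟶ B) (g : X ⟶ Y) : Prop :=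
  ∃ (u : A ⟶ X) (v : B ⟶ Y) (r : X ⟶ A) (s : Y ⟶ B),
    u ≫ g = f ≫ v ∧ r ≫ f = g ≫ s ∧ u ≫ r = 𝟙 A ∧ v ≫ s = 𝟙 B

/-- The class of retracts of morphisms in `C`. -/
def retracts (C : MorphismProperty K) : MorphismProperty K :=
  fun _ _ f => ∃ (X Y : K) (g : X ⟶ Y), C g ∧ IsRetractOf f g

/-- The class of pushouts of morphisms in `C`. -/
def Po (C : MorphismProperty K) : MorphismProperty K :=
  fun A' B' g => ∃ (A B : K) (f : A ⟶ B) (u : A ⟶ A') (v : B ⟶ B'),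
    C f ∧ IsPushout f u v g

/-- A κ-directed preorder. -/
def IsCardinalDirected (P : Type v) [Preorder P] (κ : Cardinal.{v}) : Prop :=
  ∀ S : Set P, Cardinal.mk S < κ → ∃ p : P, ∀ s ∈ S, s ≤ p

/-- A κ-presentable object: its hom-functor preserves κ-directed colimits. -/
def IsCardinalPresentable (κ : Cardinal.{v}) (A : K) : Prop :=
  ∀ (P : Type v) (_ : Preorder P), IsCardinalDirected P κ →
    Nonempty (PreservesColimitsOfShape P (coyoneda.obj (op A)))

/-- A locally κ-presentable category. -/
structure IsLocallyPresentable (κ : Cardinal.{v}) (K : Type u) [Category.{v} K] : Prop where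
  regular : κ.IsRegular
  hasColimits : HasColimits K
  generators : ∃ (ι : Type v) (G : ι → K), (∀ i, IsCardinalPresentable κ (G i)) ∧
    ∀ X : K, ∃ (P : Type v) (_ : Preorder P) (F : P ⥤ K) (c : Cocone F) (_ : IsColimit c),
      IsCardinalDirected P κ ∧ Nonempty (c.pt ≅ X) ∧ ∀ p : P, ∃ i, Nonempty (F.obj p ≅ G i)

/-- A locally presentable category. -/
def LocallyPresentable (K : Type u) [Category.{v} K] : Prop :=
  ∃ κ : Cardinal.{v}, IsLocallyPresentable κ K

/-- The smallest cellular class containing `X`. -/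
def cellClosure (X : MorphismProperty K) : MorphismProperty K :=
  fun _ _ f => ∀ C : MorphismProperty K, IsCellular C → X ≤ C → C f

/-- `cof(X)`: retracts of transfinite composites of pushouts of `X`. -/
def cofClosure (X : MorphismProperty K) : MorphismProperty K :=
  retracts (IsTransfiniteCompositionOf.{v} (Po X))

/-- The morphism property generated by a family of morphisms. -/
def ofFamily {ι : Type*} {a b : ι → K} (s : ∀ i, a i ⟶ b i) : MorphismProperty K :=
  fun _ _ f => ∃ i, Nonempty (Arrow.mk f ≅ Arrow.mk (s i))

/-- `C` is cofibrantly generated by a set of morphisms. -/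
def IsCofibrantlyGenerated (C : MorphismProperty K) : Prop :=
  ∃ (ι : Type v) (a b : ι → K) (s : ∀ i, a i ⟶ b i),
    C = cofClosure (ofFamily s)

/-- A combinatorial structure on a locally presentable category. -/
structure IsCombinatorial (K : Type u) [Category.{v} K] (C : MorphismProperty K) : Prop where
  locallyPresentable : LocallyPresentable K
  cellular : IsCellular C
  retractClosed : retracts C ≤ C
  cofibrantlyGenerated : IsCofibrantlyGenerated C

/-- `f` is a transfinite composite of length `< κ` of morphisms in `C`. -/
def IsBoundedTransfiniteCompositionOf (κ : Cardinal.{v}) (C : MorphismProperty K) :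
    MorphismProperty K :=
  fun A B f =>
    ∃ (J : Type v) (_ : LinearOrder J) (_ : SuccOrder J) (_ : OrderBot J)
      (_ : WellFoundedLT J), Cardinal.mk J < κ ∧
      ∃ (F : J ⥤ K) (c : Cocone F) (_ : IsColimit c)
        (eA : A ≅ F.obj ⊥) (eB : c.pt ≅ B),
        (∀ j : J, ¬IsMax j → C (F.map (homOfLE (Order.le_succ j)))) ∧
        (∀ j : J, Order.IsSuccLimit j → Nonempty (IsColimit (coconeLT F j))) ∧
        eA.hom ≫ c.ι.app ⊥ ≫ eB.hom = f

/-- The morphisms of `C` with κ-presentable domain and codomain. -/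
def betweenPresentable (κ : Cardinal.{v}) (C : MorphismProperty K) : MorphismProperty K :=
  fun A B f => C f ∧ IsCardinalPresentable κ A ∧ IsCardinalPresentable κ B

/-- `Po_κ(X)`: pushouts of morphisms of `X` between κ-presentable objects. -/
def PoCard (κ : Cardinal.{v}) (X : MorphismProperty K) : MorphismProperty K :=
  betweenPresentable κ (Po X)

/-- The category `psh(K²)`: objects are morphisms of `K`, morphisms are pushout squares. -/
structure PshArrow (K : Type u) [Category.{v} K] : Type max u v where
  arr : Arrow K

instance : Category.{v} (PshArrow K) where
  Hom g f := {φ : g.arr ⟶ f.arr // IsPushout g.arr.hom φ.left φ.right f.arr.hom}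
  id g := ⟨𝟙 _, IsPushout.of_vert_isIso ⟨by simp⟩⟩
  comp φ ψ := ⟨φ.1 ≫ ψ.1, φ.2.paste_vert ψ.2⟩
  id_comp φ := Subtype.ext (Category.id_comp _)
  comp_id φ := Subtype.ext (Category.comp_id _)
  assoc _ _ _ := Subtype.ext (Category.assoc _ _ _)


section PsPull

variable {K : Type u} {L : Type u'} {M : Type u''}
variable [Category.{v} K] [Category.{v} L] [Category.{v} M]

/-- The pseudopullback of `F : K ⥤ M` and `G : L ⥤ M`. -/
structure PsPull (F : K ⥤ M) (G : L ⥤ M) : Type max u u' v where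
  k : K
  l : L
  t : F.obj k ≅ G.obj l

variable {F : K ⥤ M} {G : L ⥤ M}

/-- Morphisms in the pseudopullback. -/
@[ext]
structure PsHom (a b : PsPull F G) : Type v where
  hk : a.k ⟶ b.k
  hl : a.l ⟶ b.l
  w : F.map hk ≫ b.t.hom = a.t.hom ≫ G.map hl

instance : Category.{v} (PsPull F G) where
  Hom := PsHom
  id a := ⟨𝟙 _, 𝟙 _, by simp⟩
  comp f g := ⟨f.hk ≫ g.hk, f.hl ≫ g.hl, by
    rw [F.map_comp, G.map_comp, Category.assoc, g.w, ← Category.assoc, f.w,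
      Category.assoc]⟩

/-- The first projection of the pseudopullback. -/
def projK (F : K ⥤ M) (G : L ⥤ M) : PsPull F G ⥤ K where
  obj a := a.k
  map f := f.hk

/-- The second projection of the pseudopullback. -/
def projL (F : K ⥤ M) (G : L ⥤ M) : PsPull F G ⥤ L where
  obj a := a.l
  map f := f.hl

/-- `Ps(C, D)`: morphisms of the pseudopullback whose projections lie in `C` and `D`. -/
def PsClass (C : MorphismProperty K) (D : MorphismProperty L) :
    MorphismProperty (PsPull F G) :=
  fun _ _ f => C f.hk ∧ D f.hl

end PsPull

end CellularPaper

namespace CellularChain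

section Presentable

variable {C : Type u} [Category.{v} C] (κ : Cardinal.{v}) [Fact κ.IsRegular]

lemma isCardinalFiltered_of_isCardinalDirected {P : Type v} [Preorder P]
    (h : CellularPaper.IsCardinalDirected P κ) : IsCardinalFiltered P κ :=
  isCardinalFiltered_preorder _ _ fun K s hK => by
    obtain ⟨p, hp⟩ := h (Set.range s) (Cardinal.mk_range_le.trans_lt hK)
    exact ⟨p, fun k => hp _ ⟨k, rfl⟩⟩

lemma isCardinalDirected_of_isCardinalFiltered (P : Type v) [Preorder P]
    [IsCardinalFiltered P κ] : CellularPaper.IsCardinalDirected P κ := fun S hS =>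
  ⟨IsCardinalFiltered.max (κ := κ) (fun s : S => s.1)
    (by rwa [hasCardinalLT_iff_cardinal_mk_lt]),
    fun s hs => leOfHom (IsCardinalFiltered.toMax (κ := κ) (fun s : S => s.1) _ ⟨s, hs⟩)⟩

lemma isCardinalPresentable_iff (A : C) :
    CellularPaper.IsCardinalPresentable κ A ↔ IsCardinalPresentable A κ := by
  constructor
  · intro h
    rw [isCardinalPresentable_iff_isCardinalAccessible_coyoneda_obj]
    refine ⟨fun J _ _ => ?_⟩
    obtain ⟨P, _, _, F, _⟩ := IsCardinalFiltered.exists_cardinal_directed J κ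
    have := (h P inferInstance (isCardinalDirected_of_isCardinalFiltered κ P)).some
    exact Functor.Final.preservesColimitsOfShape_of_final F _
  · intro h P _ hP
    have := isCardinalFiltered_of_isCardinalDirected κ hP
    exact ⟨preservesColimitsOfShape_of_isCardinalPresentable A κ P⟩

/-- Every object is a `κ`-directed colimit of `κ`-presentable objects. -/
def HasPresentations (C : Type u) [Category.{v} C] (κ : Cardinal.{v}) [Fact κ.IsRegular] :
    Prop :=
  ∀ X : C, ∃ (P : Type v) (_ : Preorder P) (_ : IsCardinalFiltered P κ) (F : P ⥤ C)
    (c : F ⟶ (Functor.const P).obj X), Nonempty (IsColimit (Cocone.mk X c)) ∧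
    ∀ p, IsCardinalPresentable (F.obj p) κ

lemma hasPresentations (h : CellularPaper.IsLocallyPresentable κ C) :
    HasPresentations C κ := by
  intro X
  obtain ⟨ι, G, hG, h⟩ := h.generators
  obtain ⟨P, _, F, c, hc, hP, ⟨e⟩, hF⟩ := h X
  refine ⟨P, inferInstance, isCardinalFiltered_of_isCardinalDirected κ hP, F,
    c.ι ≫ (Functor.const P).map e.hom, ⟨?_⟩, fun p => ?_⟩
  · exact hc.ofIsoColimit (Cocone.ext e (by intro; rfl))
  · obtain ⟨i, ⟨e⟩⟩ := hF p
    have := (isCardinalPresentable_iff κ _).1 (hG i)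
    exact isCardinalPresentable_of_iso e.symm κ

lemma essentiallySmall_isCardinalPresentable (h : CellularPaper.IsLocallyPresentable κ C) :
    ObjectProperty.EssentiallySmall.{v} (isCardinalPresentable C κ) := by
  obtain ⟨ι, G, hG, h⟩ := h.generators
  have gen : (ObjectProperty.ofObj G).isoClosure.IsCardinalFilteredGenerator κ :=
    { le_isCardinalPresentable := by
        rw [ObjectProperty.isoClosure_le_iff]
        rintro _ ⟨i⟩
        exact (isCardinalPresentable_iff κ _).1 (hG i)
      exists_colimitsOfShape := fun X => by
        obtain ⟨P, _, F, c, hc, hP, ⟨e⟩, hF⟩ := h X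
        refine ⟨P, inferInstance, isCardinalFiltered_of_isCardinalDirected κ hP,
          ⟨{ diag := F
             ι := c.ι ≫ (Functor.const P).map e.hom
             isColimit := hc.ofIsoColimit (Cocone.ext e (by intro; rfl))
             prop_diag_obj := fun p => ?_ }⟩⟩
        obtain ⟨i, ⟨e⟩⟩ := hF p
        exact ⟨_, ⟨i⟩, ⟨e⟩⟩ }
  exact gen.essentiallySmall_isPresentable

end Presentable

section Iteration

lemma exists_iteration {C : Type u} [Category.{v} C] (J : Type w) [LinearOrder J] [OrderBot J]
    [SuccOrder J] [WellFoundedLT J] [HasIterationOfShape J C] (X₀ : C) (R : MorphismProperty C)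
    (h : ∀ X, ∃ (Y : C) (f : X ⟶ Y), R f) :
    ∃ Φ : J ⥤ C, Φ.IsWellOrderContinuous ∧ Nonempty (X₀ ≅ Φ.obj ⊥) ∧
      ∀ j, ¬ IsMax j → R (Φ.map (homOfLE (Order.le_succ j))) := by
  choose succ toSucc hR using h
  let Ψ : SmallObject.SuccStruct C := { X₀ := X₀, succ := succ, toSucc := toSucc }
  refine ⟨Ψ.iterationFunctor J, inferInstance, ⟨(Ψ.iterationFunctorObjBotIso J).symm⟩,
    fun j hj => ?_⟩
  have := Ψ.prop_iterationFunctor_map_succ j hj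
  rw [SmallObject.SuccStruct.prop_iff] at this
  exact (MorphismProperty.arrow_mk_mem_toSet_iff R _).1
    (by rw [this]; exact (MorphismProperty.arrow_mk_mem_toSet_iff R _).2 (hR _))

lemma hasColimitsOfShape_of_wellFounded (J : Type w) [LinearOrder J] [OrderTop J]
    [WellFoundedLT J] (I : Type v) [Category.{u} I] : HasColimitsOfShape I J where
  has_colimit F := by
    let s : Set J := upperBounds (Set.range F.obj)
    have hs : s.Nonempty := ⟨⊤, fun _ _ => le_top⟩
    obtain ⟨m, hm, hmin⟩ := (wellFounded_lt (α := J)).has_min s hs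
    refine ⟨⟨⟨⟨m, ⟨fun i => homOfLE (hm ⟨i, rfl⟩), fun _ _ _ => Subsingleton.elim _ _⟩⟩,
      ⟨fun c => homOfLE (not_lt.1 (hmin c.pt ?_)),
        fun _ _ => Subsingleton.elim (α := (_ ⟶ _ : Type w)) _ _,
        fun _ _ _ => Subsingleton.elim (α := (_ ⟶ _ : Type w)) _ _⟩⟩⟩⟩
    rintro _ ⟨i, rfl⟩
    exact leOfHom (c.ι.app i)

end Iteration

section CellExtension

variable {C : Type u} [Category.{v} C] [HasColimitsOfSize.{v, v} C] {P : Type v} [Preorder P]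

/-- The canonical map from `U` to the value at `q ≥ p` of the functor freely generated by `U`
at `p`. -/
noncomputable def freeι (p : P) (U : C) {q : P} (h : p ≤ q) :
    U ⟶ ((evaluationLeftAdjoint C p).obj U).obj q :=
  Sigma.ι (fun _ : p ⟶ q => U) (homOfLE h)

instance (p : P) (U : C) {q : P} (h : p ≤ q) : IsIso (freeι p U h) := by
  have key : freeι p U h ≫ Sigma.desc (fun _ : p ⟶ q => 𝟙 U) = 𝟙 U := Limits.Sigma.ι_desc _ _
  refine ⟨Sigma.desc fun _ => 𝟙 U, key, ?_⟩
  apply Sigma.hom_ext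
  intro b
  obtain rfl : b = homOfLE h := Subsingleton.elim _ _
  exact (assoc _ _ _).symm.trans (((key =≫ freeι p U h).trans (id_comp _)).trans (comp_id _).symm)

lemma freeι_naturality (p : P) {U V : C} (f : U ⟶ V) {q : P} (h : p ≤ q) :
    freeι p U h ≫ ((evaluationLeftAdjoint C p).map f).app q = f ≫ freeι p V h :=
  Limits.Sigma.ι_desc _ _

lemma freeι_map (p : P) (U : C) {q : P} (h : p ≤ q) :
    freeι p U le_rfl ≫ ((evaluationLeftAdjoint C p).obj U).map (homOfLE h) = freeι p U h :=
  Limits.Sigma.ι_desc _ _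

lemma free_hom_ext {p : P} {U : C} {X : P ⥤ C} {f g : (evaluationLeftAdjoint C p).obj U ⟶ X}
    (h : freeι p U le_rfl ≫ f.app p = freeι p U le_rfl ≫ g.app p) : f = g := by
  ext q
  apply Sigma.hom_ext
  intro b
  change freeι p U (leOfHom b) ≫ f.app q = freeι p U (leOfHom b) ≫ g.app q
  rw [← freeι_map, assoc, assoc, f.naturality, g.naturality, reassoc_of% h]

lemma exists_free_desc {p : P} {U : C} {X : P ⥤ C} (a : U ⟶ X.obj p) :
    ∃ f : (evaluationLeftAdjoint C p).obj U ⟶ X, freeι p U le_rfl ≫ f.app p = a := by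
  let f (q : P) : ((evaluationLeftAdjoint C p).obj U).obj q ⟶ X.obj q :=
    Sigma.desc fun b : p ⟶ q => a ≫ X.map b
  have hf {q : P} (b : p ⟶ q) : freeι p U (leOfHom b) ≫ f q = a ≫ X.map b :=
    Limits.Sigma.ι_desc _ _
  refine ⟨⟨f, fun q r k => ?_⟩, ?_⟩
  · apply Sigma.hom_ext
    intro b
    change freeι p U (leOfHom b) ≫ _ = freeι p U (leOfHom b) ≫ _
    have e : freeι p U (leOfHom b) ≫ ((evaluationLeftAdjoint C p).obj U).map k =
        freeι p U (leOfHom (b ≫ k)) := by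
      rw [← freeι_map p U (leOfHom b), ← freeι_map p U (leOfHom (b ≫ k)), assoc,
        ← Functor.map_comp]
      rfl
    rw [reassoc_of% hf b, ← X.map_comp, reassoc_of% e]
    exact hf (b ≫ k)
  · exact (hf (𝟙 p)).trans (by simp)

lemma isIso_free_app {p : P} {U V : C} (f : U ⟶ V) {q : P} (h : ¬ p ≤ q) :
    IsIso (((evaluationLeftAdjoint C p).map f).app q) := by
  refine ⟨Sigma.desc fun g => (h (leOfHom g)).elim, ?_, ?_⟩ <;>
  · apply Sigma.hom_ext
    intro g
    exact (h (leOfHom g)).elim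

lemma exists_cell_extension {X : P ⥤ C} {A A' : C} (x : X ⟶ (Functor.const P).obj A)
    (hx : IsColimit (Cocone.mk A x)) {U V : C} (u : U ⟶ V) (p : P) (a : U ⟶ X.obj p)
    (v : V ⟶ A') (g : A ⟶ A') (h : IsPushout u (a ≫ x.app p) v g) :
    ∃ (Y : P ⥤ C) (f : X ⟶ Y) (y : Y ⟶ (Functor.const P).obj A') (b : V ⟶ Y.obj p),
      f ≫ y = x ≫ (Functor.const P).map g ∧ b ≫ y.app p = v ∧
      Nonempty (IsColimit (Cocone.mk A' y)) ∧
      (∀ q (h : p ≤ q), IsPushout u (a ≫ X.map (homOfLE h)) (b ≫ Y.map (homOfLE h)) (f.app q)) ∧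
      ∀ q, ¬ p ≤ q → IsIso (f.app q) := by
  let E := evaluationLeftAdjoint C p
  obtain ⟨a', ha'⟩ := exists_free_desc a
  obtain ⟨v', hv'⟩ := exists_free_desc (X := (Functor.const P).obj A') v
  let Y := pushout (E.map u) a'
  let inl : E.obj V ⟶ Y := pushout.inl _ _
  let f : X ⟶ Y := pushout.inr _ _
  have sq : IsPushout (E.map u) a' inl f := IsPushout.of_hasPushout _ _
  have comm : E.map u ≫ v' = a' ≫ x ≫ (Functor.const P).map g := by
    apply free_hom_ext
    have := h.w
    simp only [NatTrans.comp_app, reassoc_of% @freeι_naturality, E, hv', reassoc_of% ha',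
      Functor.const_map_app]
    simpa using this
  let y : Y ⟶ (Functor.const P).obj A' := sq.desc v' (x ≫ (Functor.const P).map g) comm
  have hy₁ : inl ≫ y = v' := sq.inl_desc _ _ _
  have hy₂ : f ≫ y = x ≫ (Functor.const P).map g := sq.inr_desc _ _ _
  let b : V ⟶ Y.obj p := freeι p V le_rfl ≫ inl.app p
  have hb : b ≫ y.app p = v := by
    simp only [b, assoc, ← NatTrans.comp_app, hy₁, hv']
  refine ⟨Y, f, y, b, hy₂, hb, ⟨?_⟩, ?_, ?_⟩
  · have comm' (s : Cocone Y) : u ≫ b ≫ s.ι.app p =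
        (a ≫ x.app p) ≫ hx.desc (Cocone.mk s.pt (f ≫ s.ι)) := by
      have := hx.fac (Cocone.mk s.pt (f ≫ s.ι)) p
      dsimp at this
      have e := congr_app sq.w p
      dsimp at e
      simp only [assoc, this, b]
      rw [← reassoc_of% @freeι_naturality, reassoc_of% e, reassoc_of% ha']
    have hs₁ (s : Cocone Y) := h.inl_desc _ _ (comm' s)
    have hs₂ (s : Cocone Y) := h.inr_desc _ _ (comm' s)
    refine ⟨fun s => h.desc _ _ (comm' s), fun s q => ?_, fun s m hm => ?_⟩
    · suffices y ≫ (Functor.const P).map (h.desc _ _ (comm' s)) = s.ι from congr_app this q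
      apply sq.hom_ext
      · apply free_hom_ext
        have := hs₁ s
        rw [reassoc_of% hy₁]
        simp only [NatTrans.comp_app, reassoc_of% hv', Functor.const_map_app]
        exact this.trans (assoc _ _ _)
      · rw [reassoc_of% hy₂, ← Functor.map_comp, hs₂]
        ext q
        exact hx.fac (Cocone.mk s.pt (f ≫ s.ι)) q
    · apply h.hom_ext
      · rw [hs₁, ← hm p]
        dsimp
        rw [reassoc_of% hb]
      · rw [hs₂]
        apply hx.hom_ext
        intro q
        rw [hx.fac]
        dsimp
        rw [← hm q]
        have e := congr_app hy₂ q =≫ m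
        simp only [NatTrans.comp_app, Functor.const_map_app, assoc] at e
        exact e.symm
  · intro q hq
    have sq' : IsPushout ((E.map u).app q) (a'.app q) (inl.app q) (f.app q) :=
      sq.map ((evaluation P C).obj q)
    have left : IsPushout u (freeι p U hq) (freeι p V hq) ((E.map u).app q) :=
      IsPushout.of_vert_isIso ⟨(freeι_naturality p u hq).symm⟩
    have := left.paste_vert sq'
    convert this using 1
    · rw [← ha', assoc, ← a'.naturality]
      exact (assoc _ _ _).symm.trans (congrArg (· ≫ a'.app q) (freeι_map p U hq))
    · simp only [b, assoc]
      rw [← inl.naturality, reassoc_of% @freeι_map]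
  · intro q hq
    have sq' : IsPushout ((E.map u).app q) (a'.app q) (inl.app q) (f.app q) :=
      sq.map ((evaluation P C).obj q)
    have := isIso_free_app u hq
    exact MorphismProperty.of_isPushout (P := .isomorphisms C) sq'.flip this

end CellExtension

section ColimitLemmas

variable {C : Type*} [Category* C]

lemma isColimit_comm {I J : Type*} [Category* I] [Category* J] (H : I ⥤ J ⥤ C)
    (R : I ⥤ C) (B : J ⥤ C) {Z : C}
    (r : ∀ i, H.obj i ⟶ (Functor.const J).obj (R.obj i))
    (hr : ∀ i, Nonempty (IsColimit (Cocone.mk (R.obj i) (r i))))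
    (b : ∀ j, H.flip.obj j ⟶ (Functor.const I).obj (B.obj j))
    (hb : ∀ j, Nonempty (IsColimit (Cocone.mk (B.obj j) (b j))))
    (zR : R ⟶ (Functor.const I).obj Z) (zB : B ⟶ (Functor.const J).obj Z)
    (hzB : IsColimit (Cocone.mk Z zB))
    (compat : ∀ i j, (r i).app j ≫ zR.app i = (b j).app i ≫ zB.app j)
    (hr' : ∀ {i i'} (f : i ⟶ i') j, (r i).app j ≫ R.map f = (H.map f).app j ≫ (r i').app j)
    (hb' : ∀ {j j'} (g : j ⟶ j') i, (b j).app i ≫ B.map g = (H.obj i).map g ≫ (b j').app i) :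
    Nonempty (IsColimit (Cocone.mk Z zR)) := by
  let t (s : Cocone R) (j : J) : Cocone (H.flip.obj j) :=
    { pt := s.pt
      ι :=
        { app i := (r i).app j ≫ s.ι.app i
          naturality i i' f := by
            have := s.w f
            dsimp
            rw [← reassoc_of% hr' f j, this, comp_id] } }
  let d (s : Cocone R) (j : J) : B.obj j ⟶ s.pt := (hb j).some.desc (t s j)
  have hd (s j i) : (b j).app i ≫ d s j = (r i).app j ≫ s.ι.app i := (hb j).some.fac (t s j) i
  let e (s : Cocone R) : Cocone B :=
    { pt := s.pt
      ι :=
        { app := d s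
          naturality j j' g := by
            dsimp
            rw [comp_id]
            refine (hb j).some.hom_ext fun i => ?_
            have := (r i).naturality g
            dsimp at this ⊢
            rw [reassoc_of% hb', hd, hd, reassoc_of% this] } }
  have he (s j) : zB.app j ≫ hzB.desc (e s) = d s j := hzB.fac (e s) j
  refine ⟨⟨fun s => hzB.desc (e s), fun s i => (hr i).some.hom_ext fun j => ?_, fun s m hm =>
    hzB.hom_ext fun j => (hb j).some.hom_ext fun i => ?_⟩⟩
  · dsimp
    rw [reassoc_of% compat, he, hd]
  · have := hm i
    dsimp at this ⊢
    rw [he, hd, ← this, reassoc_of% compat]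

lemma isPushout_of_isColimit {I : Type*} [Category* I] {F₁ F₂ F₃ F₄ : I ⥤ C} {t : F₁ ⟶ F₂}
    {l : F₁ ⟶ F₃} {r : F₂ ⟶ F₄} {b : F₃ ⟶ F₄}
    (h : ∀ i, IsPushout (t.app i) (l.app i) (r.app i) (b.app i)) {X₁ X₂ X₃ X₄ : C}
    {c₁ : F₁ ⟶ (Functor.const I).obj X₁} {c₂ : F₂ ⟶ (Functor.const I).obj X₂}
    {c₃ : F₃ ⟶ (Functor.const I).obj X₃} {c₄ : F₄ ⟶ (Functor.const I).obj X₄}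
    (h₁ : IsColimit (Cocone.mk X₁ c₁)) (h₂ : IsColimit (Cocone.mk X₂ c₂))
    (h₃ : IsColimit (Cocone.mk X₃ c₃)) (h₄ : IsColimit (Cocone.mk X₄ c₄))
    {t' : X₁ ⟶ X₂} {l' : X₁ ⟶ X₃} {r' : X₂ ⟶ X₄} {b' : X₃ ⟶ X₄}
    (ht : ∀ i, c₁.app i ≫ t' = t.app i ≫ c₂.app i) (hl : ∀ i, c₁.app i ≫ l' = l.app i ≫ c₃.app i)
    (hr : ∀ i, c₂.app i ≫ r' = r.app i ≫ c₄.app i)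
    (hb : ∀ i, c₃.app i ≫ b' = b.app i ≫ c₄.app i) : IsPushout t' l' r' b' := by
  have w : t' ≫ r' = l' ≫ b' := h₁.hom_ext fun i => by
    dsimp
    rw [reassoc_of% ht, hr, reassoc_of% hl, hb, reassoc_of% (h i).w]
  have comm (s : PushoutCocone t' l') (i : I) :
      t.app i ≫ c₂.app i ≫ s.inl = l.app i ≫ c₃.app i ≫ s.inr := by
    rw [← reassoc_of% ht, ← reassoc_of% hl, s.condition]
  let d (s : PushoutCocone t' l') (i : I) : F₄.obj i ⟶ s.pt := (h i).desc _ _ (comm s i)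
  have hd₁ (s i) : r.app i ≫ d s i = c₂.app i ≫ s.inl := (h i).inl_desc _ _ (comm s i)
  have hd₂ (s i) : b.app i ≫ d s i = c₃.app i ≫ s.inr := (h i).inr_desc _ _ (comm s i)
  let e (s : PushoutCocone t' l') : Cocone F₄ :=
    { pt := s.pt
      ι :=
        { app := d s
          naturality i i' f := by
            have h2 := c₂.naturality f
            have h3 := c₃.naturality f
            dsimp at h2 h3 ⊢
            rw [comp_id] at h2 h3 ⊢
            apply (h i).hom_ext
            · rw [← r.naturality_assoc, hd₁, hd₁, reassoc_of% h2]
            · rw [← b.naturality_assoc, hd₂, hd₂, reassoc_of% h3] } }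
  have he (s i) : c₄.app i ≫ h₄.desc (e s) = d s i := h₄.fac (e s) i
  refine ⟨⟨w⟩, ⟨PushoutCocone.IsColimit.mk _ (fun s => h₄.desc (e s)) (fun s => ?_) (fun s => ?_)
    (fun s m hm₁ hm₂ => ?_)⟩⟩
  · refine h₂.hom_ext fun i => ?_
    dsimp
    rw [reassoc_of% hr, he, hd₁]
  · refine h₃.hom_ext fun i => ?_
    dsimp
    rw [reassoc_of% hb, he, hd₂]
  · refine h₄.hom_ext fun i => (h i).hom_ext ?_ ?_
    · dsimp
      rw [he, hd₁, ← reassoc_of% hr, hm₁]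
    · dsimp
      rw [he, hd₂, ← reassoc_of% hb, hm₂]

lemma isWellOrderContinuous_of_isColimit {I : Type*} [Category* I] {J : Type*} [PartialOrder J]
    (H : I ⥤ J ⥤ C) (hH : ∀ i, (H.obj i).IsWellOrderContinuous) {X : J ⥤ C}
    (c : H ⟶ (Functor.const I).obj X)
    (hc : ∀ j, Nonempty (IsColimit (((evaluation J C).obj j).mapCocone (Cocone.mk X c)))) :
    X.IsWellOrderContinuous where
  nonempty_isColimit m hm := by
    let ι := (Set.principalSegIio m).monotone.functor
    let x (j : J) : H.flip.obj j ⟶ (Functor.const I).obj (X.obj j) :=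
      { app i := (c.app i).app j
        naturality i i' f := by
          simp }
    exact isColimit_comm (ι ⋙ H.flip) (ι ⋙ X) (H.flip.obj m) (fun i => x (ι.obj i))
      (fun i => ⟨((hc _).some).ofIsoColimit (Cocone.ext (Iso.refl _) fun _ => comp_id _)⟩)
      (fun i => ((Set.principalSegIio m).cocone (H.obj i)).ι)
      (fun i => (hH i).nonempty_isColimit m hm) ((Set.principalSegIio m).cocone X).ι (x m)
      (((hc m).some).ofIsoColimit (Cocone.ext (Iso.refl _) fun _ => comp_id _))
      (fun i j => ((c.app j).naturality _).symm)
      (fun f j => ((c.app j).naturality _).symm) (fun g i => ((H.map g).naturality _))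

end ColimitLemmas

section LinkStep

variable {C : Type*} [Category* C]

/-- Commutative squares, viewed as morphisms of arrows, which are pushouts or whose target is an
isomorphism. -/
def linkStep : MorphismProperty (Arrow C) := fun f g s =>
  IsPushout f.hom s.left s.right g.hom ∨ IsIso g.hom

lemma linkStep.isIso {f g : Arrow C} {s : f ⟶ g} (h : linkStep s) (hf : IsIso f.hom) :
    IsIso g.hom := by
  obtain h | h := h
  · exact MorphismProperty.of_isPushout (P := .isomorphisms C) h.flip hf
  · exact h

lemma linkStep_id (f : Arrow C) : linkStep (𝟙 f) :=
  Or.inl (IsPushout.of_vert_isIso ⟨by simp⟩)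

lemma linkStep.comp {f g h : Arrow C} {s : f ⟶ g} {t : g ⟶ h} (hs : linkStep s)
    (ht : linkStep t) : linkStep (s ≫ t) := by
  obtain ht | ht := ht
  · obtain hs | hs := hs
    · exact Or.inl (hs.paste_vert ht)
    · exact Or.inr (linkStep.isIso (Or.inl ht) hs)
  · exact Or.inr ht

lemma exists_isColimit_Ico {D : Type*} [Category* D] {W : Type*} [LinearOrder W] (Φ : W ⥤ D)
    [Φ.IsWellOrderContinuous] {i w : W} (hw : Order.IsSuccLimit w) (hi : i < w) :
    Nonempty (IsColimit (Cocone.mk (F := (Subtype.mono_coe (· ∈ Set.Ico i w)).functor ⋙ Φ)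
      (Φ.obj w)
      { app k := Φ.map (homOfLE k.2.2.le)
        naturality _ _ _ := (Φ.map_comp _ _).symm.trans (comp_id _).symm })) := by
  let f : Set.Ico i w → Set.Iio w := fun k => ⟨k.1, k.2.2⟩
  have hf : Monotone f := fun _ _ h => h
  have : Nonempty (Set.Ico i w) := ⟨⟨i, le_rfl, hi⟩⟩
  have : hf.functor.Final := by
    rw [Monotone.final_functor_iff]
    exact fun k => ⟨⟨max i k.1, le_max_left _ _, max_lt hi k.2⟩, le_max_right _ _⟩
  exact ⟨(Functor.Final.isColimitWhiskerEquiv (F := hf.functor) _).2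
    (Φ.isColimitOfIsWellOrderContinuous w hw)⟩

lemma linkStep_map {W : Type*} [LinearOrder W] [SuccOrder W] [OrderBot W] [WellFoundedLT W]
    (Φ : W ⥤ Arrow C) (h₁ : (Φ ⋙ Arrow.leftFunc).IsWellOrderContinuous)
    (h₂ : (Φ ⋙ Arrow.rightFunc).IsWellOrderContinuous)
    (h : ∀ w, ¬ IsMax w → linkStep (Φ.map (homOfLE (Order.le_succ w)))) {i w : W} (f : i ⟶ w) :
    linkStep (Φ.map f) := by
  induction w using SuccOrder.limitRecOn generalizing i with
  | isMin w hw =>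
    obtain rfl : i = w := le_antisymm (leOfHom f) (hw (leOfHom f))
    obtain rfl : f = 𝟙 _ := Subsingleton.elim _ _
    rw [Φ.map_id]
    exact linkStep_id _
  | succ w hw ih =>
    obtain hi | rfl := (leOfHom f).lt_or_eq
    · rw [Order.lt_succ_iff_of_not_isMax hw] at hi
      have e : Φ.map f = Φ.map (homOfLE hi) ≫ Φ.map (homOfLE (Order.le_succ w)) := by
        rw [← Φ.map_comp]; rfl
      rw [e]
      exact (ih _).comp (h w hw)
    · obtain rfl : f = 𝟙 _ := Subsingleton.elim _ _
      rw [Φ.map_id]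
      exact linkStep_id _
  | isSuccLimit w hw ih =>
    obtain hi | rfl := (leOfHom f).lt_or_eq
    · have : ∃ (k : W) (_ : i ≤ k) (_ : k < w), ∀ (l : W) (hl : k ≤ l), l < w →
          IsPushout (Φ.obj k).hom (Φ.map (homOfLE hl)).left (Φ.map (homOfLE hl)).right
            (Φ.obj l).hom := by
        by_cases hk : ∃ (k : W) (_ : i ≤ k) (_ : k < w), IsIso (Φ.obj k).hom
        · obtain ⟨k, hik, hkw, hk⟩ := hk
          refine ⟨k, hik, hkw, fun l hl hlw => ?_⟩
          have := (ih l hlw (homOfLE hl)).isIso hk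
          exact IsPushout.of_horiz_isIso ⟨(Φ.map (homOfLE hl)).w.symm⟩
        · push Not at hk
          exact ⟨i, le_rfl, hi, fun l hl hlw =>
            (ih l hlw (homOfLE hl)).resolve_right (hk l hl hlw)⟩
      obtain ⟨k, hik, hkw, hk⟩ := this
      have key : IsPushout (Φ.obj k).hom (Φ.map (homOfLE hkw.le)).left
          (Φ.map (homOfLE hkw.le)).right (Φ.obj w).hom := by
        have : Nonempty (Set.Ico k w) := ⟨⟨k, le_rfl, hkw⟩⟩
        have : IsConnected (Set.Ico k w) := IsFiltered.isConnected _
        obtain ⟨hl⟩ := exists_isColimit_Ico (Φ ⋙ Arrow.leftFunc) hw hkw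
        obtain ⟨hr⟩ := exists_isColimit_Ico (Φ ⋙ Arrow.rightFunc) hw hkw
        let ι := (Subtype.mono_coe (· ∈ Set.Ico k w)).functor
        let a : (Functor.const (Set.Ico k w)).obj (Φ.obj k) ⟶ ι ⋙ Φ :=
          { app l := Φ.map (homOfLE l.2.1)
            naturality _ _ _ := (id_comp _).trans (Φ.map_comp _ _) }
        have e (l : Set.Ico k w) :
            Φ.map (homOfLE hkw.le) = Φ.map (homOfLE l.2.1) ≫ Φ.map (homOfLE l.2.2.le) := by
          rw [← Φ.map_comp]; rfl
        exact isPushout_of_isColimit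
          (t := (Functor.const (Set.Ico k w)).map (Φ.obj k).hom)
          (r := Functor.whiskerRight a Arrow.rightFunc)
          (l := Functor.whiskerRight a Arrow.leftFunc)
          (b := Functor.whiskerLeft (ι ⋙ Φ) Arrow.leftToRight)
          (fun l => hk l.1 l.2.1 l.2.2)
          (isColimitConstCocone _ _) (isColimitConstCocone _ _) hl hr
          (fun l => (id_comp _).trans (comp_id _).symm)
          (fun l => (id_comp _).trans (congrArg CommaMorphism.left (e l)))
          (fun l => (id_comp _).trans (congrArg CommaMorphism.right (e l)))
          (fun l => (Φ.map (homOfLE l.2.2.le)).w)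
      have e : Φ.map f = Φ.map (homOfLE hik) ≫ Φ.map (homOfLE hkw.le) := by
        rw [← Φ.map_comp]; rfl
      rw [e]
      exact (ih k hkw _).comp (Or.inl key)
    · obtain rfl : f = 𝟙 _ := Subsingleton.elim _ _
      rw [Φ.map_id]
      exact linkStep_id _

end LinkStep

section Chains

variable {C : Type u} [Category.{v} C]

/-- Composites of well-order-continuous chains of morphisms in `T`, indexed by a well-order
with a greatest element. -/
def chainComposites (T : MorphismProperty C) : MorphismProperty C := fun _ _ f =>
  ∃ (J : Type v) (_ : LinearOrder J) (_ : SuccOrder J) (_ : OrderBot J) (_ : OrderTop J)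
    (_ : WellFoundedLT J) (F : J ⥤ C), F.IsWellOrderContinuous ∧
    (∀ j, ¬ IsMax j → T (F.map (homOfLE (Order.le_succ j)))) ∧
    Nonempty (Arrow.mk (F.map (homOfLE (bot_le : (⊥ : J) ≤ ⊤))) ≅ Arrow.mk f)

lemma chainComposites_mk {T : MorphismProperty C} {J : Type v} [LinearOrder J] [SuccOrder J]
    [OrderBot J] [OrderTop J] [WellFoundedLT J] (F : J ⥤ C) [F.IsWellOrderContinuous]
    (h : ∀ j, ¬ IsMax j → T (F.map (homOfLE (Order.le_succ j)))) {A B : C} {f : A ⟶ B}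
    (e : Arrow.mk (F.map (homOfLE (bot_le : (⊥ : J) ≤ ⊤))) ≅ Arrow.mk f) :
    chainComposites T f :=
  ⟨J, inferInstance, inferInstance, inferInstance, inferInstance, inferInstance, F, inferInstance,
    h, ⟨e⟩⟩

lemma chainComposites_of_covBy {T : MorphismProperty C} {J : Type v} [LinearOrder J]
    [OrderBot J] [OrderTop J] [WellFoundedLT J] (F : J ⥤ C) [F.IsWellOrderContinuous]
    (h : ∀ (i j : J) (h : i ⋖ j), T (F.map (homOfLE h.le))) :
    chainComposites T (F.map (homOfLE (bot_le : (⊥ : J) ≤ ⊤))) :=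
  ⟨J, inferInstance, SuccOrder.ofLinearWellFoundedLT J, inferInstance, inferInstance,
    inferInstance, F, inferInstance,
    fun j hj => h j _ (@Order.covBy_succ_of_not_isMax J _ (_) j hj), ⟨Iso.refl _⟩⟩

instance (T : MorphismProperty C) : (chainComposites T).RespectsIso :=
  MorphismProperty.RespectsIso.of_respects_arrow_iso _ fun _ _ e h => by
    obtain ⟨J, _, _, _, _, _, F, hF, hT, ⟨e'⟩⟩ := h
    exact ⟨J, _, _, _, _, ‹_›, F, hF, hT, ⟨e' ≪≫ e⟩⟩

lemma chainComposites_of_isIso (T : MorphismProperty C) {A B : C} (f : A ⟶ B) [IsIso f] :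
    chainComposites T f := by
  refine ⟨PUnit, inferInstance, SuccOrder.ofLinearWellFoundedLT _, inferInstance, inferInstance,
    inferInstance, (Functor.const _).obj A, ⟨fun m hm => (hm.1 ?_).elim⟩, fun j hj => ?_,
    ⟨Arrow.isoMk (Iso.refl _) (asIso f) (by simp)⟩⟩
  · exact fun _ _ => le_rfl
  · exact (hj fun _ _ => le_rfl).elim

lemma nonempty_isColimit_of_cofinal {C : Type*} [Category* C] {J : Type*} [PartialOrder J]
    (F : J ⥤ C) (m : J) {D : Type*} [Preorder D] [IsDirectedOrder D] (f : D → Set.Iio m)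
    (hf : Monotone f) (h : ∀ k : Set.Iio m, ∃ d, k ≤ f d)
    (hc : Nonempty (IsColimit (((Set.principalSegIio m).cocone F).whisker hf.functor))) :
    Nonempty (IsColimit ((Set.principalSegIio m).cocone F)) := by
  have : hf.functor.Final := (Monotone.final_functor_iff _).2 h
  exact ⟨(Functor.Final.isColimitWhiskerEquiv (F := hf.functor) _) hc.some⟩

lemma isWellOrderContinuous_const {C : Type*} [Category* C] {J : Type*} [LinearOrder J] (A : C) :
    ((Functor.const J).obj A).IsWellOrderContinuous where
  nonempty_isColimit m hm := by
    have : Nonempty (Set.Iio m) := by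
      by_contra h
      exact hm.1 fun k hk => not_lt.1 fun hk' => h ⟨⟨k, hk'⟩⟩
    have : IsConnected (Set.Iio m) := IsFiltered.isConnected _
    exact ⟨(isColimitConstCocone (Set.Iio m) A).ofIsoColimit
      (Cocone.ext (Iso.refl _) fun _ => comp_id _)⟩

lemma isWellOrderContinuous_of_isPushout {C : Type*} [Category* C] [HasPushouts C] {J : Type*}
    [PartialOrder J] {X₁ X₂ X₃ X₄ : J ⥤ C} {t : X₁ ⟶ X₂} {l : X₁ ⟶ X₃} {r : X₂ ⟶ X₄}
    {b : X₃ ⟶ X₄} (sq : IsPushout t l r b) (h₁ : X₁.IsWellOrderContinuous)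
    (h₂ : X₂.IsWellOrderContinuous) (h₃ : X₃.IsWellOrderContinuous) :
    X₄.IsWellOrderContinuous :=
  isWellOrderContinuous_of_isColimit (span t l) (by rintro (_ | _ | _) <;> assumption)
    sq.cocone.ι fun j => ⟨isColimitOfPreserves ((evaluation J C).obj j) sq.isColimit⟩

lemma chainComposites_of_isPushout [HasPushouts C] {T : MorphismProperty C}
    (hT : ∀ {A B A' B' : C} {f : A ⟶ B} {u : A ⟶ A'} {v : B ⟶ B'} {g : A' ⟶ B'},
      IsPushout f u v g → T f → T g)
    {A B A' B' : C} {f : A ⟶ B} {u : A ⟶ A'} {v : B ⟶ B'} {g : A' ⟶ B'}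
    (h : IsPushout f u v g) (hf : chainComposites T f) : chainComposites T g := by
  obtain ⟨J, _, _, _, _, _, F, hF, hF', ⟨e⟩⟩ := hf
  let i : (Functor.const J).obj (F.obj ⊥) ⟶ F :=
    { app j := F.map (homOfLE bot_le)
      naturality j j' f := (id_comp _).trans (F.map_comp _ _) }
  let u' : (Functor.const J).obj (F.obj ⊥) ⟶ (Functor.const J).obj A' :=
    (Functor.const J).map (e.hom.left ≫ u)
  let F' := pushout i u'
  let inl : F ⟶ F' := pushout.inl i u'
  have sq : IsPushout i u' inl (pushout.inr _ _) := IsPushout.of_hasPushout _ _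
  have sq' (j : J) : IsPushout (F.map (homOfLE (bot_le : ⊥ ≤ j))) (e.hom.left ≫ u)
    (inl.app j) ((pushout.inr i u').app j) := sq.map ((evaluation J C).obj j)
  have iso : IsIso ((pushout.inr i u').app ⊥) :=
    MorphismProperty.of_isPushout (P := .isomorphisms C) (sq' ⊥).flip
      (inferInstanceAs (IsIso (F.map (𝟙 _))))
  have hinr {j k : J} (f : j ⟶ k) :
      (pushout.inr i u').app j ≫ F'.map f = (pushout.inr i u').app k :=
    ((pushout.inr i u').naturality f).symm.trans (id_comp _)
  have link {j k : J} (f : j ⟶ k) : IsPushout (F.map f) (inl.app j) (inl.app k) (F'.map f) := by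
    refine IsPushout.of_left ?_ (inl.naturality f) (sq' j)
    rw [hinr, ← F.map_comp]
    exact sq' k
  have : F'.IsWellOrderContinuous := isWellOrderContinuous_of_isPushout sq
    (isWellOrderContinuous_const _) hF (isWellOrderContinuous_const _)
  have h' : IsPushout (F.map (homOfLE (bot_le : (⊥ : J) ≤ ⊤))) (e.hom.left ≫ u)
      (e.hom.right ≫ v) g :=
    (IsPushout.of_vert_isIso ⟨e.hom.w.symm⟩).paste_vert h
  refine chainComposites_mk F' (fun j hj => hT (link _) (hF' j hj))
    (Arrow.isoMk (asIso ((pushout.inr i u').app ⊥)).symm ((sq' ⊤).isoIsPushout _ _ h') ?_)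
  dsimp
  rw [IsIso.inv_comp_eq]
  have := congrArg (· ≫ ((sq' ⊤).isoIsPushout _ _ h').hom) (hinr (homOfLE (bot_le : (⊥ : J) ≤ ⊤)))
  exact (((assoc _ _ _).symm.trans this).trans
    (IsPushout.inr_isoIsPushout_hom _ _ (sq' ⊤) h')).symm

end Chains

section Flatten

lemma sigmaLex_le {J : Type*} [LinearOrder J] {I : J → Type*} [∀ j, LinearOrder (I j)] {j j' : J}
    {i : I j} {i' : I j'} (h : (toLex ⟨j, i⟩ : Σₗ j, I j) ≤ toLex ⟨j', i'⟩) :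
    j < j' ∨ ∃ e : j = j', e ▸ i ≤ i' :=
  Sigma.lex_iff.1 h

lemma sigmaLex_lt {J : Type*} [LinearOrder J] {I : J → Type*} [∀ j, LinearOrder (I j)] {j j' : J}
    {i : I j} {i' : I j'} (h : (toLex ⟨j, i⟩ : Σₗ j, I j) < toLex ⟨j', i'⟩) :
    j < j' ∨ ∃ e : j = j', e ▸ i < i' :=
  Sigma.lex_iff.1 h

variable {C : Type*} [Category* C] {J : Type*} [LinearOrder J] [SuccOrder J] (F : J ⥤ C)
  {I : J → Type*} [∀ j, LinearOrder (I j)]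
  (G : ∀ j, I j ⥤ C) (s : ∀ j, (Functor.const (I j)).obj (F.obj j) ⟶ G j)
  (t : ∀ j, G j ⟶ (Functor.const (I j)).obj (F.obj (Order.succ j)))

/-- The transition morphisms of the concatenation of the chains `G j`. -/
noncomputable def concatMap (j : J) (i : I j) (j' : J) (i' : I j')
    (h : toLex (⟨j, i⟩ : Σ j, I j) ≤ toLex ⟨j', i'⟩) : (G j).obj i ⟶ (G j').obj i' :=
  if hj : j < j' then (t j).app i ≫ F.map (homOfLE (Order.succ_le_of_lt hj)) ≫ (s j').app i'
  else by
    have h' := (Sigma.lex_iff.1 h).resolve_left hj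
    obtain rfl : j = j' := h'.1
    exact (G j).map (homOfLE h'.2)

lemma concatMap_of_lt {j : J} (i : I j) {j' : J} (i' : I j') (hj : j < j') (h) :
    concatMap F G s t j i j' i' h =
      (t j).app i ≫ F.map (homOfLE (Order.succ_le_of_lt hj)) ≫ (s j').app i' :=
  dif_pos hj

lemma concatMap_self (j : J) (i i' : I j) (hi : i ≤ i') (h) :
    concatMap F G s t j i j i' h = (G j).map (homOfLE hi) :=
  dif_neg (lt_irrefl j)

variable (hst : ∀ j i, (s j).app i ≫ (t j).app i = F.map (homOfLE (Order.le_succ j)))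

include hst in
lemma concatMap_comp {j j' j'' : J} (i : I j) (i' : I j') (i'' : I j'') (h h' h'') :
    concatMap F G s t j i j'' i'' h'' =
      concatMap F G s t j i j' i' h ≫ concatMap F G s t j' i' j'' i'' h' := by
  obtain hj | ⟨rfl, hi⟩ := sigmaLex_le h <;> obtain hj' | ⟨rfl, hi'⟩ := sigmaLex_le h'
  · rw [concatMap_of_lt _ _ _ _ _ _ hj, concatMap_of_lt _ _ _ _ _ _ hj',
      concatMap_of_lt _ _ _ _ _ _ (hj.trans hj')]
    have := reassoc_of% (hst j' i')
    simp only [assoc, this]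
    rw [← F.map_comp_assoc, ← F.map_comp_assoc]
    rfl
  · dsimp at hi'
    rw [concatMap_of_lt _ _ _ _ _ _ hj, concatMap_of_lt _ _ _ _ _ _ hj,
      concatMap_self _ _ _ _ _ _ _ hi', assoc, assoc, ← (s _).naturality]
    simp
  · dsimp at hi
    rw [concatMap_of_lt _ _ _ _ _ _ hj', concatMap_of_lt _ _ _ _ _ _ hj',
      concatMap_self _ _ _ _ _ _ _ hi, ← assoc ((G j).map _), (t _).naturality]
    simp
  · dsimp at hi hi'
    rw [concatMap_self _ _ _ _ _ _ _ hi', concatMap_self _ _ _ _ _ _ _ hi,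
      concatMap_self _ _ _ _ _ _ _ (hi.trans hi'), ← (G j).map_comp]
    rfl

/-- The concatenation of the chains `G j`. -/
noncomputable def concat : (Σₗ j, I j) ⥤ C where
  obj a := (G a.1).obj a.2
  map {a b} f := concatMap F G s t a.1 a.2 b.1 b.2 (leOfHom f)
  map_id a := (concatMap_self _ _ _ _ _ _ _ le_rfl _).trans ((G a.1).map_id _)
  map_comp _ _ := concatMap_comp F G s t hst _ _ _ _ _ _

lemma concat_map_self {j : J} {i i' : I j} (hi : i ≤ i')
    (f : (toLex ⟨j, i⟩ : Σₗ j, I j) ⟶ toLex ⟨j, i'⟩) :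
    (concat F G s t hst).map f = (G j).map (homOfLE hi) :=
  concatMap_self _ _ _ _ _ _ _ hi (leOfHom f)

variable [∀ j, OrderBot (I j)] [∀ j, OrderTop (I j)]

omit [SuccOrder J] in
lemma sigmaLex_covBy_iff {j j' : J} {i : I j} {i' : I j'}
    (h : (toLex ⟨j, i⟩ : Σₗ j, I j) ⋖ toLex ⟨j', i'⟩) :
    (∃ (e : j = j'), e ▸ i ⋖ i') ∨ (j ⋖ j' ∧ i = ⊤ ∧ i' = ⊥) := by
  obtain hj | ⟨rfl, hi⟩ := sigmaLex_lt h.1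
  · refine Or.inr ⟨⟨hj, fun k hk hk' => h.2 (c := toLex ⟨k, ⊥⟩) (Sigma.Lex.left _ _ hk)
      (Sigma.Lex.left _ _ hk')⟩, ?_, ?_⟩
    · by_contra hi
      exact h.2 (c := toLex ⟨j, ⊤⟩) (Sigma.Lex.right _ _ (lt_top_iff_ne_top.2 hi))
        (Sigma.Lex.left _ _ hj)
    · by_contra hi
      exact h.2 (c := toLex ⟨j', ⊥⟩) (Sigma.Lex.left _ _ hj)
        (Sigma.Lex.right _ _ (bot_lt_iff_ne_bot.2 hi))
  · exact Or.inl ⟨rfl, hi, fun k hk hk' => h.2 (c := toLex ⟨j, k⟩) (Sigma.Lex.right _ _ hk)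
      (Sigma.Lex.right _ _ hk')⟩

omit [∀ j, OrderTop (I j)] in
lemma map_comp_app_bot {j j' : J} (f : j ⟶ j')
    (g : (toLex ⟨j, ⊥⟩ : Σₗ j, I j) ⟶ toLex ⟨j', ⊥⟩) :
    F.map f ≫ (s j').app ⊥ = (s j).app ⊥ ≫ (concat F G s t hst).map g := by
  obtain hk | rfl := (leOfHom f).lt_or_eq
  · refine Eq.trans ?_ (congrArg (fun m => (s j).app ⊥ ≫ m)
      (concatMap_of_lt F G s t ⊥ ⊥ hk (leOfHom g)).symm)
    refine Eq.trans ?_ (((reassoc_of% (hst j ⊥)) _).symm)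
    exact (congrArg (· ≫ _) (F.map_comp (homOfLE _) (homOfLE _))).trans (assoc _ _ _)
  · obtain rfl : f = 𝟙 _ := Subsingleton.elim _ _
    obtain rfl : g = 𝟙 _ := Subsingleton.elim _ _
    rw [F.map_id]
    exact (id_comp _).trans ((congrArg (fun m => (s j).app ⊥ ≫ m)
      ((concat F G s t hst).map_id (toLex ⟨j, ⊥⟩))).trans (comp_id ((s j).app ⊥))).symm

lemma nonempty_isColimit_of_iso {C : Type*} [Category* C] {D : Type*} [Category* D] {F G : D ⥤ C}
    {c : Cocone F} {c' : Cocone G} (hc : Nonempty (IsColimit c)) (e : F ≅ G) (i : c.pt ≅ c'.pt)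
    (h : ∀ j, c.ι.app j ≫ i.hom = e.hom.app j ≫ c'.ι.app j) : Nonempty (IsColimit c') :=
  ⟨IsColimit.equivOfNatIsoOfIso e c c' (Cocone.ext i fun j => by simp [h]) hc.some⟩

lemma isWellOrderContinuous_concat (hs : ∀ j, IsIso ((s j).app ⊥)) [F.IsWellOrderContinuous]
    (hG : ∀ j, (G j).IsWellOrderContinuous) : (concat F G s t hst).IsWellOrderContinuous where
  nonempty_isColimit := by
    intro ⟨j, i⟩ hm
    change Order.IsSuccLimit (toLex ⟨j, i⟩ : Σₗ j, I j) at hm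
    by_cases hi : i = ⊥
    · subst hi
      have hj : Order.IsSuccLimit j := by
        refine ⟨fun hj => hm.1 ?_, fun k hk => hm.2 (toLex ⟨k, ⊤⟩) ⟨Sigma.Lex.left _ _ hk.1, ?_⟩⟩
        · intro ⟨k, i⟩ hb
          obtain hb | ⟨rfl, hb⟩ := sigmaLex_le hb
          · exact absurd (hj hb.le) (not_le.2 hb)
          · exact Sigma.Lex.right _ _ bot_le
        · intro ⟨l, i⟩ h h'
          obtain h | ⟨rfl, h⟩ := sigmaLex_lt h
          · obtain h' | ⟨rfl, h'⟩ := sigmaLex_lt h'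
            · exact hk.2 h h'
            · exact not_lt_bot h'
          · exact not_top_lt h
      let m : Σₗ j, I j := toLex ⟨j, ⊥⟩
      let f : Set.Iio j → Set.Iio m := fun k => ⟨toLex ⟨k.1, ⊥⟩, Sigma.Lex.left _ _ k.2⟩
      have hf : Monotone f := by
        intro k k' hk
        obtain hk | rfl := hk.lt_or_eq
        · exact Sigma.Lex.left _ _ hk
        · exact le_rfl
      refine nonempty_isColimit_of_cofinal _ m f hf ?_ ?_
      · rintro ⟨⟨k, i⟩, hk⟩
        obtain hk | ⟨rfl, hk⟩ := sigmaLex_lt hk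
        · refine ⟨⟨Order.succ k, hj.succ_lt hk⟩, Sigma.Lex.left _ _ ?_⟩
          exact Order.lt_succ_of_not_isMax (not_isMax_of_lt hk)
        · exact (not_lt_bot hk).elim
      · refine nonempty_isColimit_of_iso ⟨F.isColimitOfIsWellOrderContinuous j hj⟩ (NatIso.ofComponents
          (fun k => @asIso _ _ _ _ ((s k.1).app ⊥) (hs k.1)) ?_) (@asIso _ _ _ _ ((s j).app ⊥) (hs j)) ?_
        · exact fun {k k'} h => map_comp_app_bot F G s t hst (homOfLE (leOfHom h)) (homOfLE (hf (leOfHom h)))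
        · exact fun k => map_comp_app_bot F G s t hst (homOfLE k.2.le)
            (homOfLE (f k).2.le)
    · have hi' : Order.IsSuccLimit i := by
        refine ⟨fun h => hi h.eq_bot, fun k hk => hm.2 (toLex ⟨j, k⟩)
          ⟨Sigma.Lex.right _ _ hk.1, ?_⟩⟩
        intro ⟨l, i⟩ h h'
        obtain h | ⟨rfl, h⟩ := sigmaLex_lt h
        · obtain h' | ⟨rfl, h'⟩ := sigmaLex_lt h'
          · exact lt_asymm h h'
          · exact lt_irrefl _ h
        · obtain h' | ⟨e, h'⟩ := sigmaLex_lt h'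
          · exact lt_irrefl _ h'
          · exact hk.2 h h'
      let m : Σₗ j, I j := toLex ⟨j, i⟩
      let f : Set.Iio i → Set.Iio m := fun k => ⟨toLex ⟨j, k.1⟩, Sigma.Lex.right _ _ k.2⟩
      have hf : Monotone f := fun k k' hk => Sigma.Lex.right _ _ hk
      refine nonempty_isColimit_of_cofinal _ m f hf ?_ ?_
      · rintro ⟨⟨k, i'⟩, hk⟩
        obtain hk | ⟨rfl, hk⟩ := sigmaLex_lt hk
        · exact ⟨⟨⊥, bot_lt_iff_ne_bot.2 hi⟩, Sigma.Lex.left _ _ hk⟩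
        · exact ⟨⟨i', hk⟩, le_rfl⟩
      · refine nonempty_isColimit_of_iso ⟨(G j).isColimitOfIsWellOrderContinuous i hi'⟩ (NatIso.ofComponents
          (fun k => Iso.refl _) ?_) (Iso.refl _) ?_
        · intro k k' h
          refine (comp_id _).trans (Eq.trans ?_ (id_comp _).symm)
          exact (concat_map_self F G s t hst (leOfHom h) (homOfLE (hf (leOfHom h)))).symm
        · intro k
          refine (comp_id _).trans (Eq.trans ?_ (id_comp _).symm)
          exact (concat_map_self F G s t hst k.2.le (homOfLE (f k).2.le)).symm

end Flatten

section Composites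

variable {C : Type u} [Category.{v} C]

lemma chainComposites_of_covBy_chainComposites {T : MorphismProperty C}
    (hT : ∀ {A B : C} (f : A ⟶ B), IsIso f → T f) {J : Type v} [LinearOrder J] [OrderBot J]
    [OrderTop J] [WellFoundedLT J] (F : J ⥤ C) [F.IsWellOrderContinuous]
    (h : ∀ (i j : J) (h : i ⋖ j), chainComposites T (F.map (homOfLE h.le))) :
    chainComposites T (F.map (homOfLE (bot_le : (⊥ : J) ≤ ⊤))) := by
  let _ : SuccOrder J := SuccOrder.ofLinearWellFoundedLT J
  have h' (j : J) : chainComposites T (F.map (homOfLE (Order.le_succ j))) := by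
    by_cases hj : IsMax j
    · have : IsIso (homOfLE (Order.le_succ j)) :=
        ⟨homOfLE (hj (Order.le_succ j)), Subsingleton.elim _ _, Subsingleton.elim _ _⟩
      exact chainComposites_of_isIso T _
    · exact h _ _ (Order.covBy_succ_of_not_isMax hj)
  choose I i₁ i₂ i₃ i₄ i₅ G hG hGT e using h'
  replace e := fun j => (e j).some
  let s (j : J) : (Functor.const (I j)).obj (F.obj j) ⟶ G j :=
    { app i := (e j).inv.left ≫ (G j).map (homOfLE bot_le)
      naturality i i' f := (id_comp _).trans
        ((congrArg _ ((G j).map_comp (homOfLE _) f)).trans (assoc _ _ _).symm) }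
  let t (j : J) : G j ⟶ (Functor.const (I j)).obj (F.obj (Order.succ j)) :=
    { app i := (G j).map (homOfLE le_top) ≫ (e j).hom.right
      naturality i i' f := ((assoc _ _ _).symm.trans
        (congrArg (· ≫ _) ((G j).map_comp f (homOfLE _)).symm)).trans (comp_id _).symm }
  have hst (j : J) (i : I j) : (s j).app i ≫ (t j).app i = F.map (homOfLE (Order.le_succ j)) := by
    have h₁ := (e j).inv.w
    have h₂ : (e j).inv.right ≫ (e j).hom.right = 𝟙 _ := congrArg CommaMorphism.right (e j).inv_hom_id
    have h₃ := (G j).map_comp (homOfLE (bot_le : ⊥ ≤ i)) (homOfLE (le_top : i ≤ ⊤))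
    dsimp [s, t] at h₁ h₂ ⊢
    rw [assoc, ← assoc ((G j).map _), ← h₃]
    exact (assoc _ _ _).symm.trans ((congrArg (· ≫ _) h₁).trans ((assoc _ _ _).trans
      ((congrArg _ h₂).trans (comp_id _))))
  have hs (j : J) : IsIso ((s j).app ⊥) := by
    have : (s j).app ⊥ = (e j).inv.left :=
      (congrArg _ ((G j).map_id ⊥)).trans (comp_id _)
    rw [this]
    infer_instance
  have hs' : IsIso ((s ⊤).app ⊤) := by
    have h₁ : IsIso ((s ⊤).app ⊤ ≫ (t ⊤).app ⊤) := by
      have : IsIso (homOfLE (Order.le_succ (⊤ : J))) :=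
        ⟨homOfLE le_top, Subsingleton.elim _ _, Subsingleton.elim _ _⟩
      rw [hst]
      exact inferInstanceAs (IsIso (F.map (homOfLE (Order.le_succ (⊤ : J)))))
    have h₂ : IsIso ((t ⊤).app ⊤) := by
      have : (t ⊤).app ⊤ = (e ⊤).hom.right :=
        (congrArg (· ≫ _) ((G ⊤).map_id ⊤)).trans (id_comp _)
      rw [this]
      infer_instance
    exact IsIso.of_isIso_comp_right _ ((t ⊤).app ⊤)
  have : WellFoundedLT (Σₗ j, I j) :=
    ⟨Subrelation.wf (r := InvImage (PSigma.Lex (· < ·) fun _ => (· < ·))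
      fun a : Σₗ j, I j => (⟨a.1, a.2⟩ : Σ' j, I j))
      (fun {a b} h => by
        obtain ⟨j, i⟩ := a
        obtain ⟨j', i'⟩ := b
        obtain h | ⟨rfl, h⟩ := sigmaLex_lt h
        · exact PSigma.Lex.left _ _ h
        · exact PSigma.Lex.right _ h)
      (InvImage.wf _ (WellFounded.psigma_lex wellFounded_lt fun _ => wellFounded_lt))⟩
  have := isWellOrderContinuous_concat F G s t hst hs hG
  refine (MorphismProperty.arrow_mk_iso_iff _ (Arrow.isoMk
    (@asIso _ _ _ _ ((s ⊥).app ⊥) (hs ⊥)) (@asIso _ _ _ _ ((s ⊤).app ⊤) hs') ?_)).2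
    (chainComposites_of_covBy (concat F G s t hst) ?_)
  · have h₁ := map_comp_app_bot F G s t hst (homOfLE (bot_le : (⊥ : J) ≤ ⊤))
      (homOfLE (bot_le (α := Σₗ j, I j)))
    have h₂ : (s ⊤).app ⊤ = (s ⊤).app ⊥ ≫ (G ⊤).map (homOfLE bot_le) :=
      (id_comp _).symm.trans ((s ⊤).naturality (homOfLE (bot_le : (⊥ : I ⊤) ≤ ⊤)))
    have h₃ := concat_map_self F G s t hst (bot_le : (⊥ : I ⊤) ≤ ⊤)
      (homOfLE (le_top (α := Σₗ j, I j)))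
    have h₄ := (concat F G s t hst).map_comp (homOfLE (bot_le (α := Σₗ j, I j) (a := toLex ⟨⊤, ⊥⟩)))
      (homOfLE (le_top (α := Σₗ j, I j)))
    refine Eq.symm (Eq.trans (congrArg (fun m => F.map (homOfLE (bot_le : (⊥ : J) ≤ ⊤)) ≫ m) h₂) ?_)
    refine Eq.trans (assoc _ _ _).symm ?_
    refine Eq.trans (congrArg (fun m => m ≫ (G ⊤).map (homOfLE bot_le)) h₁) ?_
    refine Eq.trans (assoc _ _ _) (congrArg (fun m => (s ⊥).app ⊥ ≫ m) ?_)
    rw [← h₃]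
    exact h₄.symm
  · rintro ⟨j, i⟩ ⟨j', i'⟩ hij
    obtain ⟨rfl, hi⟩ | ⟨hj, rfl, rfl⟩ := sigmaLex_covBy_iff hij
    · have := hGT j i (not_isMax_of_lt hi.1)
      obtain rfl : Order.succ i = i' := hi.succ_eq
      have key {m} (hm : m = (G j).map (homOfLE hi.le)) : T m := by rwa [hm]
      apply key
      exact concat_map_self F G s t hst hi.le _
    · have key {m} (hm : m = (t j).app ⊤ ≫ F.map (homOfLE (Order.succ_le_of_lt hj.1)) ≫
          (s j').app ⊥) (h : IsIso ((t j).app ⊤ ≫ F.map (homOfLE (Order.succ_le_of_lt hj.1)) ≫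
          (s j').app ⊥)) : T m := hT m (hm ▸ h)
      refine key (concatMap_of_lt F G s t _ _ hj.1 _) ?_
      have h₂ : IsIso ((t j).app ⊤) := by
        have : (t j).app ⊤ = (e j).hom.right :=
          (congrArg (· ≫ _) ((G j).map_id ⊤)).trans (id_comp _)
        rw [this]
        infer_instance
      have : IsIso (homOfLE (Order.succ_le_of_lt hj.1)) :=
        ⟨homOfLE hj.succ_eq.ge, Subsingleton.elim _ _, Subsingleton.elim _ _⟩
      have := hs j'
      exact inferInstanceAs (IsIso (_ ≫ _))

end Composites

section TopExtension

variable {C : Type*} [Category* C] {J : Type*} [LinearOrder J] (F : J ⥤ C) (c : Cocone F)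

/-- Morphism part of the extension of a functor by the point of a cocone. -/
def topExtensionMap : ∀ (a b : WithTop J) (_ : a ≤ b),
    (Option.elim a c.pt F.obj ⟶ Option.elim b c.pt F.obj)
  | some _, some _, h => F.map (homOfLE (WithTop.coe_le_coe.1 h))
  | some i, none, _ => c.ι.app i
  | none, none, _ => 𝟙 _
  | none, some j, h => (WithTop.not_top_le_coe j h).elim

/-- The extension of a functor on `J` to `WithTop J` by the point of a cocone. -/
def topExtension : WithTop J ⥤ C where
  obj a := Option.elim a c.pt F.obj
  map f := topExtensionMap F c _ _ (leOfHom f)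
  map_id a := by
    obtain _ | i := a
    · rfl
    · exact F.map_id i
  map_comp {a b d} f g := by
    obtain _ | i := a <;> obtain _ | j := b <;> obtain _ | k := d
    · exact (id_comp _).symm
    · exact (WithTop.not_top_le_coe k (leOfHom g)).elim
    · exact (WithTop.not_top_le_coe j (leOfHom f)).elim
    · exact (WithTop.not_top_le_coe j (leOfHom f)).elim
    · exact (comp_id _).symm
    · exact (WithTop.not_top_le_coe k (leOfHom g)).elim
    · exact (c.w _).symm
    · exact F.map_comp (homOfLE (WithTop.coe_le_coe.1 (leOfHom f)))
        (homOfLE (WithTop.coe_le_coe.1 (leOfHom g)))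

lemma isWellOrderContinuous_topExtension (hc : Nonempty (IsColimit c)) [F.IsWellOrderContinuous] :
    (topExtension F c).IsWellOrderContinuous where
  nonempty_isColimit m hm := by
    obtain _ | m := m
    · have : Nonempty J := by
        by_contra h
        rw [not_nonempty_iff] at h
        refine hm.1 fun b _ => ?_
        obtain _ | b := b
        · exact le_rfl
        · exact h.elim b
      let f : J → Set.Iio (⊤ : WithTop J) := fun j => ⟨some j, WithTop.coe_lt_top j⟩
      have hf : Monotone f := fun _ _ h => WithTop.coe_le_coe.2 h
      refine nonempty_isColimit_of_cofinal (topExtension F c) _ f hf ?_ ?_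
      · rintro ⟨_ | k, hk⟩
        · exact (lt_irrefl (⊤ : WithTop J) hk).elim
        · exact ⟨k, le_rfl⟩
      · exact nonempty_isColimit_of_iso hc (NatIso.ofComponents (fun _ => Iso.refl _)
          fun f => (comp_id _).trans (id_comp _).symm) (Iso.refl _)
          fun f => (comp_id _).trans (id_comp _).symm
    · have hm' : Order.IsSuccLimit m := by
        refine ⟨fun h => hm.1 fun b hb => ?_, fun k hk => hm.2 (some k)
          ⟨WithTop.coe_lt_coe.2 hk.1, fun l h₁ h₂ => ?_⟩⟩
        · obtain _ | b := b
          · exact (WithTop.not_top_le_coe m hb).elim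
          · exact WithTop.coe_le_coe.2 (h (WithTop.coe_le_coe.1 hb))
        · obtain _ | l := l
          · exact (WithTop.not_top_le_coe m h₂.le).elim
          · exact hk.2 (WithTop.coe_lt_coe.1 h₁) (WithTop.coe_lt_coe.1 h₂)
      have : Nonempty (Set.Iio m) := by
        by_contra h
        exact hm'.1 fun k hk => not_lt.1 fun hk' => h ⟨⟨k, hk'⟩⟩
      let f : Set.Iio m → Set.Iio (WithTop.some m : WithTop J) :=
        fun j => ⟨some j.1, WithTop.coe_lt_coe.2 j.2⟩
      have hf : Monotone f := fun _ _ h => WithTop.coe_le_coe.2 h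
      refine nonempty_isColimit_of_cofinal (topExtension F c) _ f hf ?_ ?_
      · rintro ⟨_ | k, hk⟩
        · exact (WithTop.not_top_le_coe m hk.le).elim
        · exact ⟨⟨k, WithTop.coe_lt_coe.1 hk⟩, le_rfl⟩
      · exact nonempty_isColimit_of_iso ⟨F.isColimitOfIsWellOrderContinuous m hm'⟩
          (NatIso.ofComponents (fun _ => Iso.refl _)
          fun f => (comp_id _).trans (id_comp _).symm) (Iso.refl _)
          fun f => (comp_id _).trans (id_comp _).symm

end TopExtension

section Cellular

variable {C : Type u} [Category.{v} C]

lemma isWellOrderContinuous_of_coconeLT {J : Type w} [LinearOrder J] (F : J ⥤ C)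
    (h : ∀ j, Order.IsSuccLimit j → Nonempty (IsColimit (CellularPaper.coconeLT F j))) :
    F.IsWellOrderContinuous where
  nonempty_isColimit m hm :=
    nonempty_isColimit_of_iso (h m hm) (Iso.refl _) (Iso.refl _)
      fun _ => (comp_id _).trans (id_comp _).symm

lemma nonempty_isColimit_coconeLT {J : Type w} [LinearOrder J] (F : J ⥤ C)
    [F.IsWellOrderContinuous] (j : J) (hj : Order.IsSuccLimit j) :
    Nonempty (IsColimit (CellularPaper.coconeLT F j)) :=
  nonempty_isColimit_of_iso ⟨F.isColimitOfIsWellOrderContinuous j hj⟩ (Iso.refl _) (Iso.refl _)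
      fun _ => (comp_id _).trans (id_comp _).symm

lemma Po_of_isPushout {S : MorphismProperty C} {A B A' B' : C} {f : A ⟶ B} {u : A ⟶ A'}
    {v : B ⟶ B'} {g : A' ⟶ B'} (h : IsPushout f u v g) (hf : CellularPaper.Po S f) :
    CellularPaper.Po S g := by
  obtain ⟨_, _, k, a, b, hk, hk'⟩ := hf
  exact ⟨_, _, k, _, _, hk, hk'.flip.paste_horiz h.flip |>.flip⟩

lemma chainComposites_of_mem {T : MorphismProperty C} {A B : C} {f : A ⟶ B} (hf : T f) :
    chainComposites T f := by
  let c : Cocone ((Functor.const PUnit.{v + 1}).obj A) :=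
    Cocone.mk B { app _ := f, naturality _ _ _ := (id_comp _).trans (comp_id _).symm }
  let Φ : WithTop PUnit.{v + 1} ⥤ C := topExtension ((Functor.const PUnit.{v + 1}).obj A) c
  have hΦ : Φ.IsWellOrderContinuous := ⟨fun m hm => by
    obtain _ | m := m
    · refine (hm.2 (some PUnit.unit) ⟨WithTop.coe_lt_top _, fun k h₁ h₂ => ?_⟩).elim
      obtain _ | k := k
      · exact lt_irrefl _ h₂
      · exact lt_irrefl _ h₁
    · exact (hm.1 fun b hb => by
        obtain _ | k := b
        · exact (WithTop.not_top_le_coe (α := PUnit.{v + 1}) m hb).elim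
        · exact le_rfl).elim⟩
  exact chainComposites_of_covBy Φ fun i j hij => by
    obtain _ | i := i
    · exact (not_top_lt hij.1).elim
    obtain _ | j := j
    · exact hf
    · exact (lt_irrefl _ hij.1).elim

lemma isCellular_chainComposites [HasPushouts C] {T : MorphismProperty C}
    (hT : ∀ {A B : C} (f : A ⟶ B), IsIso f → T f)
    (hT' : ∀ {A B A' B' : C} {f : A ⟶ B} {u : A ⟶ A'} {v : B ⟶ B'} {g : A' ⟶ B'},
      IsPushout f u v g → T f → T g) : CellularPaper.IsCellular (chainComposites T) where
  isos f hf := chainComposites_of_isIso T f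
  pushout h hf := chainComposites_of_isPushout hT' h hf
  transfinite {A B} f hf := by
    obtain ⟨J, _, _, _, _, F, c, hc, eA, eB, hF, hl, rfl⟩ := hf
    have := isWellOrderContinuous_of_coconeLT F hl
    have := isWellOrderContinuous_topExtension F c ⟨hc⟩
    refine (MorphismProperty.arrow_mk_iso_iff _ (Arrow.isoMk eA eB.symm ?_)).2
      (chainComposites_of_covBy_chainComposites (J := WithTop J) hT (topExtension F c) ?_)
    · change _ = (_ ≫ _ ≫ _) ≫ _
      simp only [assoc, Iso.symm_hom, Iso.hom_inv_id, comp_id]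
      rfl
    · intro i j hij
      obtain _ | i := i
      · exact (not_top_lt hij.1).elim
      obtain _ | j := j
      · have hi : IsMax i := by
          by_contra hi
          exact hij.2 (c := some (Order.succ i))
            (WithTop.coe_lt_coe.2 (Order.lt_succ_of_not_isMax hi)) (WithTop.coe_lt_top _)
        have : IsIso (c.ι.app i) := by
          let _ : OrderTop J := { top := i, le_top := fun k => le_of_not_gt fun h => h.not_ge (hi h.le) }
          let tX : IsTerminal i := isTerminalTop (α := J)
          have h := (colimitOfDiagramTerminal tX F).comp_coconePointUniqueUpToIso_hom hc i
          rw [← h]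
          have e : tX.from i = 𝟙 i := Subsingleton.elim _ _
          dsimp
          rw [e, F.map_id]
          infer_instance
        exact chainComposites_of_isIso T (c.ι.app i)
      · have hij' : i ⋖ j := ⟨WithTop.coe_lt_coe.1 hij.1, fun k h₁ h₂ =>
          hij.2 (c := some k) (WithTop.coe_lt_coe.2 h₁) (WithTop.coe_lt_coe.2 h₂)⟩
        obtain rfl := hij'.succ_eq
        exact hF i (not_isMax_of_lt hij'.1)

end Cellular

section Cellular

variable {C : Type u} [Category.{v} C]

lemma chainComposites_mono {S T : MorphismProperty C} (h : S ≤ T) :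
    chainComposites S ≤ chainComposites T := by
  rintro _ _ f ⟨J, _, _, _, _, _, F, hF, hS, e⟩
  exact ⟨J, _, _, _, _, ‹_›, F, hF, fun j hj => h _ (hS j hj), e⟩

lemma isTransfiniteCompositionOf_of_chainComposites (T : MorphismProperty C) :
    chainComposites T ≤ CellularPaper.IsTransfiniteCompositionOf.{v} T := by
  rintro A B f ⟨J, _, _, _, _, _, F, hF, hT, ⟨e⟩⟩
  refine ⟨J, inferInstance, inferInstance, inferInstance, inferInstance, F, _,
    colimitOfDiagramTerminal (isTerminalTop (α := J)) F,
    (Arrow.leftFunc.mapIso e).symm, Arrow.rightFunc.mapIso e, hT,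
    nonempty_isColimit_coconeLT F, ?_⟩
  have h₁ := e.inv.w
  have h₂ : e.inv.right ≫ e.hom.right = 𝟙 _ := congrArg CommaMorphism.right e.inv_hom_id
  dsimp at h₁ h₂ ⊢
  exact (assoc _ _ _).symm.trans ((congrArg (· ≫ _) h₁).trans ((assoc _ _ _).trans
      ((congrArg _ h₂).trans (comp_id _))))

lemma chainComposites_le_of_isCellular {W : MorphismProperty C} (hW : CellularPaper.IsCellular W) :
    chainComposites W ≤ W := fun _ _ f hf =>
  hW.transfinite f (isTransfiniteCompositionOf_of_chainComposites W _ hf)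

lemma Po_le_of_isCellular {S W : MorphismProperty C} (hW : CellularPaper.IsCellular W)
    (h : S ≤ W) : CellularPaper.Po S ≤ W := by
  rintro _ _ f ⟨_, _, k, a, b, hk, hk'⟩
  exact hW.pushout hk' (h _ hk)

lemma Po_of_isIso {S : MorphismProperty C} (h : ∀ A : C, ∃ (U : C) (_ : U ⟶ A), S (𝟙 U))
    {A B : C} (f : A ⟶ B) (hf : IsIso f) : CellularPaper.Po S f := by
  obtain ⟨U, a, hU⟩ := h A
  exact ⟨U, U, 𝟙 U, a, a ≫ f, hU, IsPushout.of_horiz_isIso ⟨by simp⟩⟩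

lemma cellClosure_le_chainComposites [HasPushouts C] {S : MorphismProperty C}
    (h : ∀ A : C, ∃ (U : C) (_ : U ⟶ A), S (𝟙 U)) :
    CellularPaper.cellClosure S ≤ chainComposites (CellularPaper.Po S) := fun _ _ f hf =>
  hf _ (isCellular_chainComposites (Po_of_isIso h) Po_of_isPushout) fun _ _ _ hg =>
    chainComposites_of_mem ⟨_, _, _, 𝟙 _, 𝟙 _, hg, IsPushout.of_vert_isIso ⟨by simp⟩⟩

end Cellular

section Presentable

variable {C : Type u} [Category.{v} C]

lemma isCardinalPresentable_of_isPushout {κ : Cardinal.{v}} [Fact κ.IsRegular]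
    {A B A' B' : C} {f : A ⟶ B} {u : A ⟶ A'} {v : B ⟶ B'} {g : A' ⟶ B'} (h : IsPushout f u v g)
    [IsCardinalPresentable A κ] [IsCardinalPresentable B κ] [IsCardinalPresentable A' κ] :
    IsCardinalPresentable B' κ := by
  have (k : WalkingSpan) : IsCardinalPresentable ((span f u).obj k) κ := by
    match k with
    | .zero => assumption
    | .left => assumption
    | .right => assumption
  exact isCardinalPresentable_of_isColimit' _ h.isColimit κ
    (hasCardinalLT_of_finite _ _ (Fact.out : κ.IsRegular).aleph0_le)

lemma isIso_map_of_succ {J : Type*} [LinearOrder J] [SuccOrder J] [OrderBot J] [WellFoundedLT J]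
    (G : J ⥤ C) [G.IsWellOrderContinuous] {i m : J} (him : i ≤ m)
    (h : ∀ k, i ≤ k → k < m → IsIso (G.map (homOfLE (Order.le_succ k)))) :
    IsIso (G.map (homOfLE him)) := by
  induction m using SuccOrder.limitRecOn with
  | isMin m hm =>
    obtain rfl : i = m := le_antisymm him (hm him)
    exact (G.map_id i) ▸ inferInstance
  | succ m hm ih =>
    obtain hi | rfl := him.lt_or_eq
    · have hi' := (Order.lt_succ_iff_of_not_isMax hm).1 hi
      have := ih hi' fun k hk hkm => h k hk (hkm.trans (Order.lt_succ_of_not_isMax hm))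
      have := h m hi' (Order.lt_succ_of_not_isMax hm)
      have e : G.map (homOfLE him) = G.map (homOfLE hi') ≫ G.map (homOfLE (Order.le_succ m)) :=
        (G.map_comp _ _).symm.trans rfl |>.symm
      rw [e]
      infer_instance
    · exact (G.map_id _) ▸ inferInstance
  | isSuccLimit m hm ih =>
    obtain hi | rfl := him.lt_or_eq
    · have hk (k : J) (hk : i ≤ k) (hkm : k < m) : IsIso (G.map (homOfLE hk)) :=
        ih k hkm hk fun l hl hlk => h l hl (hlk.trans hkm)
      have : Nonempty (Set.Ico i m) := ⟨⟨i, le_rfl, hi⟩⟩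
      have : IsConnected (Set.Ico i m) := IsFiltered.isConnected _
      obtain ⟨hc⟩ := exists_isColimit_Ico G hm hi
      let ι := (Subtype.mono_coe (· ∈ Set.Ico i m)).functor
      let a : (Functor.const (Set.Ico i m)).obj (G.obj i) ⟶ ι ⋙ G :=
        { app l := G.map (homOfLE l.2.1)
          naturality _ _ _ := (id_comp _).trans (G.map_comp _ _) }
      have e (l : Set.Ico i m) :
          G.map (homOfLE him) = G.map (homOfLE l.2.1) ≫ G.map (homOfLE l.2.2.le) := by
        rw [← G.map_comp]; rfl
      have key : IsPushout (𝟙 (G.obj i)) (𝟙 (G.obj i)) (G.map (homOfLE him))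
          (G.map (homOfLE him)) :=
        isPushout_of_isColimit (t := 𝟙 _) (l := 𝟙 _) (r := a) (b := a)
          (c₁ := (constCocone _ _).ι) (c₂ := (constCocone _ _).ι) (c₃ := (constCocone _ _).ι)
          (fun l => by
            have := hk l.1 l.2.1 l.2.2
            have : IsIso (a.app l) := this
            exact (IsPushout.of_horiz_isIso ⟨rfl⟩ :
              IsPushout (𝟙 (G.obj i)) (𝟙 (G.obj i)) (a.app l) (a.app l)))
          (isColimitConstCocone _ _) (isColimitConstCocone _ _) (isColimitConstCocone _ _) hc
          (fun l => rfl) (fun l => rfl)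
          (fun l => (id_comp _).trans (e l)) (fun l => (id_comp _).trans (e l))
      exact MorphismProperty.of_isPushout (P := .isomorphisms C) key
        (MorphismProperty.isomorphisms.infer_property _)
    · exact (G.map_id _) ▸ inferInstance

lemma isCardinalPresentable_obj_of_links {κ : Cardinal.{v}} [Fact κ.IsRegular] {J : Type v}
    [LinearOrder J] [SuccOrder J] [OrderBot J] [WellFoundedLT J] (G : J ⥤ C)
    [G.IsWellOrderContinuous] (h₀ : IsCardinalPresentable (G.obj ⊥) κ) (N : Set J)
    (hN : HasCardinalLT N κ)
    (hlink : ∀ j, j ∈ N → ¬ IsMax j → IsCardinalPresentable (G.obj j) κ →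
      IsCardinalPresentable (G.obj (Order.succ j)) κ)
    (hiso : ∀ j, j ∉ N → ¬ IsMax j → IsIso (G.map (homOfLE (Order.le_succ j)))) (m : J) :
    IsCardinalPresentable (G.obj m) κ := by
  induction m using SuccOrder.limitRecOn with
  | isMin m hm => rwa [hm.eq_bot]
  | succ m hm ih =>
    by_cases hmN : m ∈ N
    · exact hlink m hmN hm ih
    · have := hiso m hmN hm
      exact isCardinalPresentable_of_iso (asIso (G.map (homOfLE (Order.le_succ m)))) κ
  | isSuccLimit m hm ih =>
    by_cases hb : ∃ i, i < m ∧ ∀ j ∈ N, i ≤ j → m ≤ j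
    · obtain ⟨i, him, hi⟩ := hb
      have := isIso_map_of_succ G him.le fun k hik hkm =>
        hiso k (fun hk => (hkm.trans_le (hi k hk hik)).false) hkm.not_isMax
      have := ih i him
      exact isCardinalPresentable_of_iso (asIso (G.map (homOfLE him.le))) κ
    · push Not at hb
      let D := {j : N // j.1 < m}
      let f : D → Set.Iio m := fun d => ⟨d.1.1, d.2⟩
      have hf : Monotone f := fun _ _ h => h
      have : Nonempty D := by
        obtain ⟨j, hj, -, hjm⟩ := hb ⊥ hm.bot_lt
        exact ⟨⟨⟨j, hj⟩, hjm⟩⟩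
      have : hf.functor.Final := by
        rw [Monotone.final_functor_iff]
        rintro ⟨k, hk⟩
        obtain ⟨j, hj, hkj, hjm⟩ := hb k hk
        exact ⟨⟨⟨j, hj⟩, hjm⟩, hkj⟩
      have hD : HasCardinalLT (Arrow D) κ :=
        (hasCardinalLT_prod (Fact.out : κ.IsRegular).aleph0_le
          (hN.of_injective (fun d : D => d.1) Subtype.val_injective)
          (hN.of_injective (fun d : D => d.1) Subtype.val_injective)).of_injective
          (fun φ : Arrow D => (φ.left, φ.right)) (by
            rintro ⟨a, b, φ⟩ ⟨a', b', φ'⟩ h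
            obtain ⟨rfl, rfl⟩ := Prod.mk.inj h
            obtain rfl : φ = φ' := Subsingleton.elim _ _
            rfl)
      have (d : D) : IsCardinalPresentable ((hf.functor ⋙
          (Set.principalSegIio m).monotone.functor ⋙ G).obj d) κ := ih _ d.2
      exact isCardinalPresentable_of_isColimit' _
        ((Functor.Final.isColimitWhiskerEquiv (F := hf.functor) _).2
          (G.isColimitOfIsWellOrderContinuous m hm)) κ hD

end Presentable

section ChainPresentation

variable {C : Type u} [Category.{v} C] {J : Type v} [LinearOrder J] [SuccOrder J]

/-- A presentation of a chain `F` as a filtered colimit of chains with presentable values, such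
that each link of `F` is a pushout of the corresponding link of all sufficiently large terms, while
the same link of all the other terms is an isomorphism. -/
structure ChainPresentation (κ : Cardinal.{v}) [Fact κ.IsRegular] (S : MorphismProperty C)
    (F : J ⥤ C) (P : Type v) [Preorder P] where
  D : P ⥤ J ⥤ C
  φ : D ⟶ (Functor.const P).obj F
  isColimit : Nonempty (IsColimit (Cocone.mk F φ))
  presentable : ∀ p j, IsCardinalPresentable ((D.obj p).obj j) κ
  continuous : ∀ p, (D.obj p).IsWellOrderContinuous
  idx : J → P
  Po : ∀ j, ¬ IsMax j → ∀ q, idx j ≤ q →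
    CellularPaper.Po S ((D.obj q).map (homOfLE (Order.le_succ j)))
  isPushout : ∀ j, ¬ IsMax j → ∀ q, idx j ≤ q →
    IsPushout ((D.obj q).map (homOfLE (Order.le_succ j))) ((φ.app q).app j)
      ((φ.app q).app (Order.succ j)) (F.map (homOfLE (Order.le_succ j)))
  isPushout_map : ∀ j, ¬ IsMax j → ∀ q q' (h : q ≤ q'), idx j ≤ q →
    IsPushout ((D.obj q).map (homOfLE (Order.le_succ j))) ((D.map (homOfLE h)).app j)
      ((D.map (homOfLE h)).app (Order.succ j)) ((D.obj q').map (homOfLE (Order.le_succ j)))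
  isIso : ∀ j, ¬ IsMax j → ∀ q, ¬ idx j ≤ q →
    IsIso ((D.obj q).map (homOfLE (Order.le_succ j)))

/-- The category of presentations of the stages of a chain. -/
abbrev StagePresentation (F : J ⥤ C) (P : Type v) [Preorder P] :=
  Comma (𝟭 (P ⥤ C)) (F ⋙ Functor.const P)

/-- A morphism of presentations of stages extends one stage to the next one. -/
def stageStep (S : MorphismProperty C) (F : J ⥤ C) {P : Type v} [Preorder P] (t : P → Set J) :
    MorphismProperty (StagePresentation F P) := fun X Y f =>
  Nonempty (IsColimit (Cocone.mk _ X.hom)) → ¬ IsMax X.right →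
    Y.right = Order.succ X.right ∧ Nonempty (IsColimit (Cocone.mk _ Y.hom)) ∧
    ∃ p, X.right ∈ t p ∧
      (∀ q, p ≤ q → CellularPaper.Po S (f.left.app q)) ∧
      (∀ q, p ≤ q → IsPushout (f.left.app q) (X.hom.app q) (Y.hom.app q) (F.map f.right)) ∧
      (∀ q q' (h : q ≤ q'), p ≤ q → IsPushout (f.left.app q) (X.left.map (homOfLE h))
        (Y.left.map (homOfLE h)) (f.left.app q')) ∧
      ∀ q, ¬ p ≤ q → IsIso (f.left.app q)

lemma exists_stageStep [HasColimitsOfSize.{v, v} C] {κ : Cardinal.{v}} [Fact κ.IsRegular]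
    {S : MorphismProperty C}
    (hS : ∀ ⦃A B : C⦄ (f : A ⟶ B), S f → IsCardinalPresentable A κ) {F : J ⥤ C}
    (hF : ∀ j, ¬ IsMax j → CellularPaper.Po S (F.map (homOfLE (Order.le_succ j))))
    {P : Type v} [Preorder P] [IsCardinalFiltered P κ] (t : P → Set J)
    (ht : ∀ p j, ∃ q, p ≤ q ∧ j ∈ t q) (X : StagePresentation F P) :
    ∃ (Y : StagePresentation F P) (f : X ⟶ Y), stageStep S F t f := by
  by_cases hX : Nonempty (IsColimit (Cocone.mk _ X.hom)) ∧ ¬ IsMax X.right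
  · obtain ⟨⟨hX⟩, hm⟩ := hX
    obtain ⟨U, V, u, a₀, v, hu, sq⟩ := hF _ hm
    have := hS u hu
    obtain ⟨p₀, a₁, ha₁⟩ := IsCardinalPresentable.exists_hom_of_isColimit κ hX a₀
    obtain ⟨p, hp, hj⟩ := ht p₀ X.right
    have ha : (a₁ ≫ X.left.map (homOfLE hp)) ≫ X.hom.app p = a₀ := by
      rw [assoc, ← ha₁]
      exact congrArg _ ((Cocone.mk _ X.hom).w (homOfLE hp))
    obtain ⟨Y, f, y, b, hy, hb, hc, h₁, h₂⟩ := exists_cell_extension (P := P) (X := (X.left : P ⥤ C)) X.hom hX u p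
      (a₁ ≫ X.left.map (homOfLE hp)) v _ (by rw [ha]; exact sq)
    have hmap (q q' : P) (h : q ≤ q') (hq : p ≤ q) : IsPushout (f.app q)
        (X.left.map (homOfLE h)) (Y.map (homOfLE h)) (f.app q') := by
      refine IsPushout.of_top ?_ (f.naturality _).symm (h₁ q hq)
      have := h₁ q' (hq.trans h)
      rw [← homOfLE_comp hq h, X.left.map_comp, Y.map_comp, ← assoc, ← assoc] at this
      exact this
    let Y' : StagePresentation F P := { left := Y, right := Order.succ X.right, hom := y }
    let f' : X ⟶ Y' :=
      { left := f
        right := homOfLE (Order.le_succ _)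
        w := hy }
    refine ⟨Y', f', fun _ _ => ⟨rfl, hc, p, hj, fun q hq => ⟨U, V, u, _, _, hu, h₁ q hq⟩,
      fun q hq => ?_, hmap, h₂⟩⟩
    refine IsPushout.of_top ?_ (congr_app hy q) (h₁ q hq)
    have e₁ : X.left.map (homOfLE hq) ≫ X.hom.app q = X.hom.app p :=
      (Cocone.mk _ X.hom).w (homOfLE hq)
    have e₂ : Y.map (homOfLE hq) ≫ y.app q = y.app p := (Cocone.mk _ y).w (homOfLE hq)
    have e₃ : (b ≫ Y.map (homOfLE hq)) ≫ y.app q = v := by rw [assoc, e₂, hb]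
    have e₄ : ((a₁ ≫ X.left.map (homOfLE hp)) ≫ X.left.map (homOfLE hq)) ≫ X.hom.app q = a₀ :=
      (assoc _ _ _).trans ((congrArg _ e₁).trans ha)
    rw [← e₃, ← e₄] at sq
    exact sq
  · exact ⟨X, 𝟙 X, fun h₁ h₂ => (hX ⟨h₁, h₂⟩).elim⟩

end ChainPresentation

section ChainPresentation

variable {C : Type u} [Category.{v} C] {J : Type v} [LinearOrder J]

lemma isWellOrderContinuous_comp {D E : Type*} [Category* D] [Category* E]
    (Φ : J ⥤ D) [Φ.IsWellOrderContinuous] (G : D ⥤ E) [PreservesColimitsOfSize.{v, v} G] :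
    (Φ ⋙ G).IsWellOrderContinuous where
  nonempty_isColimit j hj :=
    ⟨isColimitOfPreserves G (Φ.isColimitOfIsWellOrderContinuous j hj)⟩

lemma eq_of_isWellOrderContinuous (Φ : J ⥤ J) [Φ.IsWellOrderContinuous]
    {m : J} (hm : Order.IsSuccLimit m) (h : ∀ i < m, Φ.obj i = i) : Φ.obj m = m := by
  apply le_antisymm
  · exact leOfHom ((Φ.isColimitOfIsWellOrderContinuous m hm).desc
      (Cocone.mk m { app i := homOfLE ((h i.1 i.2).le.trans i.2.le) }))
  · refine hm.le_iff_forall_le.2 fun i hi => ?_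
    rw [← h i hi]
    exact leOfHom (Φ.map (homOfLE hi.le))

variable [SuccOrder J] [OrderBot J] [OrderTop J] [WellFoundedLT J]

lemma exists_stageChain [HasColimitsOfSize.{v, v} C] {κ : Cardinal.{v}} [Fact κ.IsRegular]
    {S : MorphismProperty C}
    (hS : ∀ ⦃A B : C⦄ (f : A ⟶ B), S f → IsCardinalPresentable A κ) {F : J ⥤ C}
    [F.IsWellOrderContinuous]
    (hF : ∀ j, ¬ IsMax j → CellularPaper.Po S (F.map (homOfLE (Order.le_succ j))))
    {P : Type v} [Preorder P] [IsCardinalFiltered P κ] (t : P → Set J)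
    (ht : ∀ p j, ∃ q, p ≤ q ∧ j ∈ t q) (A : P ⥤ C) (α : A ⟶ (Functor.const P).obj (F.obj ⊥))
    (hα : Nonempty (IsColimit (Cocone.mk _ α))) :
    ∃ (Φ : J ⥤ StagePresentation F P), (Φ ⋙ Comma.fst _ _).IsWellOrderContinuous ∧
      Nonempty (A ≅ (Φ.obj ⊥).left) ∧
      (∀ j, ¬ IsMax j → stageStep S F t (Φ.map (homOfLE (Order.le_succ j)))) ∧
      ∀ j, (Φ.obj j).right = j ∧ Nonempty (IsColimit (Cocone.mk _ (Φ.obj j).hom)) := by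
  have : HasColimitsOfSize.{v, v} J := ⟨fun I _ => hasColimitsOfShape_of_wellFounded J I⟩
  let X₀ : StagePresentation F P := { left := A, right := ⊥, hom := α }
  obtain ⟨Φ, hΦ, ⟨e⟩, hΦ'⟩ := exists_iteration J X₀ (stageStep S F t) (exists_stageStep hS hF t ht)
  have : PreservesColimitsOfSize.{v, v} (Comma.fst (𝟭 (P ⥤ C)) (F ⋙ Functor.const P)) :=
    ⟨fun {_} _ => inferInstance⟩
  have : PreservesColimitsOfSize.{v, v} (Comma.snd (𝟭 (P ⥤ C)) (F ⋙ Functor.const P)) :=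
    ⟨fun {_} _ => inferInstance⟩
  have := isWellOrderContinuous_comp Φ (Comma.fst _ _)
  have := isWellOrderContinuous_comp Φ (Comma.snd _ _)
  have h₀ : (Φ.obj ⊥).right = ⊥ := le_bot_iff.1 (leOfHom e.inv.right)
  refine ⟨Φ, inferInstance, ⟨Comma.leftIso e⟩, hΦ', fun j => ?_⟩
  induction j using SuccOrder.limitRecOn with
  | isMin m hm =>
    obtain rfl := hm.eq_bot
    refine ⟨h₀, nonempty_isColimit_of_iso hα (Comma.leftIso e)
      (F.mapIso (Comma.rightIso e)) fun p => ?_⟩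
    exact (congr_app e.hom.w p).symm
  | succ m hm ih =>
    obtain ⟨h₁, h₂, -⟩ := hΦ' m hm ih.2 (by rwa [ih.1])
    exact ⟨h₁.trans (congrArg _ ih.1), h₂⟩
  | isSuccLimit m hm ih =>
    have hr := eq_of_isWellOrderContinuous (Φ ⋙ Comma.snd _ _) hm fun i hi => (ih i hi).1
    refine ⟨hr, ?_⟩
    let ι := (Set.principalSegIio m).monotone.functor
    let b (i : Set.Iio m) : (Φ.obj i.1).left ⟶
        (Functor.const P).obj (F.obj (Φ.obj i.1).right) := (Φ.obj i.1).hom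
    let ψ (i : Set.Iio m) := Φ.map (homOfLE i.2.le)
    have hψ (i : Set.Iio m) (p : P) : (ψ i).left.app p ≫ (Φ.obj m).hom.app p =
      (b i).app p ≫ F.map (ψ i).right := congr_app (ψ i).w p
    have e {i j : Set.Iio m} (h : i ⟶ j) : Φ.map (ι.map h) ≫ ψ j = ψ i :=
      (Φ.map_comp _ _).symm
    let zB : ι ⋙ Φ ⋙ Comma.snd _ _ ⋙ F ⟶ (Functor.const _).obj (F.obj (Φ.obj m).right) :=
      { app i := F.map (ψ i).right
        naturality i j h := by
          refine (F.map_comp _ _).symm.trans (Eq.trans ?_ (comp_id _).symm)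
          exact congrArg F.map (congrArg CommaMorphism.right (e h)) }
    have hzB : Nonempty (IsColimit (Cocone.mk _ zB)) := by
      refine nonempty_isColimit_of_iso ⟨F.isColimitOfIsWellOrderContinuous m hm⟩
        (NatIso.ofComponents (fun i => F.mapIso (eqToIso (ih i.1 i.2).1.symm)) ?_)
        (F.mapIso (eqToIso hr.symm)) ?_
      · intro i j h
        exact (F.map_comp _ _).symm.trans ((congrArg F.map (Subsingleton.elim _ _)).trans
          (F.map_comp (eqToIso (ih i.1 i.2).1.symm).hom (Φ.map (ι.map h)).right))
      · intro i
        exact (F.map_comp _ _).symm.trans ((congrArg F.map (Subsingleton.elim _ _)).trans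
          (F.map_comp (eqToIso (ih i.1 i.2).1.symm).hom (ψ i).right))
    let r (p : P) : (ι ⋙ Φ ⋙ Comma.fst _ _).flip.obj p ⟶
        (Functor.const _).obj ((Φ.obj m).left.obj p) :=
      { app i := (ψ i).left.app p
        naturality i j h := by
          refine Eq.trans ?_ (comp_id _).symm
          exact congr_app (congrArg CommaMorphism.left (e h)) p }
    exact isColimit_comm (ι ⋙ Φ ⋙ Comma.fst _ _).flip (Φ.obj m).left (ι ⋙ Φ ⋙ Comma.snd _ _ ⋙ F)
      r (fun p => ⟨isColimitOfPreserves ((evaluation P C).obj p)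
        ((Φ ⋙ Comma.fst _ _).isColimitOfIsWellOrderContinuous m hm)⟩) b
      (fun i => (ih i.1 i.2).2) (Φ.obj m).hom zB hzB.some (fun p i => hψ i p)
      (fun f i => ((ψ i).left.naturality f).symm)
      (fun h p => (congr_app (Φ.map (ι.map h)).w p).symm)

end ChainPresentation

section ChainPresentation

variable {C : Type u} [Category.{v} C] {J : Type v} [LinearOrder J]
  [SuccOrder J] [OrderBot J] [OrderTop J] [WellFoundedLT J]

lemma exists_chainPresentation_of_isColimit [HasColimitsOfSize.{v, v} C] {κ : Cardinal.{v}}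
    [Fact κ.IsRegular] {S : MorphismProperty C}
    (hS : ∀ ⦃A B : C⦄ (f : A ⟶ B), S f → IsCardinalPresentable A κ ∧ IsCardinalPresentable B κ)
    {F : J ⥤ C} [F.IsWellOrderContinuous]
    (hF : ∀ j, ¬ IsMax j → CellularPaper.Po S (F.map (homOfLE (Order.le_succ j))))
    {P : Type v} [Preorder P] [IsCardinalFiltered P κ] (t : P → Set J) (ht' : Monotone t)
    (hκ : ∀ p, HasCardinalLT (t p) κ)
    (ht : ∀ p j, ∃ q, p ≤ q ∧ j ∈ t q) (A : P ⥤ C) (hA : ∀ p, IsCardinalPresentable (A.obj p) κ)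
    (α : A ⟶ (Functor.const P).obj (F.obj ⊥)) (hα : Nonempty (IsColimit (Cocone.mk _ α))) :
    Nonempty (ChainPresentation κ S F P) := by
  obtain ⟨Φ, hΦ, ⟨e⟩, hs, h⟩ :=
    exists_stageChain (fun _ _ f hf => (hS f hf).1) hF t ht A α hα
  let D : P ⥤ J ⥤ C := (Φ ⋙ Comma.fst _ _).flip
  let r (j : J) : F.obj (Φ.obj j).right ≅ F.obj j := F.mapIso (eqToIso (h j).1)
  have hr {i j : J} (f : i ⟶ j) : F.map (Φ.map f).right ≫ (r j).hom = (r i).hom ≫ F.map f :=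
    (F.map_comp (Φ.map f).right (eqToIso (h j).1).hom).symm.trans
      ((congrArg F.map (Subsingleton.elim _ _)).trans (F.map_comp (eqToIso (h i).1).hom f))
  have hw {i j : J} (f : i ⟶ j) (p : P) : (Φ.map f).left.app p ≫ (Φ.obj j).hom.app p =
    (Φ.obj i).hom.app p ≫ F.map (Φ.map f).right := congr_app (Φ.map f).w p
  let φ : D ⟶ (Functor.const P).obj F :=
    { app p :=
        { app j := (Φ.obj j).hom.app p ≫ (r j).hom
          naturality i j f := by
            change (Φ.map f).left.app p ≫ _ ≫ _ = (_ ≫ _) ≫ _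
            rw [reassoc_of% hw, hr, assoc]
            rfl }
      naturality p q f := by
        ext j
        refine (assoc _ _ _).symm.trans (Eq.trans ?_ (comp_id _).symm)
        exact congrArg (· ≫ (r j).hom) (((Φ.obj j).hom.naturality f).trans (comp_id _)) }
  have key (j : J) : ∃ p, ¬ IsMax j → j ∈ t p ∧
      (∀ q, p ≤ q → CellularPaper.Po S ((D.obj q).map (homOfLE (Order.le_succ j)))) ∧
      (∀ q, p ≤ q → IsPushout ((D.obj q).map (homOfLE (Order.le_succ j))) ((φ.app q).app j)
        ((φ.app q).app (Order.succ j)) (F.map (homOfLE (Order.le_succ j)))) ∧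
      (∀ q q' (h : q ≤ q'), p ≤ q → IsPushout ((D.obj q).map (homOfLE (Order.le_succ j)))
        ((D.map (homOfLE h)).app j) ((D.map (homOfLE h)).app (Order.succ j))
        ((D.obj q').map (homOfLE (Order.le_succ j)))) ∧
      ∀ q, ¬ p ≤ q → IsIso ((D.obj q).map (homOfLE (Order.le_succ j))) := by
    by_cases hj : IsMax j
    · have : Nonempty P := (isFiltered_of_isCardinalFiltered P κ).nonempty
      exact ⟨Classical.arbitrary P, fun h => (h hj).elim⟩
    · obtain ⟨-, -, p, hp, h₁, h₂, h₃, h₄⟩ := hs j hj (h j).2 (by rwa [(h j).1])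
      rw [(h j).1] at hp
      refine ⟨p, fun _ => ⟨hp, h₁, fun q hq => ?_, h₃, h₄⟩⟩
      exact (h₂ q hq).paste_vert (IsPushout.of_vert_isIso ⟨hr _⟩)
  choose idx hidx using key
  have hc (p : P) : (D.obj p).IsWellOrderContinuous :=
    isWellOrderContinuous_comp (Φ ⋙ Comma.fst _ _) ((evaluation P C).obj p)
  refine ⟨{ D := D, φ := φ, idx := idx, continuous := hc
            isColimit := ⟨evaluationJointlyReflectsColimits _ fun j => Nonempty.some ?_⟩
            presentable := fun p j => ?_
            Po := fun j hj => (hidx j hj).2.1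
            isPushout := fun j hj => (hidx j hj).2.2.1
            isPushout_map := fun j hj => (hidx j hj).2.2.2.1
            isIso := fun j hj => (hidx j hj).2.2.2.2 }⟩
  · exact nonempty_isColimit_of_iso (h j).2 (Iso.refl _) (r j) fun p => (id_comp _).symm
  · refine isCardinalPresentable_obj_of_links (D.obj p) ?_ (t p) (hκ p) (fun j _ hj hp => ?_)
      (fun j hjt hj => (hidx j hj).2.2.2.2 p fun hjp => hjt (ht' hjp (hidx j hj).1)) j
    · have := hA p
      exact isCardinalPresentable_of_iso (e.app p) κ
    · by_cases hjp : idx j ≤ p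
      · obtain ⟨U, V, u, _, _, hu, sq⟩ := (hidx j hj).2.1 p hjp
        have := (hS u hu).1
        have := (hS u hu).2
        exact isCardinalPresentable_of_isPushout sq
      · have := (hidx j hj).2.2.2.2 p hjp
        exact isCardinalPresentable_of_iso
          (asIso ((D.obj p).map (homOfLE (Order.le_succ j)))) κ

/-- The elements of `P` together with a small subset of `J`. -/
structure PairWithSmallSet (κ : Cardinal.{v}) (P J : Type v) : Type v where
  fst : P
  snd : Set J
  hasCardinalLT : HasCardinalLT snd κ

instance (κ : Cardinal.{v}) (P J : Type v) [Preorder P] : Preorder (PairWithSmallSet κ P J) :=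
  Preorder.lift fun x => (x.fst, x.snd)

lemma exists_chainPresentation [HasColimitsOfSize.{v, v} C] {κ : Cardinal.{v}}
    [Fact κ.IsRegular] (hC : HasPresentations C κ) {S : MorphismProperty C}
    (hS : ∀ ⦃A B : C⦄ (f : A ⟶ B), S f → IsCardinalPresentable A κ ∧ IsCardinalPresentable B κ)
    (F : J ⥤ C) [F.IsWellOrderContinuous]
    (hF : ∀ j, ¬ IsMax j → CellularPaper.Po S (F.map (homOfLE (Order.le_succ j)))) :
    ∃ (P : Type v) (_ : Preorder P) (_ : IsCardinalFiltered P κ),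
      Nonempty (ChainPresentation κ S F P) := by
  obtain ⟨P₀, _, _, A, α, hα, hA⟩ := hC (F.obj ⊥)
  let P := PairWithSmallSet κ P₀ J
  have : IsCardinalFiltered P κ := isCardinalFiltered_preorder _ _ fun K s hK => by
    have hK' : HasCardinalLT K κ := by rwa [hasCardinalLT_iff_cardinal_mk_lt]
    refine ⟨⟨IsCardinalFiltered.max (fun k => (s k).fst) hK', ⋃ k, (s k).snd,
      hasCardinalLT_iUnion _ hK' fun k => (s k).hasCardinalLT⟩, fun k => ⟨leOfHom
        (IsCardinalFiltered.toMax (fun k => (s k).fst) hK' k), ?_⟩⟩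
    exact Set.subset_iUnion (fun k => (s k).snd) k
  have hf : Monotone (fun p : P => p.fst) := fun _ _ h => h.1
  have : IsFiltered P := isFiltered_of_isCardinalFiltered P κ
  have : IsDirectedOrder P := ⟨fun a b =>
    ⟨_, leOfHom (IsFiltered.leftToMax a b), leOfHom (IsFiltered.rightToMax a b)⟩⟩
  have h0 : HasCardinalLT (∅ : Set J) κ :=
    hasCardinalLT_of_finite _ _ (Fact.out : κ.IsRegular).aleph0_le
  have : hf.functor.Final := (Monotone.final_functor_iff _).2 fun p => ⟨⟨p, ∅, h0⟩, le_rfl⟩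
  refine ⟨P, inferInstance, inferInstance, exists_chainPresentation_of_isColimit hS hF
    (fun p => p.snd) (fun _ _ h => h.2) (fun p => p.hasCardinalLT) (fun p j => ?_) (hf.functor ⋙ A)
    (fun p => hA _) (Functor.whiskerLeft hf.functor α)
    ⟨(Functor.Final.isColimitWhiskerEquiv (F := hf.functor) _).2 hα.some⟩⟩
  refine ⟨⟨p.fst, p.snd ∪ {j}, hasCardinalLT_union (Fact.out : κ.IsRegular).aleph0_le p.hasCardinalLT
    (hasCardinalLT_of_finite _ _ (Fact.out : κ.IsRegular).aleph0_le)⟩,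
    ⟨le_rfl, Set.subset_union_left⟩, Or.inr rfl⟩

end ChainPresentation

section ChainApprox

variable {C : Type u} [Category.{v} C] {J : Type v} [LinearOrder J]
  [SuccOrder J]

/-- A chain with presentable values mapping to another one, such that each of its links either is
an isomorphism or is in `Po S` and yields the corresponding link of the target by pushout. -/
structure ChainApprox (κ : Cardinal.{v}) [Fact κ.IsRegular] (S : MorphismProperty C) {D F : J ⥤ C}
    (δ : D ⟶ F) : Prop where
  presentable : ∀ j, IsCardinalPresentable (D.obj j) κ
  continuous : D.IsWellOrderContinuous
  link : ∀ j, ¬ IsMax j → (CellularPaper.Po S (D.map (homOfLE (Order.le_succ j))) ∧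
    IsPushout (D.map (homOfLE (Order.le_succ j))) (δ.app j) (δ.app (Order.succ j))
      (F.map (homOfLE (Order.le_succ j)))) ∨ IsIso (D.map (homOfLE (Order.le_succ j)))

lemma isIso_app_of_isColimit {I : Type*} [Category* I] {X Y : I ⥤ C} (e : X ⟶ Y)
    (he : ∀ i, IsIso (e.app i)) {c : Cocone X} {d : Cocone Y} (hc : IsColimit c) (hd : IsColimit d)
    (f : c.pt ⟶ d.pt) (hf : ∀ i, c.ι.app i ≫ f = e.app i ≫ d.ι.app i) : IsIso f := by
  have : IsIso e := NatIso.isIso_of_isIso_app _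
  have : f = (hc.coconePointsIsoOfNatIso hd (asIso e)).hom := hc.hom_ext fun i => by
    simp [hf]
  rw [this]
  infer_instance

lemma hasColimitsOfShape_nat [HasColimitsOfSize.{v, v} C] : HasColimitsOfShape ℕ C :=
  have : HasColimitsOfSize.{0, 0} C := hasColimitsOfSizeShrink.{0, 0, v, v} C
  inferInstance

lemma hasCardinalLT_arrow_nat {κ : Cardinal.{v}} (hκ : Cardinal.aleph0 < κ) :
    HasCardinalLT (Arrow ℕ) κ := by
  have : Countable (Arrow ℕ) :=
    Function.Injective.countable (f := fun a : Arrow ℕ => (a.left, a.right)) fun a b h => by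
      obtain ⟨a₁, a₂, a⟩ := a
      obtain ⟨b₁, b₂, b⟩ := b
      obtain ⟨rfl, rfl⟩ := Prod.mk.inj h
      exact congrArg Arrow.mk (Subsingleton.elim a b)
  have h : Cardinal.mk (Arrow ℕ) ≤ Cardinal.aleph0 := Cardinal.mk_le_aleph0
  have h' := Cardinal.lift_le.{v}.2 h
  rw [Cardinal.lift_aleph0] at h'
  refine h'.trans_lt ?_
  rwa [← Cardinal.lift_aleph0.{0, v}, Cardinal.lift_lt]

namespace ChainPresentation

variable [HasColimitsOfSize.{v, v} C] {κ : Cardinal.{v}} [Fact κ.IsRegular]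
  {S : MorphismProperty C} {F : J ⥤ C} {P : Type v} [Preorder P] (X : ChainPresentation κ S F P)

/-- The colimit cocone at a given stage. -/
noncomputable def isColimitStage {p : ℕ → P} {hp : Monotone p} {c : Cocone (hp.functor ⋙ X.D)}
    (hc : IsColimit c) (j : J) : IsColimit (((evaluation J C).obj j).mapCocone c) :=
  have := hasColimitsOfShape_nat (C := C)
  isColimitOfPreserves _ hc

lemma isPushout_of_idx_le {p : ℕ → P} (hp : Monotone p) {c : Cocone (hp.functor ⋙ X.D)}
    (hc : IsColimit c) (δ : c.pt ⟶ F) (hδ : ∀ n, c.ι.app n ≫ δ = X.φ.app (p n))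
    {j : J} (hj : ¬ IsMax j) {n : ℕ} (hn : X.idx j ≤ p n) :
    CellularPaper.Po S (c.pt.map (homOfLE (Order.le_succ j))) ∧
    IsPushout (c.pt.map (homOfLE (Order.le_succ j))) (δ.app j) (δ.app (Order.succ j))
      (F.map (homOfLE (Order.le_succ j))) := by
  have hs : Monotone (fun m : ℕ => n + m) := fun a b h => Nat.add_le_add_left h n
  have : hs.functor.Final := (Monotone.final_functor_iff _).2 fun k => ⟨k, Nat.le_add_left _ _⟩
  have hc' (j : J) : IsColimit ((((evaluation J C).obj j).mapCocone c).whisker hs.functor) :=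
    (Functor.Final.isColimitWhiskerEquiv (F := hs.functor) _).symm (X.isColimitStage hc j)
  let i := homOfLE (Order.le_succ j)
  have sq : IsPushout ((X.D.obj (p n)).map i) ((c.ι.app n).app j)
      ((c.ι.app n).app (Order.succ j)) (c.pt.map i) := by
    refine isPushout_of_isColimit (I := ℕ) (F₁ := (Functor.const ℕ).obj ((X.D.obj (p n)).obj j))
      (F₂ := (Functor.const ℕ).obj ((X.D.obj (p n)).obj (Order.succ j)))
      (F₃ := hs.functor ⋙ (hp.functor ⋙ X.D) ⋙ (evaluation J C).obj j)
      (F₄ := hs.functor ⋙ (hp.functor ⋙ X.D) ⋙ (evaluation J C).obj (Order.succ j))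
      (t := (Functor.const ℕ).map ((X.D.obj (p n)).map i))
      (l := { app m := (X.D.map (homOfLE (hp (Nat.le_add_right n m)))).app j
              naturality a b h := ?_ })
      (r := { app m := (X.D.map (homOfLE (hp (Nat.le_add_right n m)))).app (Order.succ j)
              naturality a b h := ?_ })
      (b := Functor.whiskerLeft hs.functor (Functor.whiskerLeft (hp.functor ⋙ X.D)
        ((evaluation J C).map i))) ?_
      (c₁ := 𝟙 _) (c₂ := 𝟙 _) (isColimitConstCocone ℕ _) (isColimitConstCocone ℕ _)
      (hc' j) (hc' (Order.succ j)) ?_ ?_ ?_ ?_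
    · refine (id_comp _).trans (Eq.trans ?_ <| congr_app (X.D.map_comp _ _) j)
      rfl
    · refine (id_comp _).trans (Eq.trans ?_ <| congr_app (X.D.map_comp _ _) (Order.succ j))
      rfl
    · exact fun m => X.isPushout_map j hj _ _ _ hn
    · exact fun m => (id_comp _).trans (comp_id _).symm
    · exact fun m => (id_comp _).trans (congr_app (c.w (homOfLE (Nat.le_add_right n m))) j).symm
    · exact fun m => (id_comp _).trans
        (congr_app (c.w (homOfLE (Nat.le_add_right n m))) (Order.succ j)).symm
    · exact fun m => ((c.ι.app (n + m)).naturality i).symm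
  exact ⟨Po_of_isPushout sq (X.Po j hj _ hn), IsPushout.of_top
    (by
      have h := X.isPushout j hj _ hn
      rw [← hδ n] at h
      exact h) (δ.naturality _) sq⟩

lemma chainApprox (hκ : Cardinal.aleph0 < κ) {p : ℕ → P} (hp : Monotone p)
    {c : Cocone (hp.functor ⋙ X.D)} (hc : IsColimit c) (δ : c.pt ⟶ F)
    (hδ : ∀ n, c.ι.app n ≫ δ = X.φ.app (p n)) : ChainApprox κ S δ where
  presentable j := by
    have (n : ℕ) : IsCardinalPresentable (((hp.functor ⋙ X.D) ⋙ (evaluation J C).obj j).obj n) κ :=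
      X.presentable (p n) j
    have : HasLimitsOfShape ℕᵒᵖ (Type v) := inferInstance
    exact isCardinalPresentable_of_isColimit' _ (X.isColimitStage hc j) κ
      (hasCardinalLT_arrow_nat hκ)
  continuous := isWellOrderContinuous_of_isColimit _ (fun n => X.continuous (p n)) c.ι
    fun j => ⟨X.isColimitStage hc j⟩
  link j hj := by
    by_cases h : ∃ n, X.idx j ≤ p n
    · obtain ⟨n, hn⟩ := h
      exact .inl (X.isPushout_of_idx_le hp hc δ hδ hj hn)
    · refine .inr (isIso_app_of_isColimit (Functor.whiskerLeft (hp.functor ⋙ X.D)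
        ((evaluation J C).map (homOfLE (Order.le_succ j)))) (fun n => X.isIso j hj _ fun hn =>
          h ⟨n, hn⟩) (X.isColimitStage hc j) (X.isColimitStage hc (Order.succ j)) _
          fun n => ((c.ι.app n).naturality _).symm)

end ChainPresentation

end ChainApprox

section ChainPushout

variable {C : Type u} [Category.{v} C] {J : Type v} [LinearOrder J]

/-- The natural transformation from a chain to the constant chain at its last term. -/
def toTop [OrderTop J] (D : J ⥤ C) : D ⟶ (Functor.const J).obj (D.obj ⊤) where
  app j := D.map (homOfLE le_top)
  naturality i j f := by
    dsimp
    rw [comp_id, ← D.map_comp]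
    rfl

/-- The functor sending a chain to its link at a given index. -/
def linkFunctor [SuccOrder J] (C : Type u) [Category.{v} C] (j : J) : (J ⥤ C) ⥤ Arrow C where
  obj X := Arrow.mk (X.map (homOfLE (Order.le_succ j)))
  map s := Arrow.homMk (s.app j) (s.app (Order.succ j)) (s.naturality _).symm

variable [OrderTop J] [HasPushouts C] {D F F' : J ⥤ C} {δ : D ⟶ F}
  {y : (Functor.const J).obj (D.obj ⊤) ⟶ F'} {s : F ⟶ F'}

lemma isPushout_toTop_app (sq : IsPushout (toTop D) δ y s) (j : J) :
    IsPushout (D.map (homOfLE (le_top : j ≤ ⊤))) (δ.app j) (y.app j) (s.app j) :=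
  sq.map ((evaluation J C).obj j)

lemma isIso_app_top_of_isPushout_toTop (sq : IsPushout (toTop D) δ y s) : IsIso (s.app ⊤) := by
  have h := isPushout_toTop_app sq ⊤
  have : IsIso (D.map (homOfLE (le_top : (⊤ : J) ≤ ⊤))) := (D.map_id ⊤) ▸ inferInstance
  exact MorphismProperty.of_isPushout (P := .isomorphisms C) h.flip this

variable [SuccOrder J]

lemma isIso_link_of_isPushout_toTop (sq : IsPushout (toTop D) δ y s) {j : J}
    (h : IsPushout (D.map (homOfLE (Order.le_succ j))) (δ.app j) (δ.app (Order.succ j))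
      (F.map (homOfLE (Order.le_succ j)))) : IsIso (F'.map (homOfLE (Order.le_succ j))) := by
  have h₁ := isPushout_toTop_app sq j
  have h₂ := h.paste_horiz (isPushout_toTop_app sq (Order.succ j))
  rw [← D.map_comp, homOfLE_comp, s.naturality] at h₂
  have hy := (y.naturality (homOfLE (Order.le_succ j)))
  exact MorphismProperty.of_isPushout (P := .isomorphisms C)
    (IsPushout.of_left (h₁₂ := 𝟙 (D.obj ⊤)) (by rw [comp_id]; exact h₂) hy h₁).flip
    (MorphismProperty.isomorphisms.infer_property _)

variable {κ : Cardinal.{v}} [Fact κ.IsRegular] {S : MorphismProperty C}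

lemma ChainApprox.linkStep (h : ChainApprox κ S δ) (sq : IsPushout (toTop D) δ y s) {j : J}
    (hj : ¬ IsMax j) : linkStep ((linkFunctor C j).map s) := by
  obtain ⟨-, h⟩ | h := h.link j hj
  · exact Or.inr (isIso_link_of_isPushout_toTop sq h)
  · left
    have h₁ := isPushout_toTop_app sq j
    have h₂ := isPushout_toTop_app sq (Order.succ j)
    have h₃ : IsPushout (D.map (homOfLE (Order.le_succ j)))
        (D.map (homOfLE (Order.le_succ j)) ≫ δ.app (Order.succ j)) (δ.app (Order.succ j)) (𝟙 _) :=
      IsPushout.of_horiz_isIso ⟨(comp_id _).symm⟩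
    have h₄ := h₃.paste_horiz h₂
    have hy : y.app (Order.succ j) = y.app j ≫ F'.map (homOfLE (Order.le_succ j)) :=
      (id_comp _).symm.trans (y.naturality (homOfLE (Order.le_succ j)))
    rw [← D.map_comp, homOfLE_comp, id_comp, δ.naturality, hy] at h₄
    exact (h₄.of_top (s.naturality _).symm h₁).flip

lemma ChainApprox.isWellOrderContinuous (h : ChainApprox κ S δ)
    (sq : IsPushout (toTop D) δ y s) (hF : F.IsWellOrderContinuous) :
    F'.IsWellOrderContinuous :=
  isWellOrderContinuous_of_isPushout sq h.continuous (isWellOrderContinuous_const _) hF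

end ChainPushout

lemma ChainApprox.map_bot_le_top {C : Type u} [Category.{v} C] {J : Type v} [LinearOrder J]
    [SuccOrder J] [OrderTop J] {D F : J ⥤ C} {δ : D ⟶ F} {κ : Cardinal.{v}} [Fact κ.IsRegular]
    {S : MorphismProperty C} [OrderBot J] [WellFoundedLT J] (h : ChainApprox κ S δ)
    {W : MorphismProperty C} (hW : CellularPaper.IsCellular W) (hS : S ≤ W) :
    CellularPaper.betweenPresentable κ W (D.map (homOfLE (bot_le : (⊥ : J) ≤ ⊤))) := by
  have := h.continuous
  refine ⟨chainComposites_le_of_isCellular hW _ (chainComposites_mk D (fun j hj => ?_)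
    (Iso.refl _)), (isCardinalPresentable_iff κ _).2 (h.presentable _),
      (isCardinalPresentable_iff κ _).2 (h.presentable _)⟩
  obtain h | h := h.link j hj
  · exact Po_le_of_isCellular hW hS _ h.1
  · exact hW.isos _ h

section PsPull

variable {K : Type u} {L : Type u'} {M : Type u''} [Category.{v} K] [Category.{v} L]
  [Category.{v} M] {F : K ⥤ M} {G : L ⥤ M}

@[ext]
lemma psPull_hom_ext {a b : CellularPaper.PsPull F G} {f g : a ⟶ b} (h : f.hk = g.hk)
    (h' : f.hl = g.hl) : f = g :=
  CellularPaper.PsHom.ext h h'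

lemma psPull_isIso {a b : CellularPaper.PsPull F G} (f : a ⟶ b) (h : IsIso f.hk)
    (h' : IsIso f.hl) : IsIso f := by
  let g : b ⟶ a :=
    { hk := inv f.hk
      hl := inv f.hl
      w := by rw [F.map_inv, IsIso.inv_comp_eq, G.map_inv, ← assoc, IsIso.eq_comp_inv, f.w] }
  exact ⟨g, psPull_hom_ext (IsIso.hom_inv_id f.hk) (IsIso.hom_inv_id f.hl),
    psPull_hom_ext (IsIso.inv_hom_id f.hk) (IsIso.inv_hom_id f.hl)⟩

variable {I : Type*} [Category* I]

lemma psPull_map_comp {a b c : CellularPaper.PsPull F G} (f : a ⟶ b) (g : a ⟶ c)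
    {x : b.k ⟶ c.k} {y : b.l ⟶ c.l} (hx : f.hk ≫ x = g.hk) (hy : f.hl ≫ y = g.hl) :
    F.map f.hk ≫ F.map x ≫ c.t.hom = F.map f.hk ≫ b.t.hom ≫ G.map y := by
  have h := f.w
  have h' := g.w
  rw [← F.map_comp_assoc, hx, reassoc_of% h, ← G.map_comp, hy, h']

/-- A cocone in a pseudopullback is colimiting as soon as both of its projections are. -/
def psPullIsColimit {D : I ⥤ CellularPaper.PsPull F G} [PreservesColimit (D ⋙ CellularPaper.projK F G) F]
    {c : Cocone D} (hk : IsColimit ((CellularPaper.projK F G).mapCocone c))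
    (hl : IsColimit ((CellularPaper.projL F G).mapCocone c)) : IsColimit c where
  desc s :=
    { hk := hk.desc ((CellularPaper.projK F G).mapCocone s)
      hl := hl.desc ((CellularPaper.projL F G).mapCocone s)
      w := (isColimitOfPreserves F hk).hom_ext fun i =>
        psPull_map_comp (c.ι.app i) (s.ι.app i)
          (hk.fac ((CellularPaper.projK F G).mapCocone s) i)
          (hl.fac ((CellularPaper.projL F G).mapCocone s) i) }
  fac _ i := psPull_hom_ext (hk.fac _ i) (hl.fac _ i)
  uniq s _ h := psPull_hom_ext
    (hk.uniq ((CellularPaper.projK F G).mapCocone s) _ fun i => congrArg (·.hk) (h i))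
    (hl.uniq ((CellularPaper.projL F G).mapCocone s) _ fun i => congrArg (·.hl) (h i))

/-- The comparison of the functors underlying a diagram in a pseudopullback. -/
def psPullIso (D : I ⥤ CellularPaper.PsPull F G) :
    (D ⋙ CellularPaper.projK F G) ⋙ F ≅ (D ⋙ CellularPaper.projL F G) ⋙ G :=
  NatIso.ofComponents (fun i => (D.obj i).t) fun f => (D.map f).w

lemma psPull_exists_isColimit [HasColimitsOfShape I K] [HasColimitsOfShape I L]
    [PreservesColimitsOfShape I F] [PreservesColimitsOfShape I G]
    (D : I ⥤ CellularPaper.PsPull F G) : ∃ c : Cocone D,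
      Nonempty (IsColimit ((CellularPaper.projK F G).mapCocone c)) ∧
      Nonempty (IsColimit ((CellularPaper.projL F G).mapCocone c)) := by
  let ck := colimit.cocone (D ⋙ CellularPaper.projK F G)
  let cl := colimit.cocone (D ⋙ CellularPaper.projL F G)
  let hk : IsColimit ck := colimit.isColimit _
  let hl : IsColimit cl := colimit.isColimit _
  let e := (isColimitOfPreserves F hk).coconePointsIsoOfNatIso (isColimitOfPreserves G hl)
    (psPullIso D)
  let c : Cocone D :=
    { pt := { k := ck.pt, l := cl.pt, t := e }
      ι :=
        { app i :=
            { hk := ck.ι.app i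
              hl := cl.ι.app i
              w := IsColimit.comp_coconePointsIsoOfNatIso_hom (isColimitOfPreserves F hk)
                (isColimitOfPreserves G hl) (psPullIso D) i }
          naturality i j f := psPull_hom_ext (ck.ι.naturality f) (cl.ι.naturality f) } }
  exact ⟨c, ⟨hk⟩, ⟨hl⟩⟩

instance psPull_hasColimitsOfShape [HasColimitsOfShape I K] [HasColimitsOfShape I L]
    [PreservesColimitsOfShape I F] [PreservesColimitsOfShape I G] :
    HasColimitsOfShape I (CellularPaper.PsPull F G) where
  has_colimit D := by
    obtain ⟨c, ⟨hk⟩, ⟨hl⟩⟩ := psPull_exists_isColimit D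
    exact ⟨⟨c, psPullIsColimit hk hl⟩⟩

instance projK_preservesColimitsOfShape [HasColimitsOfShape I K] [HasColimitsOfShape I L]
    [PreservesColimitsOfShape I F] [PreservesColimitsOfShape I G] :
    PreservesColimitsOfShape I (CellularPaper.projK F G) where
  preservesColimit {D} := by
    obtain ⟨c, ⟨hk⟩, ⟨hl⟩⟩ := psPull_exists_isColimit D
    exact preservesColimit_of_preserves_colimit_cocone (psPullIsColimit hk hl) hk

instance projL_preservesColimitsOfShape [HasColimitsOfShape I K] [HasColimitsOfShape I L]
    [PreservesColimitsOfShape I F] [PreservesColimitsOfShape I G] :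
    PreservesColimitsOfShape I (CellularPaper.projL F G) where
  preservesColimit {D} := by
    obtain ⟨c, ⟨hk⟩, ⟨hl⟩⟩ := psPull_exists_isColimit D
    exact preservesColimit_of_preserves_colimit_cocone (psPullIsColimit hk hl) hl

instance psPull_hasColimitsOfSize [HasColimitsOfSize.{v, v} K] [HasColimitsOfSize.{v, v} L]
    [PreservesColimitsOfSize.{v, v} F] [PreservesColimitsOfSize.{v, v} G] :
    HasColimitsOfSize.{v, v} (CellularPaper.PsPull F G) :=
  ⟨fun _ _ => inferInstance⟩

instance projK_preservesColimitsOfSize [HasColimitsOfSize.{v, v} K] [HasColimitsOfSize.{v, v} L]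
    [PreservesColimitsOfSize.{v, v} F] [PreservesColimitsOfSize.{v, v} G] :
    PreservesColimitsOfSize.{v, v} (CellularPaper.projK F G) :=
  ⟨fun {_} _ => inferInstance⟩

instance projL_preservesColimitsOfSize [HasColimitsOfSize.{v, v} K] [HasColimitsOfSize.{v, v} L]
    [PreservesColimitsOfSize.{v, v} F] [PreservesColimitsOfSize.{v, v} G] :
    PreservesColimitsOfSize.{v, v} (CellularPaper.projL F G) :=
  ⟨fun {_} _ => inferInstance⟩

end PsPull

section PsPull

variable {K : Type u} {L : Type u'} {M : Type u''} [Category.{v} K] [Category.{v} L]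
  [Category.{v} M] {F : K ⥤ M} {G : L ⥤ M}

lemma psPull_isPushout [PreservesColimitsOfShape WalkingSpan F] {a b c d : CellularPaper.PsPull F G}
    {f : a ⟶ b} {g : a ⟶ c} {h : b ⟶ d} {i : c ⟶ d} (hk : IsPushout f.hk g.hk h.hk i.hk)
    (hl : IsPushout f.hl g.hl h.hl i.hl) : IsPushout f g h i := by
  refine ⟨⟨psPull_hom_ext hk.w hl.w⟩, ⟨PushoutCocone.IsColimit.mk _ (fun s =>
    { hk := hk.desc s.inl.hk s.inr.hk (congrArg (·.hk) s.condition)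
      hl := hl.desc s.inl.hl s.inr.hl (congrArg (·.hl) s.condition)
      w := (hk.map F).hom_ext (psPull_map_comp h s.inl (hk.inl_desc _ _ _) (hl.inl_desc _ _ _))
        (psPull_map_comp i s.inr (hk.inr_desc _ _ _) (hl.inr_desc _ _ _)) })
    (fun s => psPull_hom_ext (hk.inl_desc _ _ _) (hl.inl_desc _ _ _))
    (fun s => psPull_hom_ext (hk.inr_desc _ _ _) (hl.inr_desc _ _ _))
    (fun s m h₁ h₂ => psPull_hom_ext
      (hk.hom_ext ((congrArg (·.hk) h₁).trans (hk.inl_desc _ _ _).symm)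
        ((congrArg (·.hk) h₂).trans (hk.inr_desc _ _ _).symm))
      (hl.hom_ext ((congrArg (·.hl) h₁).trans (hl.inl_desc _ _ _).symm)
        ((congrArg (·.hl) h₂).trans (hl.inr_desc _ _ _).symm)))⟩⟩

lemma psPull_isWellOrderContinuous {J : Type v} [LinearOrder J] (Φ : J ⥤ CellularPaper.PsPull F G)
    [PreservesColimitsOfSize.{v, v} F] (h : (Φ ⋙ CellularPaper.projK F G).IsWellOrderContinuous)
    (h' : (Φ ⋙ CellularPaper.projL F G).IsWellOrderContinuous) : Φ.IsWellOrderContinuous where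
  nonempty_isColimit m hm :=
    ⟨psPullIsColimit (h.nonempty_isColimit m hm).some (h'.nonempty_isColimit m hm).some⟩

lemma psPull_isCardinalPresentable [HasColimitsOfSize.{v, v} K] [HasColimitsOfSize.{v, v} L]
    [PreservesColimitsOfSize.{v, v} F] [PreservesColimitsOfSize.{v, v} G]
    {κ : Cardinal.{v}} [Fact κ.IsRegular] (a : CellularPaper.PsPull F G)
    (hk : IsCardinalPresentable a.k κ) (hl : IsCardinalPresentable a.l κ)
    (hm : IsCardinalPresentable (F.obj a.k) κ) : IsCardinalPresentable a κ := by
  rw [← isCardinalPresentable_iff]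
  intro P _ hP
  have := isCardinalFiltered_of_isCardinalDirected κ hP
  have := isFiltered_of_isCardinalFiltered P κ
  refine ⟨⟨fun {D} => ⟨fun {c} hc => ?_⟩⟩⟩
  have hck := isColimitOfPreserves (CellularPaper.projK F G) hc
  have hcl := isColimitOfPreserves (CellularPaper.projL F G) hc
  have hcg := isColimitOfPreserves G hcl
  have ha (i j : P) (f : i ⟶ j) : (D.map f).hk ≫ (c.ι.app j).hk = (c.ι.app i).hk :=
    congrArg (·.hk) (c.w f)
  have hb (i j : P) (f : i ⟶ j) : (D.map f).hl ≫ (c.ι.app j).hl = (c.ι.app i).hl :=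
    congrArg (·.hl) (c.w f)
  have hda (i j k : P) (f : i ⟶ j) (g : j ⟶ k) : (D.map f).hk ≫ (D.map g).hk =
    (D.map (f ≫ g)).hk := congrArg (·.hk) (D.map_comp f g).symm
  have hdb (i j k : P) (f : i ⟶ j) (g : j ⟶ k) : (D.map f).hl ≫ (D.map g).hl =
    (D.map (f ≫ g)).hl := congrArg (·.hl) (D.map_comp f g).symm
  refine ⟨Types.FilteredColimit.isColimitOf' _ _ ?_ ?_⟩
  · intro (f : a ⟶ c.pt)
    obtain ⟨i, (x : a.k ⟶ (D.obj i).k), (hx : x ≫ (c.ι.app i).hk = f.hk)⟩ :=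
      IsCardinalPresentable.exists_hom_of_isColimit κ hck f.hk
    obtain ⟨j, (y : a.l ⟶ (D.obj j).l), (hy : y ≫ (c.ι.app j).hl = f.hl)⟩ :=
      IsCardinalPresentable.exists_hom_of_isColimit κ hcl f.hl
    obtain ⟨q, hiq, hjq, -⟩ := IsFilteredOrEmpty.cocone_objs i j
    obtain ⟨x', hx'⟩ : ∃ x' : a.k ⟶ (D.obj q).k, x' ≫ (c.ι.app q).hk = f.hk :=
      ⟨x ≫ (D.map hiq).hk, by rw [assoc, ha, hx]⟩
    obtain ⟨y', hy'⟩ : ∃ y' : a.l ⟶ (D.obj q).l, y' ≫ (c.ι.app q).hl = f.hl :=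
      ⟨y ≫ (D.map hjq).hl, by rw [assoc, hb, hy]⟩
    have h₁ := f.w
    have h₂ : F.map (c.ι.app q).hk ≫ c.pt.t.hom = _ := (c.ι.app q).w
    obtain ⟨r, s, hs⟩ := IsCardinalPresentable.exists_eq_of_isColimit' κ hcg (i := q)
      (F.map x' ≫ (D.obj q).t.hom) (a.t.hom ≫ G.map y') (by
        refine Eq.trans (b := F.map x' ≫ (D.obj q).t.hom ≫ G.map (c.ι.app q).hl) (assoc _ _ _)
          (Eq.trans ?_ (b := a.t.hom ≫ G.map y' ≫ G.map (c.ι.app q).hl) (assoc _ _ _).symm)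
        rw [← G.map_comp, hy', ← h₁, ← h₂, ← hx', F.map_comp _ (c.ι.app q).hk, assoc])
    replace hs : (F.map x' ≫ (D.obj q).t.hom) ≫ G.map (D.map s).hl =
      (a.t.hom ≫ G.map y') ≫ G.map (D.map s).hl := hs
    have h₃ : F.map (D.map s).hk ≫ _ = _ := (D.map s).w
    refine ⟨r, ⟨x' ≫ (D.map s).hk, y' ≫ (D.map s).hl, ?_⟩,
      psPull_hom_ext ?_ ?_⟩
    · rw [F.map_comp _ (D.map s).hk, G.map_comp _ (D.map s).hl, assoc, h₃, ← assoc, hs, assoc]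
    · change f.hk = (_ ≫ _) ≫ (c.ι.app r).hk
      rw [assoc, ha, hx']
    · change f.hl = (_ ≫ _) ≫ (c.ι.app r).hl
      rw [assoc, hb, hy']
  · intro i (f : a ⟶ D.obj i) (g : a ⟶ D.obj i) h
    obtain ⟨j, x, hx⟩ := IsCardinalPresentable.exists_eq_of_isColimit' κ hck f.hk g.hk
      (congrArg (fun k : a ⟶ c.pt => k.hk) h)
    obtain ⟨k, y, hy⟩ := IsCardinalPresentable.exists_eq_of_isColimit' κ hcl f.hl g.hl
      (congrArg (fun k : a ⟶ c.pt => k.hl) h)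
    replace hx : f.hk ≫ (D.map x).hk = g.hk ≫ (D.map x).hk := hx
    replace hy : f.hl ≫ (D.map y).hl = g.hl ≫ (D.map y).hl := hy
    obtain ⟨q, hiq, hjq, -⟩ := IsFilteredOrEmpty.cocone_objs j k
    refine ⟨q, x ≫ hiq, psPull_hom_ext ?_ ?_⟩
    · change f.hk ≫ (D.map _).hk = g.hk ≫ (D.map _).hk
      rw [← hda, reassoc_of% hx]
    · change f.hl ≫ (D.map _).hl = g.hl ≫ (D.map _).hl
      rw [Subsingleton.elim (x ≫ hiq) (y ≫ hjq), ← hdb, reassoc_of% hy]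

end PsPull

section Interleave

variable {M : Type u} [Category.{v} M]

lemma isCardinalPresentable_composableArrows [HasColimitsOfSize.{v, v} M] {κ : Cardinal.{v}}
    [Fact κ.IsRegular] (a : ComposableArrows M 1) (h₀ : IsCardinalPresentable (a.obj 0) κ)
    (h₁ : IsCardinalPresentable (a.obj 1) κ) : IsCardinalPresentable a κ := by
  rw [← isCardinalPresentable_iff]
  intro P _ hP
  have := isCardinalFiltered_of_isCardinalDirected κ hP
  have := isFiltered_of_isCardinalFiltered P κ
  refine ⟨⟨fun {D} => ⟨fun {c} hc => ?_⟩⟩⟩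
  have hc' (i : Fin 2) : IsColimit (((evaluation (Fin 2) M).obj i).mapCocone c) :=
    isColimitOfPreserves _ hc
  have hw {i j : P} (f : i ⟶ j) (k : Fin 2) :
    (D.map f).app k ≫ (c.ι.app j).app k = (c.ι.app i).app k := congr_app (c.w f) k
  have hcomp {i j k : P} (f : i ⟶ j) (g : j ⟶ k) (l : Fin 2) :
    (D.map f).app l ≫ (D.map g).app l = (D.map (f ≫ g)).app l := congr_app (D.map_comp f g).symm l
  refine ⟨Types.FilteredColimit.isColimitOf' _ _ ?_ ?_⟩
  · intro (f : a ⟶ c.pt)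
    obtain ⟨i, (x₀ : a.obj 0 ⟶ (D.obj i).obj 0), (hx₀ : x₀ ≫ (c.ι.app i).app 0 = f.app 0)⟩ :=
      IsCardinalPresentable.exists_hom_of_isColimit κ (hc' 0) (f.app 0)
    obtain ⟨j, (y₀ : a.obj 1 ⟶ (D.obj j).obj 1), (hy₀ : y₀ ≫ (c.ι.app j).app 1 = f.app 1)⟩ :=
      IsCardinalPresentable.exists_hom_of_isColimit κ (hc' 1) (f.app 1)
    obtain ⟨q, hiq, hjq, -⟩ := IsFilteredOrEmpty.cocone_objs i j
    obtain ⟨x, hx⟩ : ∃ x : a.obj 0 ⟶ (D.obj q).obj 0, x ≫ (c.ι.app q).app 0 = f.app 0 :=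
      ⟨x₀ ≫ (D.map hiq).app 0, by rw [assoc, hw, hx₀]⟩
    obtain ⟨y, hy⟩ : ∃ y : a.obj 1 ⟶ (D.obj q).obj 1, y ≫ (c.ι.app q).app 1 = f.app 1 :=
      ⟨y₀ ≫ (D.map hjq).app 1, by rw [assoc, hw, hy₀]⟩
    let e : (0 : Fin 2) ⟶ 1 := homOfLE (by decide)
    obtain ⟨r, s, hs⟩ := IsCardinalPresentable.exists_eq_of_isColimit' κ (hc' 1) (i := q)
      (x ≫ (D.obj q).map e) (a.map e ≫ y) (by
        refine Eq.trans (b := x ≫ (D.obj q).map e ≫ (c.ι.app q).app 1) (assoc _ _ _)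
          (Eq.trans ?_ (b := a.map e ≫ y ≫ (c.ι.app q).app 1) (assoc _ _ _).symm)
        rw [hy, (c.ι.app q).naturality, reassoc_of% hx, f.naturality]
        rfl)
    replace hs : (x ≫ (D.obj q).map e) ≫ (D.map s).app 1 =
      (a.map e ≫ y) ≫ (D.map s).app 1 := hs
    refine ⟨r, ComposableArrows.homMk₁ (x ≫ (D.map s).app 0) (y ≫ (D.map s).app 1) ?_,
      ComposableArrows.hom_ext₁ ?_ ?_⟩
    · change a.map e ≫ _ = _ ≫ (D.obj r).map e
      rw [assoc, ← (D.map s).naturality, ← assoc, ← assoc, hs]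
    · change f.app 0 = (x ≫ (D.map s).app 0) ≫ (c.ι.app r).app 0
      rw [assoc, hw, hx]
    · change f.app 1 = (y ≫ (D.map s).app 1) ≫ (c.ι.app r).app 1
      rw [assoc, hw, hy]
  · intro i (f : a ⟶ D.obj i) (g : a ⟶ D.obj i) h
    obtain ⟨j, x, hx⟩ := IsCardinalPresentable.exists_eq_of_isColimit' κ (hc' 0) (f.app 0) (g.app 0)
      (congrArg (fun k : a ⟶ c.pt => k.app 0) h)
    obtain ⟨k, y, hy⟩ := IsCardinalPresentable.exists_eq_of_isColimit' κ (hc' 1) (f.app 1) (g.app 1)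
      (congrArg (fun k : a ⟶ c.pt => k.app 1) h)
    replace hx : f.app 0 ≫ (D.map x).app 0 = g.app 0 ≫ (D.map x).app 0 := hx
    replace hy : f.app 1 ≫ (D.map y).app 1 = g.app 1 ≫ (D.map y).app 1 := hy
    obtain ⟨q, hiq, hjq, -⟩ := IsFilteredOrEmpty.cocone_objs j k
    refine ⟨q, x ≫ hiq, ComposableArrows.hom_ext₁ ?_ ?_⟩
    · change f.app 0 ≫ (D.map _).app 0 = g.app 0 ≫ (D.map _).app 0
      rw [← hcomp, reassoc_of% hx]
    · change f.app 1 ≫ (D.map _).app 1 = g.app 1 ≫ (D.map _).app 1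
      rw [Subsingleton.elim (x ≫ hiq) (y ≫ hjq), ← hcomp, reassoc_of% hy]

end Interleave

section Interleave

variable {N : Type u} [Category.{v} N] {κ : Cardinal.{v}} [Fact κ.IsRegular]
  {P Q : Type v} [Preorder P] [Preorder Q] [IsCardinalFiltered P κ] {X : P ⥤ N} {Y : Q ⥤ N} {Z : N}
  {x : X ⟶ (Functor.const P).obj Z} {y : Y ⟶ (Functor.const Q).obj Z}

lemma exists_backward_of_isColimit (hx : IsColimit (Cocone.mk Z x))
    {p : P} {q : Q} [IsCardinalPresentable (X.obj p) κ] [IsCardinalPresentable (Y.obj q) κ]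
    (h : X.obj p ⟶ Y.obj q) (hh : h ≫ y.app q = x.app p) :
    ∃ (p' : P) (hp : p ≤ p') (g : Y.obj q ⟶ X.obj p'), g ≫ x.app p' = y.app q ∧
      h ≫ g = X.map (homOfLE hp) := by
  obtain ⟨p₁, (g : Y.obj q ⟶ X.obj p₁), (hg : g ≫ x.app p₁ = y.app q)⟩ :=
    IsCardinalPresentable.exists_hom_of_isColimit κ hx (y.app q)
  obtain ⟨p', u, v, huv⟩ := IsCardinalPresentable.exists_eq_of_isColimit κ hx (h ≫ g) (𝟙 (X.obj p))
    (by simp [hg, hh])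
  refine ⟨p', leOfHom v, g ≫ X.map u, ?_, ?_⟩
  · rw [assoc, ← hg]
    exact congrArg (g ≫ ·) ((Cocone.mk Z x).w u)
  · rw [← assoc, huv, id_comp]
    rfl

lemma exists_iso_of_interleaved {A B : ℕ ⥤ N} (h : ∀ n, A.obj n ⟶ B.obj n)
    (g : ∀ n, B.obj n ⟶ A.obj (n + 1)) (hg : ∀ n, h n ≫ g n = A.map (homOfLE (Nat.le_succ n)))
    (hg' : ∀ n, g n ≫ h (n + 1) = B.map (homOfLE (Nat.le_succ n))) {c : Cocone A} {d : Cocone B}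
    (hc : IsColimit c) (hd : IsColimit d) {α : c.pt ⟶ Z} {β : d.pt ⟶ Z}
    (hαβ : ∀ n, h n ≫ d.ι.app n ≫ β = c.ι.app n ≫ α) : ∃ e : c.pt ≅ d.pt, e.hom ≫ β = α := by
  let a : A ⟶ B := NatTrans.ofSequence h fun n => by
    rw [← hg, ← hg', assoc]
  have ha (n : ℕ) : a.app n = h n := rfl
  clear_value a
  have hcw (n : ℕ) : A.map (homOfLE (Nat.le_succ n)) ≫ c.ι.app (n + 1) = c.ι.app n := c.w _
  have hdw (n : ℕ) : B.map (homOfLE (Nat.le_succ n)) ≫ d.ι.app (n + 1) = d.ι.app n := d.w _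
  let b : B ⟶ (Functor.const ℕ).obj c.pt :=
    NatTrans.ofSequence (fun n => g n ≫ c.ι.app (n + 1)) fun n => by
      have := hg (n + 1)
      rw [← hcw (n + 1), ← hg (n + 1), ← hg' n]
      simp
  have hb (n : ℕ) : b.app n = g n ≫ c.ι.app (n + 1) := rfl
  clear_value b
  let f : c.pt ⟶ d.pt := hc.desc ⟨d.pt, a ≫ d.ι⟩
  have hf (n : ℕ) : c.ι.app n ≫ f = h n ≫ d.ι.app n := by
    rw [← ha]
    exact hc.fac ⟨d.pt, a ≫ d.ι⟩ n
  let f' : d.pt ⟶ c.pt := hd.desc ⟨c.pt, b⟩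
  have hf' (n : ℕ) : d.ι.app n ≫ f' = g n ≫ c.ι.app (n + 1) := by
    rw [← hb]
    exact hd.fac ⟨c.pt, b⟩ n
  refine ⟨⟨f, f', hc.hom_ext fun n => ?_, hd.hom_ext fun n => ?_⟩, hc.hom_ext fun n => ?_⟩
  · rw [← assoc, hf, assoc, hf', ← assoc, hg, hcw, comp_id]
  · rw [← assoc, hf', assoc, hf, ← assoc, hg', hdw, comp_id]
  · rw [← assoc, hf, assoc, hαβ]

variable [IsCardinalFiltered Q κ]

/-- Two filtered colimits of presentable objects which agree have matching sequential
restrictions. -/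
lemma exists_interleaving (hX : ∀ p, IsCardinalPresentable (X.obj p) κ)
    (hY : ∀ q, IsCardinalPresentable (Y.obj q) κ) (hx : IsColimit (Cocone.mk Z x))
    (hy : IsColimit (Cocone.mk Z y)) (p₀ : P) (q₀ : Q) :
    ∃ (p : ℕ → P) (q : ℕ → Q) (hp : Monotone p) (hq : Monotone q), p₀ ≤ p 0 ∧ q₀ ≤ q 0 ∧
      ∀ (c : Cocone (hp.functor ⋙ X)) (d : Cocone (hq.functor ⋙ Y)), IsColimit c → IsColimit d →
        ∀ (α : c.pt ⟶ Z) (β : d.pt ⟶ Z), (∀ n, c.ι.app n ≫ α = x.app (p n)) →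
          (∀ n, d.ι.app n ≫ β = y.app (q n)) → ∃ e : c.pt ≅ d.pt, e.hom ≫ β = α := by
  let T := Σ' (p : P) (q : Q) (h : X.obj p ⟶ Y.obj q), h ≫ y.app q = x.app p
  have step (s : T) : ∃ (s' : T) (hp : s.1 ≤ s'.1) (hq : s.2.1 ≤ s'.2.1)
      (g : Y.obj s.2.1 ⟶ X.obj s'.1), s.2.2.1 ≫ g = X.map (homOfLE hp) ∧
        g ≫ s'.2.2.1 = Y.map (homOfLE hq) := by
    obtain ⟨p, q, h, hh⟩ := s
    obtain ⟨p', hp, g, hg, hg'⟩ := exists_backward_of_isColimit (κ := κ) hx h hh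
    obtain ⟨q', hq, h', hh', hh''⟩ := exists_backward_of_isColimit (κ := κ) hy g hg
    exact ⟨⟨p', q', h', hh'⟩, hp, hq, g, hg', hh''⟩
  choose next hp hq g hg hg' using step
  obtain ⟨s₀, hp₀, hq₀⟩ : ∃ s : T, p₀ ≤ s.1 ∧ q₀ ≤ s.2.1 := by
    obtain ⟨q₁, (h : X.obj p₀ ⟶ Y.obj q₁), (hh : h ≫ y.app q₁ = x.app p₀)⟩ :=
      IsCardinalPresentable.exists_hom_of_isColimit κ hy (x.app p₀)
    have := isFiltered_of_isCardinalFiltered Q κ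
    obtain ⟨q, h₁, h₀, -⟩ := IsFilteredOrEmpty.cocone_objs q₁ q₀
    refine ⟨⟨p₀, q, h ≫ Y.map h₁, ?_⟩, le_rfl, leOfHom h₀⟩
    rw [assoc, ← hh]
    exact congrArg (h ≫ ·) ((Cocone.mk Z y).w h₁)
  let s (n : ℕ) : T := next^[n] s₀
  have hs (n : ℕ) : s (n + 1) = next (s n) := Function.iterate_succ_apply' _ _ _
  have hstep (n : ℕ) : ∃ (hp : (s n).1 ≤ (s (n + 1)).1) (hq : (s n).2.1 ≤ (s (n + 1)).2.1)
      (g : Y.obj (s n).2.1 ⟶ X.obj (s (n + 1)).1), (s n).2.2.1 ≫ g = X.map (homOfLE hp) ∧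
        g ≫ (s (n + 1)).2.2.1 = Y.map (homOfLE hq) := by
    rw [hs]
    exact ⟨hp _, hq _, g _, hg _, hg' _⟩
  have hps : p₀ ≤ (s 0).1 := hp₀
  have hqs : q₀ ≤ (s 0).2.1 := hq₀
  clear_value s
  clear hp hq g hg hg' hs
  choose hp hq g hg hg' using hstep
  have hp' : Monotone fun n => (s n).1 := monotone_nat_of_le_succ hp
  have hq' : Monotone fun n => (s n).2.1 := monotone_nat_of_le_succ hq
  refine ⟨_, _, hp', hq', hps, hqs, fun c d hc hd α β hα hβ => ?_⟩
  exact exists_iso_of_interleaved (A := hp'.functor ⋙ X) (B := hq'.functor ⋙ Y)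
    (fun n => (s n).2.2.1) g hg hg' hc hd fun n => (congrArg (_ ≫ ·) (hβ n)).trans
      ((s n).2.2.2.trans (hα n).symm)

end Interleave

section ChainPull

/-- The first and the last index. -/
def extremes (J : Type w) [Preorder J] [OrderBot J] [OrderTop J] : ComposableArrows J 1 :=
  ComposableArrows.mk₁ (homOfLE (bot_le : (⊥ : J) ≤ ⊤))

/-- The image under `F` of the morphism from the first to the last term of a chain. -/
abbrev endpoints {K : Type u} {M : Type u''} [Category.{v} K] [Category.{v} M] (F : K ⥤ M)
    (J : Type v) [Preorder J] [OrderBot J] [OrderTop J] : (J ⥤ K) ⥤ ComposableArrows M 1 :=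
  (Functor.whiskeringRight J K M).obj F ⋙ (Functor.whiskeringLeft (Fin 2) J M).obj (extremes J)

variable {K : Type u} {L : Type u'} {M : Type u''} [Category.{v} K] [Category.{v} L]
  [Category.{v} M] (F : K ⥤ M) (G : L ⥤ M)

instance endpoints_preservesColimitsOfSize [HasColimitsOfSize.{v, v} M]
    [HasColimitsOfSize.{v, v} K]
    [PreservesColimitsOfSize.{v, v} F]
    (J : Type v) [Preorder J] [OrderBot J] [OrderTop J] :
    PreservesColimitsOfSize.{v, v} (endpoints F J) := inferInstance

variable (JK JL : Type v) [LinearOrder JK] [OrderBot JK] [OrderTop JK] [LinearOrder JL]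
  [OrderBot JL] [OrderTop JL]

/-- Pairs of chains with compatible extremal terms. -/
abbrev ChainPull := CellularPaper.PsPull (endpoints F JK) (endpoints G JL)

variable {F G JK JL}

variable (F G JK JL) in
/-- The extremal terms of a pair of chains. -/
def evalEnd (i : Fin 2) : ChainPull F G JK JL ⥤ CellularPaper.PsPull F G where
  obj σ := ⟨σ.k.obj ((extremes JK).obj i), σ.l.obj ((extremes JL).obj i), σ.t.app i⟩
  map s := ⟨s.hk.app _, s.hl.app _, congr_app s.w i⟩

/-- The morphism from the first to the last term of a pair of chains. -/
def endHom (σ : ChainPull F G JK JL) : (evalEnd F G JK JL 0).obj σ ⟶ (evalEnd F G JK JL 1).obj σ :=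
  ⟨σ.k.map ((extremes JK).map (homOfLE (Fin.zero_le 1))),
    σ.l.map ((extremes JL).map (homOfLE (Fin.zero_le 1))), σ.t.hom.naturality _⟩

lemma endHom_naturality {σ τ : ChainPull F G JK JL} (s : σ ⟶ τ) :
    endHom σ ≫ (evalEnd F G JK JL 1).map s = (evalEnd F G JK JL 0).map s ≫ endHom τ :=
  psPull_hom_ext (s.hk.naturality _) (s.hl.naturality _)

variable (JK JL) in
/-- The pair of constant chains at a given object. -/
def constPull (a : CellularPaper.PsPull F G) : ChainPull F G JK JL where
  k := (Functor.const JK).obj a.k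
  l := (Functor.const JL).obj a.l
  t := NatIso.ofComponents (fun _ => a.t) fun _ => by
    change F.map (𝟙 _) ≫ a.t.hom = a.t.hom ≫ G.map (𝟙 _)
    rw [F.map_id, G.map_id, id_comp, comp_id]

/-- The morphism from a pair of chains to the constant pair at the last term. -/
def toTopPull (σ : ChainPull F G JK JL) :
    σ ⟶ constPull JK JL ((evalEnd F G JK JL 1).obj σ) where
  hk := toTop σ.k
  hl := toTop σ.l
  w := NatTrans.ext <| funext fun i => σ.t.hom.naturality (homOfLE (Fin.le_last i))

end ChainPull

section Approx

lemma isCardinalPresentable_endpoints {K : Type u} {M : Type u''} [Category.{v} K] [Category.{v} M]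
    {F : K ⥤ M} [HasColimitsOfSize.{v, v} M] {J : Type v} [LinearOrder J] [OrderBot J] [OrderTop J]
    {κ : Cardinal.{v}} [Fact κ.IsRegular]
    (hF : ∀ A : K, IsCardinalPresentable A κ → IsCardinalPresentable (F.obj A) κ) (D : J ⥤ K)
    (hD : ∀ j, IsCardinalPresentable (D.obj j) κ) :
    IsCardinalPresentable ((endpoints F J).obj D) κ :=
  isCardinalPresentable_composableArrows _ (hF _ (hD _)) (hF _ (hD _))

variable {K : Type u} {L : Type u'} {M : Type u''} [Category.{v} K] [Category.{v} L]
  [Category.{v} M] {F : K ⥤ M} {G : L ⥤ M} [HasColimitsOfSize.{v, v} K]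
  [HasColimitsOfSize.{v, v} L] [HasColimitsOfSize.{v, v} M] [PreservesColimitsOfSize.{v, v} F]
  [PreservesColimitsOfSize.{v, v} G] {JK JL : Type v} [LinearOrder JK] [OrderBot JK] [OrderTop JK]
  [SuccOrder JK] [LinearOrder JL] [OrderBot JL] [OrderTop JL] [SuccOrder JL]
  {κ : Cardinal.{v}} [Fact κ.IsRegular] {SK : MorphismProperty K} {SL : MorphismProperty L}

lemma exists_chainApprox (hκ : Cardinal.aleph0 < κ)
    (hF : ∀ A : K, IsCardinalPresentable A κ → IsCardinalPresentable (F.obj A) κ)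
    (hG : ∀ A : L, IsCardinalPresentable A κ → IsCardinalPresentable (G.obj A) κ)
    (σ : ChainPull F G JK JL) {P Q : Type v} [Preorder P] [Preorder Q] [IsCardinalFiltered P κ]
    [IsCardinalFiltered Q κ] (X : ChainPresentation κ SK σ.k P) (Y : ChainPresentation κ SL σ.l Q)
    (jK : JK) (jL : JL) :
    ∃ (ξ : ChainPull F G JK JL) (δ : ξ ⟶ σ), ChainApprox κ SK δ.hk ∧ ChainApprox κ SL δ.hl ∧
      (¬ IsMax jK → IsPushout (ξ.k.map (homOfLE (Order.le_succ jK))) (δ.hk.app jK)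
        (δ.hk.app (Order.succ jK)) (σ.k.map (homOfLE (Order.le_succ jK)))) ∧
      (¬ IsMax jL → IsPushout (ξ.l.map (homOfLE (Order.le_succ jL))) (δ.hl.app jL)
        (δ.hl.app (Order.succ jL)) (σ.l.map (homOfLE (Order.le_succ jL)))) := by
  have := isFiltered_of_isCardinalFiltered P κ
  have := isFiltered_of_isCardinalFiltered Q κ
  let x : X.D ⋙ endpoints F JK ⟶ (Functor.const P).obj ((endpoints G JL).obj σ.l) :=
    ((endpoints F JK).mapCocone (Cocone.mk _ X.φ)).ι ≫ (Functor.const P).map σ.t.hom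
  let y : Y.D ⋙ endpoints G JL ⟶ (Functor.const Q).obj ((endpoints G JL).obj σ.l) :=
    ((endpoints G JL).mapCocone (Cocone.mk _ Y.φ)).ι
  have hx : IsColimit (Cocone.mk _ x) :=
    (isColimitOfPreserves (endpoints F JK) X.isColimit.some).ofIsoColimit
      (Cocone.ext σ.t fun _ => rfl)
  have hy : IsColimit (Cocone.mk _ y) :=
    (isColimitOfPreserves (endpoints G JL) Y.isColimit.some)
  obtain ⟨p, q, hp, hq, hp₀, hq₀, H⟩ := exists_interleaving (κ := κ)
    (fun p => isCardinalPresentable_endpoints hF (X.D.obj p) (X.presentable p))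
    (fun q => isCardinalPresentable_endpoints hG (Y.D.obj q) (Y.presentable q)) hx hy
    (X.idx jK) (Y.idx jL)
  have : PreservesColimitsOfSize.{0, 0} (endpoints F JK) := preservesColimitsOfSize_shrink.{0, v, 0, v} _
  have : PreservesColimitsOfSize.{0, 0} (endpoints G JL) := preservesColimitsOfSize_shrink.{0, v, 0, v} _
  have := hasColimitsOfShape_nat (C := JK ⥤ K)
  have := hasColimitsOfShape_nat (C := JL ⥤ L)
  let c := colimit.cocone (hp.functor ⋙ X.D)
  let d := colimit.cocone (hq.functor ⋙ Y.D)
  have hc : IsColimit c := colimit.isColimit _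
  have hd : IsColimit d := colimit.isColimit _
  clear_value c d
  let δ : c.pt ⟶ σ.k := hc.desc ⟨_, Functor.whiskerLeft hp.functor X.φ⟩
  have hδ (n : ℕ) : c.ι.app n ≫ δ = X.φ.app (p n) := hc.fac ⟨_, Functor.whiskerLeft hp.functor X.φ⟩ n
  let ε : d.pt ⟶ σ.l := hd.desc ⟨_, Functor.whiskerLeft hq.functor Y.φ⟩
  have hε (n : ℕ) : d.ι.app n ≫ ε = Y.φ.app (q n) := hd.fac ⟨_, Functor.whiskerLeft hq.functor Y.φ⟩ n
  clear_value δ ε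
  obtain ⟨e, he⟩ := H ((endpoints F JK).mapCocone c) ((endpoints G JL).mapCocone d)
    (isColimitOfPreserves _ hc) (isColimitOfPreserves _ hd)
    ((endpoints F JK).map δ ≫ σ.t.hom) ((endpoints G JL).map ε)
    (fun n => ((endpoints F JK).map_comp_assoc (c.ι.app n) δ σ.t.hom).symm.trans
      (congrArg (fun f => (endpoints F JK).map f ≫ σ.t.hom) (hδ n)))
    (fun n => ((endpoints G JL).map_comp (d.ι.app n) ε).symm.trans
      (congrArg (endpoints G JL).map (hε n)))
  exact ⟨⟨c.pt, d.pt, e⟩, ⟨δ, ε, he.symm⟩, X.chainApprox hκ hp hc δ hδ, Y.chainApprox hκ hq hd ε hε,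
    fun hj => (X.isPushout_of_idx_le hp hc δ hδ hj hp₀).2,
    fun hj => (Y.isPushout_of_idx_le hq hd ε hε hj hq₀).2⟩

end Approx

section Step

variable {K : Type u} {L : Type u'} {M : Type u''} [Category.{v} K] [Category.{v} L]
  [Category.{v} M] {F : K ⥤ M} {G : L ⥤ M} {JK JL : Type v} [LinearOrder JK] [OrderBot JK]
  [OrderTop JK] [SuccOrder JK] [LinearOrder JL] [OrderBot JL] [OrderTop JL] [SuccOrder JL]

/-- Both components are well-order-continuous chains with links in the given classes. -/
structure IsCellularPull (TK : MorphismProperty K) (TL : MorphismProperty L)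
    (σ : ChainPull F G JK JL) : Prop where
  continuousK : σ.k.IsWellOrderContinuous
  continuousL : σ.l.IsWellOrderContinuous
  linkK : ∀ j, ¬ IsMax j → TK (σ.k.map (homOfLE (Order.le_succ j)))
  linkL : ∀ j, ¬ IsMax j → TL (σ.l.map (homOfLE (Order.le_succ j)))

/-- Links are modified by pushouts only or become isomorphisms, and the last term is kept. -/
structure IsPullStep {σ σ' : ChainPull F G JK JL} (s : σ ⟶ σ') : Prop where
  linkK : ∀ j, ¬ IsMax j → linkStep ((linkFunctor K j).map s.hk)
  linkL : ∀ j, ¬ IsMax j → linkStep ((linkFunctor L j).map s.hl)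
  isIsoK : IsIso (s.hk.app ⊤)
  isIsoL : IsIso (s.hl.app ⊤)

/-- The links at a pair of indices are isomorphisms. -/
structure IsSolved (σ : ChainPull F G JK JL) (τ : JK × JL) : Prop where
  isIsoK : ¬ IsMax τ.1 → IsIso (σ.k.map (homOfLE (Order.le_succ τ.1)))
  isIsoL : ¬ IsMax τ.2 → IsIso (σ.l.map (homOfLE (Order.le_succ τ.2)))

lemma IsPullStep.isSolved {σ σ' : ChainPull F G JK JL} {s : σ ⟶ σ'} (h : IsPullStep s)
    {τ : JK × JL} (hτ : IsSolved σ τ) : IsSolved σ' τ :=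
  ⟨fun hm => (h.linkK _ hm).isIso (hτ.isIsoK hm), fun hm => (h.linkL _ hm).isIso (hτ.isIsoL hm)⟩

variable [HasColimitsOfSize.{v, v} K] [HasColimitsOfSize.{v, v} L] [HasColimitsOfSize.{v, v} M]
  [PreservesColimitsOfSize.{v, v} F] [PreservesColimitsOfSize.{v, v} G] [WellFoundedLT JK]
  [WellFoundedLT JL] {κ : Cardinal.{v}} [Fact κ.IsRegular] {WK : MorphismProperty K}
  {WL : MorphismProperty L}

lemma exists_isPullStep (hκ : Cardinal.aleph0 < κ) (hK : HasPresentations K κ)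
    (hL : HasPresentations L κ)
    (hF : ∀ A : K, IsCardinalPresentable A κ → IsCardinalPresentable (F.obj A) κ)
    (hG : ∀ A : L, IsCardinalPresentable A κ → IsCardinalPresentable (G.obj A) κ)
    (hWK : CellularPaper.IsCellular WK) (hWL : CellularPaper.IsCellular WL)
    {σ : ChainPull F G JK JL}
    (hσ : IsCellularPull (CellularPaper.Po (CellularPaper.betweenPresentable κ WK))
      (CellularPaper.Po (CellularPaper.betweenPresentable κ WL)) σ) (τ : JK × JL) :
    ∃ (σ' : ChainPull F G JK JL) (s : σ ⟶ σ'), IsPullStep s ∧ σ'.k.IsWellOrderContinuous ∧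
      σ'.l.IsWellOrderContinuous ∧ CellularPaper.Po (CellularPaper.betweenPresentable κ
        (CellularPaper.PsClass WK WL)) ((evalEnd F G JK JL 0).map s) ∧ IsSolved σ' τ := by
  have := hσ.continuousK
  have := hσ.continuousL
  obtain ⟨P, _, _, ⟨X⟩⟩ := exists_chainPresentation hK (S := CellularPaper.betweenPresentable κ WK)
    (fun A B f h => ⟨(isCardinalPresentable_iff κ _).1 h.2.1, (isCardinalPresentable_iff κ _).1 h.2.2⟩)
    σ.k hσ.linkK
  obtain ⟨Q, _, _, ⟨Y⟩⟩ := exists_chainPresentation hL (S := CellularPaper.betweenPresentable κ WL)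
    (fun A B f h => ⟨(isCardinalPresentable_iff κ _).1 h.2.1, (isCardinalPresentable_iff κ _).1 h.2.2⟩)
    σ.l hσ.linkL
  obtain ⟨ξ, δ, hδK, hδL, hjK, hjL⟩ := exists_chainApprox hκ hF hG σ X Y τ.1 τ.2
  obtain ⟨σ', y, s, sq⟩ : ∃ (σ' : ChainPull F G JK JL)
      (y : constPull JK JL ((evalEnd F G JK JL 1).obj ξ) ⟶ σ') (s : σ ⟶ σ'),
      IsPushout (toTopPull ξ) δ y s := ⟨_, _, _, IsPushout.of_hasPushout _ _⟩
  have sqK : IsPushout (toTop ξ.k) δ.hk y.hk s.hk := sq.map (CellularPaper.projK _ _)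
  have sqL : IsPushout (toTop ξ.l) δ.hl y.hl s.hl := sq.map (CellularPaper.projL _ _)
  refine ⟨σ', s, ⟨fun j hj => hδK.linkStep sqK hj, fun j hj => hδL.linkStep sqL hj,
    isIso_app_top_of_isPushout_toTop sqK, isIso_app_top_of_isPushout_toTop sqL⟩,
    hδK.isWellOrderContinuous sqK hσ.continuousK, hδL.isWellOrderContinuous sqL hσ.continuousL,
    ?_, fun hj => isIso_link_of_isPushout_toTop sqK (hjK hj),
    fun hj => isIso_link_of_isPushout_toTop sqL (hjL hj)⟩
  have hpK := hδK.map_bot_le_top hWK (fun _ _ _ h => h.1)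
  have hpL := hδL.map_bot_le_top hWL (fun _ _ _ h => h.1)
  have hp (i : Fin 2) : IsCardinalPresentable ((evalEnd F G JK JL i).obj ξ) κ :=
    psPull_isCardinalPresentable _ (hδK.presentable _) (hδL.presentable _)
      (hF _ (hδK.presentable _))
  let y₀ : (evalEnd F G JK JL 1).obj ξ ⟶ (evalEnd F G JK JL 0).obj σ' :=
    (evalEnd F G JK JL 0).map y
  refine ⟨_, _, endHom ξ, (evalEnd F G JK JL 0).map δ, y₀, ⟨⟨hpK.1, hpL.1⟩,
    (isCardinalPresentable_iff κ _).2 (hp 0), (isCardinalPresentable_iff κ _).2 (hp 1)⟩, ?_⟩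
  exact psPull_isPushout (isPushout_toTop_app sqK ⊥) (isPushout_toTop_app sqL ⊥)

end Step

section PullIteration

lemma isWellOrderContinuous_obj_of_isSuccLimit {C : Type u} [Category.{v} C]
    [HasColimitsOfSize.{v, v} C] {W J : Type v}
    [LinearOrder W] [LinearOrder J] (Φ : W ⥤ J ⥤ C)
    [Φ.IsWellOrderContinuous] {w : W} (hw : Order.IsSuccLimit w)
    (h : ∀ w' < w, (Φ.obj w').IsWellOrderContinuous) : (Φ.obj w).IsWellOrderContinuous :=
  isWellOrderContinuous_of_isColimit _ (fun i => h i.1 i.2)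
    ((Set.principalSegIio w).cocone Φ).ι fun _ =>
      ⟨isColimitOfPreserves _ (Φ.isColimitOfIsWellOrderContinuous w hw)⟩

variable {K : Type u} {L : Type u'} {M : Type u''} [Category.{v} K] [Category.{v} L]
  [Category.{v} M] {F : K ⥤ M} {G : L ⥤ M} {JK JL : Type v} [LinearOrder JK] [OrderBot JK]
  [OrderTop JK] [SuccOrder JK] [LinearOrder JL] [OrderBot JL] [OrderTop JL] [SuccOrder JL]

lemma isPullStep_id (σ : ChainPull F G JK JL) : IsPullStep (𝟙 σ) where
  linkK j _ := by
    have : (linkFunctor K j).map (𝟙 σ.k) = 𝟙 _ := (linkFunctor K j).map_id _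
    change linkStep ((linkFunctor K j).map (𝟙 σ.k))
    rw [this]
    exact linkStep_id _
  linkL j _ := by
    have : (linkFunctor L j).map (𝟙 σ.l) = 𝟙 _ := (linkFunctor L j).map_id _
    change linkStep ((linkFunctor L j).map (𝟙 σ.l))
    rw [this]
    exact linkStep_id _
  isIsoK := (inferInstance : IsIso (𝟙 (σ.k.obj ⊤)))
  isIsoL := (inferInstance : IsIso (𝟙 (σ.l.obj ⊤)))

variable {W : Type v} [LinearOrder W] [WellFoundedLT W] (t : W → JK × JL)
  (TK : MorphismProperty K) (TL : MorphismProperty L)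
  (T : MorphismProperty (CellularPaper.PsPull F G))

/-- The steps of the iteration making more and more links into isomorphisms. -/
def solvingStep : MorphismProperty (ChainPull F G JK JL) := fun σ σ' s =>
  IsPullStep s ∧ (IsCellularPull TK TL σ → σ'.k.IsWellOrderContinuous ∧
    σ'.l.IsWellOrderContinuous ∧ T ((evalEnd F G JK JL 0).map s) ∧
    ∀ w, (∀ w' < w, IsSolved σ (t w')) → IsSolved σ' (t w))

variable {t TK TL T} in
lemma exists_solvingStep [Nonempty W] (h : ∀ σ : ChainPull F G JK JL, IsCellularPull TK TL σ → ∀ τ,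
      ∃ (σ' : ChainPull F G JK JL) (s : σ ⟶ σ'), IsPullStep s ∧ σ'.k.IsWellOrderContinuous ∧
        σ'.l.IsWellOrderContinuous ∧ T ((evalEnd F G JK JL 0).map s) ∧ IsSolved σ' τ)
    (σ : ChainPull F G JK JL) :
    ∃ (σ' : ChainPull F G JK JL) (s : σ ⟶ σ'), solvingStep t TK TL T s := by
  by_cases hσ : IsCellularPull TK TL σ
  · obtain ⟨w, hw⟩ : ∃ w, ∀ w', (∀ w'' < w', IsSolved σ (t w'')) → ¬ IsSolved σ (t w') → w' = w := by
      by_cases hw : ∃ w, ¬ IsSolved σ (t w)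
      · refine ⟨wellFounded_lt.min {w | ¬ IsSolved σ (t w)} hw, fun w' h₁ h₂ => ?_⟩
        refine le_antisymm (not_lt.1 fun h => ?_) (wellFounded_lt.min_le h₂)
        exact wellFounded_lt.min_mem {w | ¬ IsSolved σ (t w)} hw (h₁ _ h)
      · exact ⟨Classical.arbitrary W, fun w' _ h => (hw ⟨w', h⟩).elim⟩
    obtain ⟨σ', s, hs, h₁, h₂, h₃, h₄⟩ := h σ hσ (t w)
    refine ⟨σ', s, hs, fun _ => ⟨h₁, h₂, h₃, fun w' hw' => ?_⟩⟩
    by_cases hw'' : IsSolved σ (t w')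
    · exact hs.isSolved hw''
    · exact hw w' hw' hw'' ▸ h₄
  · exact ⟨σ, 𝟙 σ, isPullStep_id σ, fun h => (hσ h).elim⟩

variable [HasColimitsOfSize.{v, v} K] [HasColimitsOfSize.{v, v} L] [HasColimitsOfSize.{v, v} M]
  [PreservesColimitsOfSize.{v, v} F] [PreservesColimitsOfSize.{v, v} G] [OrderBot W] [SuccOrder W]

lemma isPullStep_map (Φ : W ⥤ ChainPull F G JK JL) [Φ.IsWellOrderContinuous]
    (h : ∀ w, ¬ IsMax w → IsPullStep (Φ.map (homOfLE (Order.le_succ w)))) {w w' : W} (hw : w ≤ w') :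
    IsPullStep (Φ.map (homOfLE hw)) where
  linkK j hj := linkStep_map (Φ ⋙ CellularPaper.projK _ _ ⋙ linkFunctor K j)
    (isWellOrderContinuous_comp Φ (CellularPaper.projK _ _ ⋙ (evaluation JK K).obj j))
    (isWellOrderContinuous_comp Φ (CellularPaper.projK _ _ ⋙ (evaluation JK K).obj (Order.succ j)))
    (fun w hw => (h w hw).linkK j hj) (homOfLE hw)
  linkL j hj := linkStep_map (Φ ⋙ CellularPaper.projL _ _ ⋙ linkFunctor L j)
    (isWellOrderContinuous_comp Φ (CellularPaper.projL _ _ ⋙ (evaluation JL L).obj j))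
    (isWellOrderContinuous_comp Φ (CellularPaper.projL _ _ ⋙ (evaluation JL L).obj (Order.succ j)))
    (fun w hw => (h w hw).linkL j hj) (homOfLE hw)
  isIsoK :=
    have := isWellOrderContinuous_comp Φ (CellularPaper.projK _ _ ⋙ (evaluation JK K).obj ⊤)
    isIso_map_of_succ (Φ ⋙ CellularPaper.projK _ _ ⋙ (evaluation JK K).obj ⊤) hw
      fun k _ hk => (h k hk.not_isMax).isIsoK
  isIsoL :=
    have := isWellOrderContinuous_comp Φ (CellularPaper.projL _ _ ⋙ (evaluation JL L).obj ⊤)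
    isIso_map_of_succ (Φ ⋙ CellularPaper.projL _ _ ⋙ (evaluation JL L).obj ⊤) hw
      fun k _ hk => (h k hk.not_isMax).isIsoL

variable {t TK TL T} in
lemma isCellularPull_obj
    (hTK : ∀ ⦃f g : Arrow K⦄ (s : f ⟶ g), linkStep s → TK f.hom → TK g.hom)
    (hTL : ∀ ⦃f g : Arrow L⦄ (s : f ⟶ g), linkStep s → TL f.hom → TL g.hom)
    (Φ : W ⥤ ChainPull F G JK JL) [Φ.IsWellOrderContinuous]
    (h₀ : IsCellularPull TK TL (Φ.obj ⊥))
    (h : ∀ w, ¬ IsMax w → solvingStep t TK TL T (Φ.map (homOfLE (Order.le_succ w)))) (w : W) :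
    IsCellularPull TK TL (Φ.obj w) ∧ ∀ w' < w, IsSolved (Φ.obj w) (t w') := by
  have hΦ {w w' : W} (hw : w ≤ w') := isPullStep_map Φ (fun w hw => (h w hw).1) hw
  have hK (j : JK) (hj : ¬ IsMax j) : TK ((Φ.obj w).k.map (homOfLE (Order.le_succ j))) :=
    hTK _ ((hΦ (bot_le : ⊥ ≤ w)).linkK j hj) (h₀.linkK j hj)
  have hL (j : JL) (hj : ¬ IsMax j) : TL ((Φ.obj w).l.map (homOfLE (Order.le_succ j))) :=
    hTL _ ((hΦ (bot_le : ⊥ ≤ w)).linkL j hj) (h₀.linkL j hj)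
  induction w using SuccOrder.limitRecOn with
  | isMin w hw =>
    obtain rfl := hw.eq_bot
    exact ⟨h₀, fun w' hw' => (not_lt_bot hw').elim⟩
  | succ w hw ih =>
    have ih := ih (fun j hj => hTK _ ((hΦ (bot_le : ⊥ ≤ w)).linkK j hj) (h₀.linkK j hj))
      (fun j hj => hTL _ ((hΦ (bot_le : ⊥ ≤ w)).linkL j hj) (h₀.linkL j hj))
    obtain ⟨h₁, h₂, -, h₃⟩ := (h w hw).2 ih.1
    exact ⟨⟨h₁, h₂, hK, hL⟩, fun w' hw' => h₃ w' fun w'' hw'' => ih.2 w''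
      (hw''.trans_le (Order.le_of_lt_succ hw'))⟩
  | isSuccLimit w hw ih =>
    have ih (w' : W) (hw' : w' < w) := ih w' hw'
      (fun j hj => hTK _ ((hΦ (bot_le : ⊥ ≤ w')).linkK j hj) (h₀.linkK j hj))
      (fun j hj => hTL _ ((hΦ (bot_le : ⊥ ≤ w')).linkL j hj) (h₀.linkL j hj))
    have hcK := isWellOrderContinuous_comp Φ (CellularPaper.projK _ _)
    have hcL := isWellOrderContinuous_comp Φ (CellularPaper.projL _ _)
    refine ⟨⟨isWellOrderContinuous_obj_of_isSuccLimit (Φ ⋙ CellularPaper.projK _ _) hw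
        fun w' hw' => (ih w' hw').1.continuousK,
      isWellOrderContinuous_obj_of_isSuccLimit (Φ ⋙ CellularPaper.projL _ _) hw
        fun w' hw' => (ih w' hw').1.continuousL, hK, hL⟩, fun w' hw' => ?_⟩
    have hs := hw.succ_lt hw'
    exact (hΦ hs.le).isSolved ((ih _ hs).2 w' (Order.lt_succ_of_not_isMax hw'.not_isMax))

end PullIteration

section PullChains

variable {K : Type u} {L : Type u'} {M : Type u''} [Category.{v} K] [Category.{v} L]
  [Category.{v} M] {F : K ⥤ M} {G : L ⥤ M}

/-- Construct an isomorphism in the pseudopullback. -/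
def psPullIsoMk {a b : CellularPaper.PsPull F G} (e : a.k ≅ b.k) (e' : a.l ≅ b.l)
    (w : F.map e.hom ≫ b.t.hom = a.t.hom ≫ G.map e'.hom) : a ≅ b where
  hom := ⟨e.hom, e'.hom, w⟩
  inv := ⟨e.inv, e'.inv, by
    rw [← cancel_epi (F.map e.hom), ← F.map_comp_assoc, e.hom_inv_id, F.map_id, id_comp,
      reassoc_of% w, ← G.map_comp, e'.hom_inv_id, G.map_id, comp_id]⟩
  hom_inv_id := psPull_hom_ext e.hom_inv_id e'.hom_inv_id
  inv_hom_id := psPull_hom_ext e.inv_hom_id e'.inv_hom_id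

lemma exists_chainPull {JK JL : Type v} [LinearOrder JK] [OrderBot JK]
    [OrderTop JK] [LinearOrder JL] [OrderBot JL] [OrderTop JL] {a b : CellularPaper.PsPull F G}
    (f : a ⟶ b) {X : JK ⥤ K} {Y : JL ⥤ L}
    (eK : Arrow.mk (X.map (homOfLE (bot_le : (⊥ : JK) ≤ ⊤))) ≅ Arrow.mk f.hk)
    (eL : Arrow.mk (Y.map (homOfLE (bot_le : (⊥ : JL) ≤ ⊤))) ≅ Arrow.mk f.hl) :
    ∃ σ : ChainPull F G JK JL, σ.k = X ∧ σ.l = Y ∧ Nonempty (Arrow.mk (endHom σ) ≅ Arrow.mk f) := by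
  let k₀ : X.obj ⊥ ≅ a.k := Arrow.leftFunc.mapIso eK
  let k₁ : X.obj ⊤ ≅ b.k := Arrow.rightFunc.mapIso eK
  let l₀ : Y.obj ⊥ ≅ a.l := Arrow.leftFunc.mapIso eL
  let l₁ : Y.obj ⊤ ≅ b.l := Arrow.rightFunc.mapIso eL
  have hk : k₀.hom ≫ f.hk = X.map (homOfLE bot_le) ≫ k₁.hom := Arrow.w eK.hom
  have hl : l₀.hom ≫ f.hl = Y.map (homOfLE bot_le) ≫ l₁.hom := Arrow.w eL.hom
  clear_value k₀ k₁ l₀ l₁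
  let t₀ : F.obj (X.obj ⊥) ≅ G.obj (Y.obj ⊥) := F.mapIso k₀ ≪≫ a.t ≪≫ G.mapIso l₀.symm
  let t₁ : F.obj (X.obj ⊤) ≅ G.obj (Y.obj ⊤) := F.mapIso k₁ ≪≫ b.t ≪≫ G.mapIso l₁.symm
  have ht₀ : F.map k₀.hom ≫ a.t.hom = t₀.hom ≫ G.map l₀.hom := by
    simp [t₀, ← G.map_comp]
  have ht₁ : F.map k₁.hom ≫ b.t.hom = t₁.hom ≫ G.map l₁.hom := by
    simp [t₁, ← G.map_comp]
  have ht : F.map (X.map (homOfLE bot_le)) ≫ t₁.hom = t₀.hom ≫ G.map (Y.map (homOfLE bot_le)) := by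
    rw [← cancel_mono (G.map l₁.hom), assoc, ← ht₁, ← F.map_comp_assoc, ← hk, F.map_comp_assoc,
      f.w, reassoc_of% ht₀, ← G.map_comp, hl, G.map_comp, assoc]
  clear_value t₀ t₁
  let σ : ChainPull F G JK JL := ⟨X, Y, ComposableArrows.isoMk₁ t₀ t₁ ht⟩
  let e₀ : (evalEnd F G JK JL 0).obj σ ≅ a := psPullIsoMk k₀ l₀ ht₀
  let e₁ : (evalEnd F G JK JL 1).obj σ ≅ b := psPullIsoMk k₁ l₁ ht₁
  exact ⟨σ, rfl, rfl, ⟨Arrow.isoMk e₀ e₁ (psPull_hom_ext hk hl)⟩⟩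

variable {JK JL : Type v} [LinearOrder JK] [OrderBot JK]
  [OrderTop JK] [SuccOrder JK] [LinearOrder JL] [OrderBot JL] [OrderTop JL] [SuccOrder JL]
  {TK : MorphismProperty K} {TL : MorphismProperty L}
  {T : MorphismProperty (CellularPaper.PsPull F G)}

lemma IsCellularPull.of_iso
    (hTK : ∀ ⦃f g : Arrow K⦄ (s : f ⟶ g), linkStep s → TK f.hom → TK g.hom)
    (hTL : ∀ ⦃f g : Arrow L⦄ (s : f ⟶ g), linkStep s → TL f.hom → TL g.hom)
    {σ σ' : ChainPull F G JK JL} (e : σ ≅ σ') (h : IsCellularPull TK TL σ) :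
    IsCellularPull TK TL σ' := by
  have := h.continuousK
  have := h.continuousL
  let eK : σ.k ≅ σ'.k := (CellularPaper.projK _ _).mapIso e
  let eL : σ.l ≅ σ'.l := (CellularPaper.projL _ _).mapIso e
  refine ⟨Functor.isWellOrderContinuous_of_iso eK, Functor.isWellOrderContinuous_of_iso eL,
    fun j hj => hTK ((linkFunctor K j).map eK.hom) (Or.inl ?_) (h.linkK j hj),
    fun j hj => hTL ((linkFunctor L j).map eL.hom) (Or.inl ?_) (h.linkL j hj)⟩
  · exact IsPushout.of_vert_isIso ⟨((linkFunctor K j).map eK.hom).w.symm⟩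
  · exact IsPushout.of_vert_isIso ⟨((linkFunctor L j).map eL.hom).w.symm⟩

variable [HasColimitsOfSize.{v, v} K] [HasColimitsOfSize.{v, v} L] [HasColimitsOfSize.{v, v} M]
  [PreservesColimitsOfSize.{v, v} F] [PreservesColimitsOfSize.{v, v} G] [WellFoundedLT JK]
  [WellFoundedLT JL]

lemma chainComposites_endHom
    (hTK : ∀ ⦃f g : Arrow K⦄ (s : f ⟶ g), linkStep s → TK f.hom → TK g.hom)
    (hTL : ∀ ⦃f g : Arrow L⦄ (s : f ⟶ g), linkStep s → TL f.hom → TL g.hom)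
    (h : ∀ σ : ChainPull F G JK JL, IsCellularPull TK TL σ → ∀ τ,
      ∃ (σ' : ChainPull F G JK JL) (s : σ ⟶ σ'), IsPullStep s ∧ σ'.k.IsWellOrderContinuous ∧
        σ'.l.IsWellOrderContinuous ∧ T ((evalEnd F G JK JL 0).map s) ∧ IsSolved σ' τ)
    (σ : ChainPull F G JK JL) (hσ : IsCellularPull TK TL σ) : chainComposites T (endHom σ) := by
  let _ : SuccOrder (JK ×ₗ JL) := SuccOrder.ofLinearWellFoundedLT _
  obtain ⟨Φ, _, ⟨e⟩, hΦ⟩ := exists_iteration (JK ×ₗ JL) σ (solvingStep (⇑ofLex) TK TL T)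
    (exists_solvingStep h)
  have hc := isCellularPull_obj hTK hTL Φ (hσ.of_iso hTK hTL e) hΦ
  have hs (τ : JK × JL) : IsSolved (Φ.obj ⊤) τ := by
    obtain hτ | hτ := (le_top : toLex τ ≤ ⊤).lt_or_eq
    · exact (hc ⊤).2 _ hτ
    · obtain rfl : τ = (⊤, ⊤) := hτ
      exact ⟨fun h => (h isMax_top).elim, fun h => (h isMax_top).elim⟩
  have := (hc ⊤).1.continuousK
  have := (hc ⊤).1.continuousL
  have h₁ : IsIso (endHom (Φ.obj ⊤)) := psPull_isIso _
    (isIso_map_of_succ (Φ.obj ⊤).k bot_le fun k _ hk => (hs (k, ⊤)).isIsoK hk.not_isMax)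
    (isIso_map_of_succ (Φ.obj ⊤).l bot_le fun k _ hk => (hs (⊤, k)).isIsoL hk.not_isMax)
  have hΦ' := isPullStep_map Φ (fun w hw => (hΦ w hw).1) (bot_le : (⊥ : JK ×ₗ JL) ≤ ⊤)
  have h₂ : IsIso ((evalEnd F G JK JL 1).map (Φ.map (homOfLE (bot_le : (⊥ : JK ×ₗ JL) ≤ ⊤)))) :=
    psPull_isIso _ hΦ'.isIsoK hΦ'.isIsoL
  have : (Φ ⋙ evalEnd F G JK JL 0).IsWellOrderContinuous := psPull_isWellOrderContinuous _
    (isWellOrderContinuous_comp Φ (CellularPaper.projK _ _ ⋙ (evaluation JK K).obj ⊥))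
    (isWellOrderContinuous_comp Φ (CellularPaper.projL _ _ ⋙ (evaluation JL L).obj ⊥))
  refine chainComposites_mk (Φ ⋙ evalEnd F G JK JL 0) (fun w hw => ((hΦ w hw).2 (hc w).1).2.2.1)
    (Arrow.isoMk ((evalEnd F G JK JL 0).mapIso e.symm) (asIso (endHom (Φ.obj ⊤)) ≪≫
      (asIso ((evalEnd F G JK JL 1).map (Φ.map (homOfLE bot_le)))).symm ≪≫
        (evalEnd F G JK JL 1).mapIso e.symm) ?_)
  have h₃ := endHom_naturality (Φ.map (homOfLE (bot_le : (⊥ : JK ×ₗ JL) ≤ ⊤)))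
  have h₄ := endHom_naturality e.inv
  dsimp
  rw [← reassoc_of% h₃, IsIso.hom_inv_id_assoc, h₄]

lemma chainComposites_psPull
    (hTK : ∀ ⦃f g : Arrow K⦄ (s : f ⟶ g), linkStep s → TK f.hom → TK g.hom)
    (hTL : ∀ ⦃f g : Arrow L⦄ (s : f ⟶ g), linkStep s → TL f.hom → TL g.hom)
    (h : ∀ (JK JL : Type v) [LinearOrder JK] [OrderBot JK] [OrderTop JK] [SuccOrder JK]
      [WellFoundedLT JK] [LinearOrder JL] [OrderBot JL] [OrderTop JL] [SuccOrder JL]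
      [WellFoundedLT JL] (σ : ChainPull F G JK JL), IsCellularPull TK TL σ → ∀ τ,
      ∃ (σ' : ChainPull F G JK JL) (s : σ ⟶ σ'), IsPullStep s ∧ σ'.k.IsWellOrderContinuous ∧
        σ'.l.IsWellOrderContinuous ∧ T ((evalEnd F G JK JL 0).map s) ∧ IsSolved σ' τ)
    {a b : CellularPaper.PsPull F G} (f : a ⟶ b) (hK : chainComposites TK f.hk)
    (hL : chainComposites TL f.hl) : chainComposites T f := by
  obtain ⟨JK, _, _, _, _, _, X, hX, hX', ⟨eK⟩⟩ := hK
  obtain ⟨JL, _, _, _, _, _, Y, hY, hY', ⟨eL⟩⟩ := hL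
  obtain ⟨σ, rfl, rfl, ⟨e⟩⟩ := exists_chainPull f eK eL
  exact ((chainComposites T).arrow_mk_iso_iff e).1
    (chainComposites_endHom hTK hTL (h JK JL) σ ⟨hX, hY, hX', hY'⟩)

end PullChains

section Transport

variable {C : Type u} [Category.{v} C] {D : Type u'} [Category.{v} D]

lemma isTransfiniteCompositionOf_map (H : C ⥤ D) [PreservesColimitsOfSize.{v, v} H]
    {S : MorphismProperty C} {T : MorphismProperty D}
    (hST : ∀ ⦃A B : C⦄ (f : A ⟶ B), S f → T (H.map f)) {A B : C} {f : A ⟶ B}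
    (hf : CellularPaper.IsTransfiniteCompositionOf.{v} S f) :
    CellularPaper.IsTransfiniteCompositionOf.{v} T (H.map f) := by
  obtain ⟨J, _, _, _, _, X, c, hc, eA, eB, hX, hl, rfl⟩ := hf
  refine ⟨J, inferInstance, inferInstance, inferInstance, inferInstance, X ⋙ H, H.mapCocone c,
    isColimitOfPreserves H hc, H.mapIso eA, H.mapIso eB, fun j hj => hST _ (hX j hj),
    fun j hj => ?_, by simp⟩
  obtain ⟨h⟩ := hl j hj
  exact ⟨isColimitOfPreserves H h⟩

lemma Po_of_linkStep {S : MorphismProperty C} (hS : ∀ A : C, ∃ (U : C) (_ : U ⟶ A), S (𝟙 U))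
    ⦃f g : Arrow C⦄ (s : f ⟶ g) (h : linkStep s) (hf : CellularPaper.Po S f.hom) :
    CellularPaper.Po S g.hom :=
  h.elim (fun h => Po_of_isPushout h hf) (Po_of_isIso hS _)

lemma exists_betweenPresentable_id {κ : Cardinal.{v}} [Fact κ.IsRegular]
    (h : HasPresentations C κ) {S : MorphismProperty C} (hS : ∀ A : C, S (𝟙 A)) (A : C) :
    ∃ (U : C) (_ : U ⟶ A), CellularPaper.betweenPresentable κ S (𝟙 U) := by
  obtain ⟨P, _, _, X, c, -, hX⟩ := h A
  obtain ⟨p⟩ := (isFiltered_of_isCardinalFiltered P κ).nonempty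
  have hp := (isCardinalPresentable_iff κ _).2 (hX p)
  exact ⟨_, c.app p, hS _, hp, hp⟩

lemma exists_ofFamily_eq {κ : Cardinal.{v}} [Fact κ.IsRegular]
    [h : ObjectProperty.EssentiallySmall.{v} (isCardinalPresentable C κ)]
    (S : MorphismProperty C) [S.RespectsIso] :
    ∃ (ι : Type v) (a b : ι → C) (s : ∀ i, a i ⟶ b i),
      CellularPaper.ofFamily s = CellularPaper.betweenPresentable κ S := by
  obtain ⟨Q, _, hQ, hQ'⟩ := h.exists_small_le
  let e (x : Shrink.{v} (Subtype Q)) : C := ((equivShrink _).symm x).1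
  have he (x) : CellularPaper.IsCardinalPresentable κ (e x) :=
    (isCardinalPresentable_iff κ _).2 (hQ _ ((equivShrink _).symm x).2)
  have he' (A : C) (hA : CellularPaper.IsCardinalPresentable κ A) :
      ∃ x, Nonempty (A ≅ e x) := by
    obtain ⟨B, hB, ⟨i⟩⟩ := hQ' A ((isCardinalPresentable_iff κ A).1 hA)
    refine ⟨equivShrink _ ⟨B, hB⟩, ⟨i ≪≫ eqToIso ?_⟩⟩
    simp [e]
  refine ⟨Σ x y, { f : e x ⟶ e y // S f }, fun i => e i.1, fun i => e i.2.1, fun i => i.2.2.1, ?_⟩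
  ext A B f
  constructor
  · rintro ⟨⟨x, y, g, hg⟩, ⟨i⟩⟩
    refine ⟨(S.arrow_mk_iso_iff i).2 hg, ?_, ?_⟩
    · have : IsCardinalPresentable (Arrow.leftFunc.obj (Arrow.mk g)) κ :=
        (isCardinalPresentable_iff κ _).1 (he x)
      exact (isCardinalPresentable_iff κ _).2
        (isCardinalPresentable_of_iso (Arrow.leftFunc.mapIso i).symm κ)
    · have : IsCardinalPresentable (Arrow.rightFunc.obj (Arrow.mk g)) κ :=
        (isCardinalPresentable_iff κ _).1 (he y)
      exact (isCardinalPresentable_iff κ _).2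
        (isCardinalPresentable_of_iso (Arrow.rightFunc.mapIso i).symm κ)
  · rintro ⟨hf, hA, hB⟩
    obtain ⟨x, ⟨i⟩⟩ := he' A hA
    obtain ⟨y, ⟨j⟩⟩ := he' B hB
    have w : i.hom ≫ i.inv ≫ f ≫ j.hom = f ≫ j.hom := i.hom_inv_id_assoc _
    exact ⟨⟨x, y, i.inv ≫ f ≫ j.hom,
      (S.arrow_mk_iso_iff (Arrow.isoMk i j w : Arrow.mk f ≅ Arrow.mk (i.inv ≫ f ≫ j.hom))).1 hf⟩,
      ⟨Arrow.isoMk i j w⟩⟩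

lemma isCellular_respectsIso {S : MorphismProperty C} (hS : CellularPaper.IsCellular S) :
    S.RespectsIso :=
  MorphismProperty.RespectsIso.of_respects_arrow_iso _ fun _ _ i h =>
    hS.pushout (IsPushout.of_vert_isIso ⟨i.hom.w.symm⟩ : IsPushout _ i.hom.left i.hom.right _) h

end Transport

section Pull

variable {K : Type u} {L : Type u'} {M : Type u''} [Category.{v} K] [Category.{v} L]
  [Category.{v} M] {F : K ⥤ M} {G : L ⥤ M} {WK : MorphismProperty K} {WL : MorphismProperty L}

lemma retracts_psClass_le (hK : CellularPaper.retracts WK ≤ WK)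
    (hL : CellularPaper.retracts WL ≤ WL) :
    CellularPaper.retracts (CellularPaper.PsClass (F := F) (G := G) WK WL) ≤
      CellularPaper.PsClass WK WL := by
  rintro a b f ⟨x, y, g, hg, i, j, r, s, h₁, h₂, h₃, h₄⟩
  exact ⟨hK _ ⟨_, _, g.hk, hg.1, i.hk, j.hk, r.hk, s.hk, congrArg (·.hk) h₁,
      congrArg (·.hk) h₂, congrArg (·.hk) h₃, congrArg (·.hk) h₄⟩,
    hL _ ⟨_, _, g.hl, hg.2, i.hl, j.hl, r.hl, s.hl, congrArg (·.hl) h₁,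
      congrArg (·.hl) h₂, congrArg (·.hl) h₃, congrArg (·.hl) h₄⟩⟩

variable [HasColimitsOfSize.{v, v} K] [HasColimitsOfSize.{v, v} L]
  [PreservesColimitsOfSize.{v, v} F] [PreservesColimitsOfSize.{v, v} G]

lemma isCellular_psClass (hK : CellularPaper.IsCellular WK) (hL : CellularPaper.IsCellular WL) :
    CellularPaper.IsCellular (CellularPaper.PsClass (F := F) (G := G) WK WL) where
  isos f _ := ⟨hK.isos _ (inferInstanceAs (IsIso ((CellularPaper.projK F G).map f))),
    hL.isos _ (inferInstanceAs (IsIso ((CellularPaper.projL F G).map f)))⟩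
  pushout h hf :=
    ⟨hK.pushout (h.map (CellularPaper.projK F G)) hf.1,
      hL.pushout (h.map (CellularPaper.projL F G)) hf.2⟩
  transfinite _ hf :=
    ⟨hK.transfinite _ (isTransfiniteCompositionOf_map (CellularPaper.projK F G)
      (fun _ _ _ h => h.1) hf),
    hL.transfinite _ (isTransfiniteCompositionOf_map (CellularPaper.projL F G)
      (fun _ _ _ h => h.2) hf)⟩

variable [HasColimitsOfSize.{v, v} M] {κ : Cardinal.{v}} [Fact κ.IsRegular]

lemma psClass_le_chainComposites (hκ : Cardinal.aleph0 < κ) (hK : HasPresentations K κ)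
    (hL : HasPresentations L κ)
    (hF : ∀ A : K, IsCardinalPresentable A κ → IsCardinalPresentable (F.obj A) κ)
    (hG : ∀ A : L, IsCardinalPresentable A κ → IsCardinalPresentable (G.obj A) κ)
    (hWK : CellularPaper.IsCellular WK) (hWL : CellularPaper.IsCellular WL)
    (hgenK : WK ≤ CellularPaper.cellClosure (CellularPaper.betweenPresentable κ WK))
    (hgenL : WL ≤ CellularPaper.cellClosure (CellularPaper.betweenPresentable κ WL)) :
    CellularPaper.PsClass (F := F) (G := G) WK WL ≤ chainComposites (CellularPaper.Po
      (CellularPaper.betweenPresentable κ (CellularPaper.PsClass WK WL))) := by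
  intro a b f hf
  have hidK := exists_betweenPresentable_id hK fun A => hWK.isos (𝟙 A) inferInstance
  have hidL := exists_betweenPresentable_id hL fun A => hWL.isos (𝟙 A) inferInstance
  exact chainComposites_psPull (Po_of_linkStep hidK) (Po_of_linkStep hidL)
    (fun JK JL _ _ _ _ _ _ _ _ _ _ σ hσ τ =>
      exists_isPullStep hκ hK hL hF hG hWK hWL hσ τ) f
    (cellClosure_le_chainComposites hidK _ (hgenK _ hf.1))
    (cellClosure_le_chainComposites hidL _ (hgenL _ hf.2))

end Pull

end CellularChain

namespace CellularPaper

/-- the pseudopullback of combinatorial categories is combinatorial.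
With κ suitably large, `Ps(cof K, cof L)` equals the cellular closure of the set of
morphisms between κ-presentable objects of `P` whose projections are cofibrations;
in particular it is cofibrantly generated by a set. -/
theorem combinatorial_pseudopullback {K : Type u} {L : Type u'} {M : Type u''}
    [Category.{v} K] [Category.{v} L] [Category.{v} M]
    (F : K ⥤ M) (G : L ⥤ M) [PreservesColimits F] [PreservesColimits G]
    (cofK : MorphismProperty K) (cofL : MorphismProperty L) (cofM : MorphismProperty M)
    (hcombK : IsCombinatorial K cofK) (hcombL : IsCombinatorial L cofL)
    (hcombM : IsCombinatorial M cofM)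
    (hF : ∀ ⦃A B : K⦄ (f : A ⟶ B), cofK f → cofM (F.map f))
    (hG : ∀ ⦃A B : L⦄ (f : A ⟶ B), cofL f → cofM (G.map f))
    (κ : Cardinal.{v}) (hκ : Cardinal.aleph0 < κ)
    (hK : IsLocallyPresentable κ K) (hL : IsLocallyPresentable κ L)
    (hM : IsLocallyPresentable κ M) (hP : IsLocallyPresentable κ (PsPull F G))
    (hgenK : cofK = cellClosure (betweenPresentable κ cofK))
    (hgenL : cofL = cellClosure (betweenPresentable κ cofL))
    (hFpres : ∀ A : K, IsCardinalPresentable κ A → IsCardinalPresentable κ (F.obj A))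
    (hGpres : ∀ A : L, IsCardinalPresentable κ A → IsCardinalPresentable κ (G.obj A))
    (hPK : ∀ a : PsPull F G, IsCardinalPresentable κ a → IsCardinalPresentable κ a.k)
    (hPL : ∀ a : PsPull F G, IsCardinalPresentable κ a → IsCardinalPresentable κ a.l) :
    PsClass (F := F) (G := G) cofK cofL =
      cellClosure (betweenPresentable κ (PsClass cofK cofL)) ∧
    IsCofibrantlyGenerated (PsClass (F := F) (G := G) cofK cofL) := by
  have : Fact κ.IsRegular := ⟨hK.regular⟩
  have := hK.hasColimits
  have := hL.hasColimits
  have := hM.hasColimits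
  have hcell : IsCellular (PsClass (F := F) (G := G) cofK cofL) :=
    CellularChain.isCellular_psClass hcombK.cellular hcombL.cellular
  have hle : PsClass (F := F) (G := G) cofK cofL ≤
      CellularChain.chainComposites (Po (betweenPresentable κ (PsClass cofK cofL))) :=
    CellularChain.psClass_le_chainComposites hκ (CellularChain.hasPresentations κ hK)
      (CellularChain.hasPresentations κ hL)
      (fun A hA => (CellularChain.isCardinalPresentable_iff κ _).1
        (hFpres A ((CellularChain.isCardinalPresentable_iff κ A).2 hA)))
      (fun A hA => (CellularChain.isCardinalPresentable_iff κ _).1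
        (hGpres A ((CellularChain.isCardinalPresentable_iff κ A).2 hA)))
      hcombK.cellular hcombL.cellular hgenK.le hgenL.le
  have hX : betweenPresentable κ (PsClass (F := F) (G := G) cofK cofL) ≤ PsClass cofK cofL :=
    fun _ _ _ h => h.1
  refine ⟨le_antisymm (hle.trans fun _ _ f hf W hW hS => ?_) fun _ _ f hf => hf _ hcell hX, ?_⟩
  · exact CellularChain.chainComposites_le_of_isCellular hW _
      (CellularChain.chainComposites_mono (CellularChain.Po_le_of_isCellular hW hS) _ hf)
  · have := CellularChain.essentiallySmall_isCardinalPresentable κ hP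
    have := CellularChain.isCellular_respectsIso hcell
    obtain ⟨ι, a, b, s, hs⟩ := CellularChain.exists_ofFamily_eq (κ := κ)
      (PsClass (F := F) (G := G) cofK cofL)
    refine ⟨ι, a, b, s, le_antisymm (fun A B f hf => ?_) fun A B f hf => ?_⟩
    · rw [hs]
      exact ⟨A, B, f, CellularChain.isTransfiniteCompositionOf_of_chainComposites _ _ (hle _ hf),
        𝟙 A, 𝟙 B, 𝟙 A, 𝟙 B, by simp⟩
    · rw [hs] at hf
      obtain ⟨X, Y, g, ⟨J, _, _, _, _, D, c, hc, eA, eB, hD, hl, rfl⟩, hr⟩ := hf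
      exact CellularChain.retracts_psClass_le hcombK.retractClosed hcombL.retractClosed _
        ⟨X, Y, _, hcell.transfinite _ ⟨J, _, _, _, ‹_›, D, c, hc, eA, eB, fun j hj =>
          CellularChain.Po_le_of_isCellular hcell hX _ (hD j hj), hl, rfl⟩, hr⟩

end CellularPaper
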